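/- Let X = A_5 be embedded in Y = C_{10} = Sp_{20} via the 20-dimensional irreducible representation of highest weight δ = ω_3, and let V = V_Y(λ) where λ is a dominant weight for Y with λ ≠ 0, λ_1. Then V↓X is multiplicity-free if and only if λ is one of: λ_i (2 ≤ i ≤ 10), cλ_1 (1 ≤ c ≤ 5), λ_1+λ_2, λ_1+λ_3, λ_1+λ_4, λ_1+λ_{10}, 2λ_2, or 2λ_1+λ_2. -/

import Mathlib

/-!
# Common framework

Over an algebraically closed field of characteristic zero, finite–dimensional rational
representations of a simple algebraic group are semisimple and are determined by their
formal characters, i.e. by elements of the group ring of the (rational) weight lattice;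
the character of the irreducible module of highest weight `λ` is pinned down by the
Weyl character formula `A_ρ · χ_λ = A_{λ+ρ}`.

Below we model, completely combinatorially:

* type `A_r` : weights are realised by their traceless representatives in `Fin (r+1) → ℚ`
  (the `gl`-coordinates), and the Weyl group is the symmetric group;
* types `B_n, C_n, D_n` : weights are realised in the standard `ε`-coordinates
  `Fin n → ℚ`, and the Weyl group consists of (signed) permutations, with evenly many
  sign changes in type `D`;
* an embedding `X = A_r < Y` (classical of type `t` and rank `n`) in which `X` acts on
  the natural module `W` of `Y` irreducibly with highest weight `δ` : the weights of `W`
  are `± w i` (plus one zero weight in type `B`), and restriction of characters is induced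
  by the map `v ↦ ∑ i, v i • w i` of weight lattices;
* `IsMFRes t n r δ lam` : the restriction to `X` of the irreducible `Y`-module with
  highest weight `lam` is multiplicity-free, i.e. its character is a sum of distinct
  irreducible characters of `X`.

Dominant weights are always recorded by their (natural number) coordinates in the basis
of fundamental weights, `e n k` being the `k`-th fundamental weight (1-indexed).
-/

noncomputable section

namespace MFPaper

/-- The Dynkin type of a classical group `B_n = SO_{2n+1}`, `C_n = Sp_{2n}`, `D_n = SO_{2n}`. -/
inductive CType | B | C | D
deriving DecidableEq

/-- The character ring: the integral group ring of a rational weight space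
with `k` coordinates. -/
abbrev CharRing (k : ℕ) : Type := AddMonoidAlgebra ℤ (Fin k → ℚ)

/-- The formal exponential `e^v` of a weight `v`. -/
def mono {k : ℕ} (v : Fin k → ℚ) : CharRing k := AddMonoidAlgebra.single v 1

/-- `e n k` : the `k`-th fundamental dominant weight (`1 ≤ k ≤ n`, 1-indexed) of a rank `n`
group, recorded by its coordinates in the basis of fundamental weights. -/
def e (n k : ℕ) : Fin n → ℕ := fun i => if (i : ℕ) + 1 = k then 1 else 0

/-! ### Type `A_r` -/

/-- The partition (`gl`) lift of the dominant weight of `A_r` with coordinates `d`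
in the basis of fundamental weights. -/
def partLift (r : ℕ) (d : Fin r → ℕ) : Fin (r + 1) → ℚ := fun i =>
  ∑ j ∈ Finset.univ.filter (fun j : Fin r => (i : ℕ) ≤ (j : ℕ)), (d j : ℚ)

/-- The traceless (`sl`) representative of the dominant weight of `A_r` with coordinates `d`. -/
def slWt (r : ℕ) (d : Fin r → ℕ) : Fin (r + 1) → ℚ := fun i =>
  partLift r d i - (∑ j : Fin r, (((j : ℕ) : ℚ) + 1) * (d j : ℚ)) / (r + 1)

/-- A lift of the half-sum of the positive roots of `A_r`. -/
def rhoA (r : ℕ) : Fin (r + 1) → ℚ := fun i => (r : ℚ) - (i : ℕ)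

/-- The Weyl alternating sum `A_v = ∑_{σ} sgn(σ) e^{σ v}` for type `A_r`. -/
def altA (r : ℕ) (v : Fin (r + 1) → ℚ) : CharRing (r + 1) :=
  ∑ σ : Equiv.Perm (Fin (r + 1)),
    ((Equiv.Perm.sign σ : ℤˣ) : ℤ) • mono (fun i => v (σ i))

/-- `IsCharA r d f` : `f` is the formal character of the irreducible `A_r`-module
of highest weight `d` (Weyl character formula). -/
def IsCharA (r : ℕ) (d : Fin r → ℕ) (f : CharRing (r + 1)) : Prop :=
  altA r (rhoA r) * f = altA r (slWt r d + rhoA r)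

/-- `Decomp r F c` : the character `F` of a representation of `A_r` decomposes as
`∑_μ (c μ) · χ_μ`, i.e. the irreducible of highest weight `μ` occurs in it as a
composition factor with multiplicity `c μ`. -/
def Decomp (r : ℕ) (F : CharRing (r + 1)) (c : (Fin r → ℕ) →₀ ℕ) : Prop :=
  F * altA r (rhoA r) = c.sum fun μ k => (k : ℤ) • altA r (slWt r μ + rhoA r)

/-- The Weyl dimension formula for type `A_r`. -/
def dimA (r : ℕ) (d : Fin r → ℕ) : ℚ :=
  ∏ p ∈ Finset.univ.filter (fun p : Fin (r + 1) × Fin (r + 1) => (p.1 : ℕ) < (p.2 : ℕ)),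
    ((partLift r d p.1 - partLift r d p.2 + ((p.2 : ℕ) : ℚ) - ((p.1 : ℕ) : ℚ)) /
      (((p.2 : ℕ) : ℚ) - ((p.1 : ℕ) : ℚ)))

/-- The self-dual irreducible `A_r`-module of highest weight `d` is *symplectic*
(it carries an invariant alternating form); by Steinberg's criterion this happens
exactly when `⟨d, 2ρ^∨⟩ = ∑ d_k · k(r+1-k)` is odd. -/
def IsSympWt (r : ℕ) (d : Fin r → ℕ) : Prop :=
  Odd (∑ i : Fin r, d i * ((i : ℕ) + 1) * (r - (i : ℕ)))

/-! ### The classical types `B`, `C`, `D` -/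

/-- Convenient access to the `k`-th (0-indexed) coordinate. -/
def cval {n : ℕ} (c : Fin n → ℕ) (k : ℕ) : ℚ := if h : k < n then (c ⟨k, h⟩ : ℚ) else 0

/-- `ε`-coordinates of the dominant weight of the classical group of type `t` and rank `n`
with coordinates `c` in the basis of fundamental weights (Bourbaki numbering). -/
def epsWt (t : CType) (n : ℕ) (c : Fin n → ℕ) : Fin n → ℚ := fun i =>
  (∑ k ∈ Finset.univ.filter (fun k : Fin n => (i : ℕ) ≤ (k : ℕ)), (c k : ℚ)) -
    (match t with
      | .C => 0
      | .B => cval c (n - 1) / 2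
      | .D => (cval c (n - 2) + cval c (n - 1)) / 2)

/-- The half-sum of the positive roots in `ε`-coordinates. -/
def rhoY (t : CType) (n : ℕ) : Fin n → ℚ := fun i =>
  match t with
  | .C => (n : ℚ) - (i : ℕ)
  | .B => (n : ℚ) - (i : ℕ) - 1 / 2
  | .D => (n : ℚ) - 1 - (i : ℕ)

/-- The Weyl alternating sum for the classical group of type `t` and rank `n`:
the Weyl group consists of the signed permutations of the coordinates,
with evenly many sign changes in type `D`. -/
def altY (t : CType) (n : ℕ) (v : Fin n → ℚ) : CharRing n :=
  ∑ σ : Equiv.Perm (Fin n), ∑ s : Fin n → Bool,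
    if t = CType.D ∧ ¬ Even (Finset.univ.filter (fun i => s i = true)).card then 0
    else (((Equiv.Perm.sign σ : ℤˣ) : ℤ) *
          (-1) ^ (Finset.univ.filter (fun i => s i = true)).card) •
      mono (fun i => (if s i then -1 else 1) * v (σ i))

/-- `IsCharY t n c f` : `f` is the formal character of the irreducible module of highest
weight `c` for the classical group of type `t` and rank `n` (Weyl character formula). -/
def IsCharY (t : CType) (n : ℕ) (c : Fin n → ℕ) (f : CharRing n) : Prop :=
  altY t n (rhoY t n) * f = altY t n (epsWt t n c + rhoY t n)

/-! ### The embedding `X = A_r < Y` via `δ`, and restriction of characters -/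

/-- `WtSys t n r δ w` : `w` lists "half" of the weights of the natural module
`W = V_X(δ)` of the classical group `Y` of type `t` and rank `n`, for `X = A_r`:
the weights of `W` (with multiplicity) are exactly the `± w i`, together with one
extra zero weight in type `B`.  Such a `w` records a maximal torus embedding
`T_X → T_Y` realising the irreducible embedding `X < Y = SO(W)` or `Sp(W)` given
by the representation of highest weight `δ`. -/
def WtSys (t : CType) (n r : ℕ) (δ : Fin r → ℕ)
    (w : Fin n → (Fin (r + 1) → ℚ)) : Prop :=
  ((∑ i : Fin n, (mono (w i) + mono (-(w i)))) +
      (if t = CType.B then mono (0 : Fin (r + 1) → ℚ) else 0)) * altA r (rhoA r)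
    = altA r (slWt r δ + rhoA r)

/-- Restriction of characters from `Y` to `X = A_r` along the torus embedding
recorded by `w`. -/
def resChar {n r : ℕ} (w : Fin n → (Fin (r + 1) → ℚ)) (F : CharRing n) :
    CharRing (r + 1) :=
  AddMonoidAlgebra.mapDomain (fun v : Fin n → ℚ => ∑ i : Fin n, v i • w i) F

/-- `IsMFRes t n r δ lam` : in the embedding `X = A_r < Y` (the classical group of type
`t` and rank `n`) given by the irreducible representation of highest weight `δ`, the
restriction to `X` of the irreducible `Y`-module of highest weight `lam` is
multiplicity-free: its character is a sum of *distinct* irreducible characters of `X`. -/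
def IsMFRes (t : CType) (n r : ℕ) (δ : Fin r → ℕ) (lam : Fin n → ℕ) : Prop :=
  ∀ w, WtSys t n r δ w → ∀ f, IsCharY t n lam f →
    ∃ c : (Fin r → ℕ) →₀ ℕ, Decomp r (resChar w f) c ∧ ∀ μ, c μ ≤ 1

/-- The operation `e^v ↦ e^{k·v}` on characters (Adams operation on the torus),
used to express symmetric and exterior powers of characters. -/
def pw {m : ℕ} (k : ℕ) (F : CharRing m) : CharRing m :=
  AddMonoidAlgebra.mapDomain (fun v : Fin m → ℚ => (k : ℚ) • v) F

/-- The irreducible `A_r`-module of highest weight `d` carries a nonzero invariant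
*symmetric* bilinear form, i.e. the trivial module occurs in its symmetric square
(whose character `S` satisfies `2S = f² + f^{[2]}`). -/
def HasSymForm (r : ℕ) (d : Fin r → ℕ) : Prop :=
  ∀ f, IsCharA r d f →
    ∃ c : (Fin r → ℕ) →₀ ℕ,
      (f * f + pw 2 f) * altA r (rhoA r)
          = c.sum (fun μ k => ((2 * k : ℕ) : ℤ) • altA r (slWt r μ + rhoA r)) ∧ 1 ≤ c 0

/-- The irreducible `A_r`-module of highest weight `d` carries a nonzero invariant
*alternating* bilinear form, i.e. the trivial module occurs in its exterior square
(whose character `Λ` satisfies `2Λ = f² - f^{[2]}`). -/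
def HasAltForm (r : ℕ) (d : Fin r → ℕ) : Prop :=
  ∀ f, IsCharA r d f →
    ∃ c : (Fin r → ℕ) →₀ ℕ,
      (f * f - pw 2 f) * altA r (rhoA r)
          = c.sum (fun μ k => ((2 * k : ℕ) : ℤ) • altA r (slWt r μ + rhoA r)) ∧ 1 ≤ c 0

end MFPaper

open MFPaper

set_option linter.all false

namespace Cas
open AddMonoidAlgebra (single single_mul_single single_add one_def coeff_sum coeff_smul coeff_sub smul_single mapDomainRingHom mapDomainRingHom_apply mapDomain_single coeff_mapDomain)
open Matrix (single_apply diagonal mul_diagonal mulVec mulVec_diagonal add_mulVec mulVec_mulVec trace det_transpose det_apply' transpose_apply submatrix_apply of_apply map_apply det_permute diagonal_apply fromBlocks fromBlocks_neg transpose_mul fromBlocks_toBlocks fromBlocks_add toBlocks₁₁ toBlocks₁₂ toBlocks₂₁ toBlocks₂₂ transpose_add transpose_smul det_apply smul_mul induction_on' updateCol_apply)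
open Finset (sum_add_distrib sum_mul mul_sum sum_congr sum_sub_distrib induction_on sum_insert smul_sum sum_comm univ mul_prod_erase mem_univ prod_empty prod_insert sum_eq_zero sum_smul mem_filter univ_unique sum_singleton prod_ne_zero_iff sum_subset prod_mul_distrib sum_eq_single prod_congr ne_of_mem_erase sum_const_zero sum_filter add_sum_erase)
open Finsupp (coe_finsetSum mapDomain_apply)
open Polynomial (aeval aeval_C eval_X monic_X)
open MvPolynomial (smul_eq_C_mul mkDerivation_X)
open List (range length_cons map_cons sum_cons map_map map_congr_left mem_map all_eq_true mem_cons all_cons pairwise_cons)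
open Module (finrank Basis End)
open AddMonoidHom (coe_mk)
open Function (Injective update)
open Equiv (Perm sum_comp prod_comp swap swap_apply_def)
open Equiv.Perm (sign sign_swap)
open Nat (cast_sub beq_eq eq_of_beq_eq_true blt_eq)
open Fin (rev revPerm ext_iff)
open Pi (single_neg)
open RingHom (map_det mapMatrix_apply id_apply)
open Sum (elim elim_inl elim_inr)
open Derivation (leibniz map_algebraMap)
open Submodule (smul_mem add_mem mem_one mul_mem_mul mem_iSup_of_mem)
open Algebra (adjoin)
open Bool (and_eq_true eq_false_iff)
abbrev MF (k : ℕ) := Matrix (Fin k) (Fin k) ℚ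
section
abbrev QR (k : ℕ) := AddMonoidAlgebra ℚ (Fin k → ℚ)

def qm {k : ℕ} (q : (Fin k → ℚ) → ℚ) : QR k →ₗ[ℚ] QR k where
  toFun F := ⟨Finsupp.onFinset F.coeff.support (fun v => q v * F.coeff v) (by
    intro v hv; simp only [Finsupp.mem_support_iff]; intro h; simp [h] at hv)⟩
  map_add' F G := by ext v; simp [mul_add]
  map_smul' c F := by ext v; simp; ring

@[simp] theorem coeff_qm {k : ℕ} (q : (Fin k → ℚ) → ℚ) (F : QR k) (v) :
    (qm q F).coeff v = q v * F.coeff v := rfl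

@[simp] theorem qm_single {k : ℕ} (q : (Fin k → ℚ) → ℚ) (v) (c : ℚ) :
    qm q (single v c) = single v (q v * c) := by
  ext u; simp [Finsupp.single_apply]; by_cases h : v = u <;> simp [h]

theorem ind {k : ℕ} {p : QR k → Prop} (h1 : ∀ v c, p (single v c))
    (h2 : ∀ F G, p F → p G → p (F + G)) (F : QR k) : p F := by
  have h0 : p 0 := by simpa using h1 0 0
  refine AddMonoidAlgebra.induction_linear (motive := p) F h0 (fun f g => h2 f g) (fun v c => h1 v c)

theorem qm_mul {k : ℕ} (q : (Fin k → ℚ) → ℚ) (hq : ∀ u v, q (u + v) = q u + q v) (F G : QR k) :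
    qm q (F * G) = qm q F * G + F * qm q G := by
  induction F using ind with
  | h2 F F' h h' => simp only [add_mul, map_add, h, h']; ring
  | h1 v c =>
    induction G using ind with
    | h2 F F' h h' => simp only [mul_add, map_add, h, h']; ring
    | h1 u d =>
      simp only [single_mul_single, qm_single, hq, ← single_add]
      congr 1; ring

def dt {k : ℕ} (u v : Fin k → ℚ) : ℚ := ∑ i, u i * v i

theorem dt_add {k : ℕ} (u v w : Fin k → ℚ) : dt u (v + w) = dt u v + dt u w := by
  simp [dt, mul_add, sum_add_distrib]
theorem add_dt {k : ℕ} (u v w : Fin k → ℚ) : dt (u + v) w = dt u w + dt v w := by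
  simp [dt, add_mul, sum_add_distrib]
theorem dt_comm {k : ℕ} (u v : Fin k → ℚ) : dt u v = dt v u := by
  simp [dt, mul_comm]
theorem dt_neg {k : ℕ} (u v : Fin k → ℚ) : dt u (-v) = - dt u v := by
  simp [dt]

def nsq {k : ℕ} (v : Fin k → ℚ) : ℚ := dt v v

theorem single_sum' {k : ℕ} {B : Type} (s : Finset B) (v : Fin k → ℚ) (g : B → ℚ) :
    (single v (∑ b ∈ s, g b) : QR k) = ∑ b ∈ s, single v (g b) :=
  map_sum (AddMonoidAlgebra.singleAddHom v) g s

theorem lap_mul {k : ℕ} (F G : QR k) :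
    qm nsq (F * G) = qm nsq F * G + 2 * (∑ i, qm (fun v => v i) F * qm (fun v => v i) G)
      + F * qm nsq G := by
  induction F using ind with
  | h2 F F' h h' => simp only [add_mul, map_add, h, h', sum_add_distrib]; ring
  | h1 v c =>
    induction G using ind with
    | h2 F F' h h' => simp only [mul_add, map_add, h, h', sum_add_distrib]; ring
    | h1 u d =>
      simp only [single_mul_single, qm_single]
      have : (2 : QR k) = single 0 2 := by
        rw [show (2 : QR k) = 1 + 1 by norm_num, one_def, ← single_add]
        norm_num
      rw [← single_sum', this, single_mul_single, zero_add, ← single_add,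
        ← single_add]
      congr 1
      simp only [nsq, dt, Pi.add_apply]
      simp only [sum_mul, mul_sum, ← sum_add_distrib]
      refine sum_congr rfl fun i _ => ?_
      ring

variable {k : ℕ} {ι : Type} [Fintype ι] [DecidableEq ι]

def gtr (wt : ι → Fin k → ℚ) (Z : Matrix ι ι ℚ) : QR k :=
  ∑ i, single (wt i) (Z i i)

theorem gtr_add (wt : ι → Fin k → ℚ) (Z Y : Matrix ι ι ℚ) : gtr wt (Z + Y) = gtr wt Z + gtr wt Y := by
  simp [gtr, sum_add_distrib]
theorem gtr_sub (wt : ι → Fin k → ℚ) (Z Y : Matrix ι ι ℚ) : gtr wt (Z - Y) = gtr wt Z - gtr wt Y := by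
  simp [gtr, sum_sub_distrib]
theorem gtr_sum {A : Type} (s : Finset A) (wt : ι → Fin k → ℚ) (Z : A → Matrix ι ι ℚ) :
    gtr wt (∑ a ∈ s, Z a) = ∑ a ∈ s, gtr wt (Z a) := by
  classical
  induction s using induction_on with
  | empty => simp [gtr]
  | insert a s h ih => rw [sum_insert h, sum_insert h, gtr_add, ih]
theorem gtr_smul (wt : ι → Fin k → ℚ) (c : ℚ) (Z : Matrix ι ι ℚ) : gtr wt (c • Z) = c • gtr wt Z := by
  simp [gtr, smul_sum]

theorem gtr_diag (wt : ι → Fin k → ℚ) (Z : Matrix ι ι ℚ) (q : (Fin k → ℚ) → ℚ) :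
    gtr wt (Z * diagonal (fun i => q (wt i))) = qm q (gtr wt Z) := by
  simp only [gtr, map_sum, qm_single, mul_diagonal]
  simp only [mul_comm]

theorem gtr_ef (wt : ι → Fin k → ℚ) (α : Fin k → ℚ) (Z e f : Matrix ι ι ℚ)
    (hf : ∀ i j, f i j ≠ 0 → wt i + α = wt j) (hZf : Z * f = f * Z)
    (hef : e * f - f * e = diagonal (fun i => dt α (wt i))) :
    gtr wt (Z * e * f) * (1 - single (-α) 1) = qm (dt α) (gtr wt Z) := by
  have h1 : gtr wt (Z * e * f) * single (-α) 1 = gtr wt (f * (Z * e)) := by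
    simp only [gtr, sum_mul, single_mul_single, mul_one]
    have h2 : ∀ i, single (wt i + -α) ((Z * e * f) i i) =
        ∑ j, single (wt j) ((Z * e) i j * f j i) := by
      intro i
      rw [Matrix.mul_apply, single_sum']
      refine sum_congr rfl fun j _ => ?_
      by_cases h : f j i = 0
      · simp [h]
      · rw [← hf j i h]; simp
    simp only [h2]
    rw [sum_comm]
    refine sum_congr rfl fun j _ => ?_
    rw [Matrix.mul_apply, single_sum']
    exact sum_congr rfl fun i _ => by rw [mul_comm]
  rw [mul_sub, mul_one, h1, ← mul_assoc, ← hZf, mul_assoc, mul_assoc, ← gtr_sub, ← mul_sub, hef,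
    gtr_diag]

structure CD (k : ℕ) (ι A : Type) [Fintype ι] [DecidableEq ι] [Fintype A] [DecidableEq A] where
  wt : ι → Fin k → ℚ
  α : A → Fin k → ℚ
  e : A → Matrix ι ι ℚ
  f : A → Matrix ι ι ℚ
  he : ∀ a i j, e a i j ≠ 0 → wt i = wt j + α a
  hf : ∀ a i j, f a i j ≠ 0 → wt i + α a = wt j
  hef : ∀ a, e a * f a - f a * e a = diagonal (fun i => dt (α a) (wt i))
  ρ : Fin k → ℚ
  hρ : ∀ i, 2 * dt ρ (wt i) = ∑ a, dt (α a) (wt i)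
  hce : ∀ b, (diagonal (fun i => nsq (wt i)) + ∑ a, (e a * f a + f a * e a)) * e b =
    e b * (diagonal (fun i => nsq (wt i)) + ∑ a, (e a * f a + f a * e a))
  hcf : ∀ b, (diagonal (fun i => nsq (wt i)) + ∑ a, (e a * f a + f a * e a)) * f b =
    f b * (diagonal (fun i => nsq (wt i)) + ∑ a, (e a * f a + f a * e a))

namespace CD
variable {A : Type} [Fintype A] [DecidableEq A] (C : CD k ι A)

def Ω : Matrix ι ι ℚ :=
  diagonal (fun i => nsq (C.wt i)) + ∑ a, (C.e a * C.f a + C.f a * C.e a)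

def D : QR k := single C.ρ 1 * ∏ a, (1 - single (-C.α a) 1)

def Da (a : A) : QR k := single C.ρ 1 *
  ∏ b ∈ univ.erase a, (1 - single (-C.α b) 1)

theorem D_eq (a : A) : C.D = C.Da a * (1 - single (-C.α a) 1) := by
  rw [D, Da, mul_assoc, mul_comm (∏ b ∈ _, _), mul_prod_erase univ (fun b => (1 - single (-C.α b) 1 : QR k)) (mem_univ a)]

theorem qm_prod (q : (Fin k → ℚ) → ℚ) (hq : ∀ u v, q (u + v) = q u + q v) (s : Finset A)
    (g : A → QR k) :
    qm q (∏ a ∈ s, g a) = ∑ a ∈ s, qm q (g a) * ∏ b ∈ s.erase a, g b := by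
  induction s using induction_on with
  | empty =>
    have : q 0 = 0 := by have := hq 0 0; simp at this; exact this
    rw [prod_empty, one_def, qm_single]; simp [this]
  | insert a s h ih =>
    rw [prod_insert h, qm_mul q hq, sum_insert h, Finset.erase_insert h, ih]
    congr 1
    rw [mul_sum]
    refine sum_congr rfl fun b hb => ?_
    have hab : a ≠ b := by rintro rfl; exact h hb
    rw [Finset.erase_insert_of_ne hab, prod_insert (by simp [h])]
    ring

theorem qm_D (q : (Fin k → ℚ) → ℚ) (hq : ∀ u v, q (u + v) = q u + q v) :
    qm q C.D = q C.ρ • C.D + ∑ a, q (C.α a) • (single (-C.α a) 1 * C.Da a) := by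
  have h0 : q 0 = 0 := by have := hq 0 0; simp at this; exact this
  have hn : ∀ v, q (-v) = - q v := fun v => by have := hq v (-v); simp [h0] at this; linarith
  rw [D, qm_mul q hq, qm_prod q hq, qm_single]
  congr 1
  · rw [← smul_mul_assoc]; congr 1; simp
  · rw [mul_sum]
    refine sum_congr rfl fun a _ => ?_
    rw [Da, map_sub, one_def, qm_single, qm_single, h0, hn]
    have : single (0 : Fin k → ℚ) (0 * 1 : ℚ) - single (-C.α a) (-q (C.α a) * 1)
      = q (C.α a) • (single (-C.α a) 1 : QR k) := by
      ext v; simp [Finsupp.single_apply]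
    rw [this]
    simp only [smul_mul_assoc, mul_smul_comm]
    congr 1
    ring

theorem main (hD : qm nsq C.D = nsq C.ρ • C.D) (Z : Matrix ι ι ℚ)
    (hZ : ∀ a, Z * C.f a = C.f a * Z) :
    C.D * gtr C.wt (Z * C.Ω) = qm (fun v => nsq v - nsq C.ρ) (C.D * gtr C.wt Z) := by
  set z := gtr C.wt Z with hz
  have hq : ∀ F : QR k, qm (fun v => nsq v - nsq C.ρ) F = qm nsq F - nsq C.ρ • F := by
    intro F; ext v; simp; ring
  have hΩ : gtr C.wt (Z * C.Ω) = qm nsq z + ∑ a, (2 * gtr C.wt (Z * C.e a * C.f a) - qm (dt (C.α a)) z) := by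
    rw [Ω, mul_add, gtr_add, gtr_diag, mul_sum, gtr_sum]
    congr 1
    refine sum_congr rfl fun a _ => ?_
    have : Z * (C.e a * C.f a + C.f a * C.e a) = 2 • (Z * C.e a * C.f a) -
        Z * diagonal (fun i => dt (C.α a) (C.wt i)) := by
      rw [← C.hef, mul_sub, two_smul, mul_assoc, mul_add]; abel
    rw [this, gtr_sub, gtr_diag, two_smul, gtr_add, two_mul]
  have hT : ∀ a, C.D * gtr C.wt (Z * C.e a * C.f a) = C.Da a * qm (dt (C.α a)) z := by
    intro a
    rw [D_eq C a, mul_assoc, mul_comm (1 - _), gtr_ef C.wt (C.α a) Z (C.e a) (C.f a) (C.hf a) (hZ a) (C.hef a)]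
  have hDa : ∀ a, C.Da a = C.D + single (-C.α a) 1 * C.Da a := by
    intro a
    conv_lhs => rw [← mul_one (C.Da a)]
    rw [D_eq C a]; ring
  have hgr : ∑ i, qm (fun v => v i) C.D * qm (fun v => v i) z =
      C.D * qm (dt C.ρ) z + ∑ a, single (-C.α a) 1 * C.Da a * qm (dt (C.α a)) z := by
    have hdt : ∀ u : Fin k → ℚ, qm (dt u) z = ∑ i, u i • qm (fun v => v i) z := by
      intro u; ext v
      simp only [coeff_qm, dt, sum_mul, coeff_sum, coeff_smul, coe_finsetSum, Finset.sum_apply, Finsupp.smul_apply, smul_eq_mul, mul_assoc]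
    simp only [hdt]
    have : ∀ i : Fin k, qm (fun v => v i) C.D = C.ρ i • C.D + ∑ a, C.α a i • (single (-C.α a) 1 * C.Da a) := 
      fun i => qm_D C (fun v => v i) (fun u v => rfl)
    simp only [this, add_mul, sum_add_distrib, mul_sum, sum_mul]
    congr 1
    · exact sum_congr rfl fun i _ => by rw [smul_mul_assoc, mul_smul_comm]
    · rw [sum_comm]
      exact sum_congr rfl fun a _ => sum_congr rfl fun i _ => by
        rw [smul_mul_assoc, mul_smul_comm]
  have hrho : 2 * qm (dt C.ρ) z = ∑ a, qm (dt (C.α a)) z := by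
    rw [hz, gtr]
    simp only [map_sum, qm_single]
    rw [sum_comm, mul_sum]
    refine sum_congr rfl fun i _ => ?_
    rw [← single_sum', ← sum_mul, ← C.hρ i, two_mul, ← single_add]
    congr 1; ring
  rw [hq, lap_mul, hD, hgr, hΩ]
  have h3 : C.D * ∑ a, (2 * gtr C.wt (Z * C.e a * C.f a) - qm (dt (C.α a)) z)
     = ∑ a, (C.D * qm (dt (C.α a)) z + 2 * (single (-C.α a) 1 * C.Da a * qm (dt (C.α a)) z)) := by
    rw [mul_sum]
    refine sum_congr rfl fun a _ => ?_
    rw [mul_sub, ← mul_assoc, mul_comm C.D 2, mul_assoc, hT]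
    have := hDa a
    linear_combination (2 * qm (dt (C.α a)) z) * this
  rw [mul_add, h3, sum_add_distrib, ← mul_sum, ← mul_sum, ← hrho, smul_mul_assoc]
  ring

theorem Ω_wt (i j) (h : C.Ω i j ≠ 0) : C.wt i = C.wt j := by
  by_contra hne
  apply h
  have hij : i ≠ j := by rintro rfl; exact hne rfl
  rw [Ω, Matrix.add_apply, Matrix.diagonal_apply_ne _ hij, zero_add, Matrix.sum_apply]
  refine sum_eq_zero fun a _ => ?_
  rw [Matrix.add_apply, Matrix.mul_apply, Matrix.mul_apply]
  have h1 : ∀ m, C.e a i m * C.f a m j = 0 := by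
    intro m; by_contra h; 
    have h1 := C.he a i m (left_ne_zero_of_mul h)
    have h2 := C.hf a m j (right_ne_zero_of_mul h)
    exact hne (h1.trans h2)
  have h2 : ∀ m, C.f a i m * C.e a m j = 0 := by
    intro m; by_contra h; 
    have h1 := C.hf a i m (left_ne_zero_of_mul h)
    have h2 := C.he a m j (right_ne_zero_of_mul h)
    rw [h2] at h1
    exact hne (add_right_cancel h1)
  simp [h1, h2]

theorem main_poly (hD : qm nsq C.D = nsq C.ρ • C.D) (p : Polynomial ℚ) :
    C.D * gtr C.wt (aeval C.Ω p) =
      qm (fun v => p.eval (nsq v - nsq C.ρ)) (C.D * gtr C.wt 1) := by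
  induction p using Polynomial.induction_on with
  | C a =>
    rw [aeval_C, Algebra.algebraMap_eq_smul_one, gtr_smul]
    ext v; simp
  | add p q hp hq =>
    rw [map_add, gtr_add, mul_add, hp, hq]
    ext v; simp; ring
  | monomial n a h =>
    rw [pow_succ, ← mul_assoc, map_mul, Polynomial.aeval_X, main C hD, h]
    · ext v; simp [pow_succ]; ring
    · intro a
      have : Commute C.Ω (C.f a) := C.hcf a
      have h2 : ∀ q : Polynomial ℚ, Commute (aeval C.Ω q) (C.f a) := by
        intro q
        rw [Polynomial.aeval_eq_sum_range]
        refine Commute.sum_left _ _ _ fun i _ => ?_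
        exact (this.pow_left i).smul_left _
      exact h2 _

end CD
end

section
namespace CD
variable {k : ℕ} {ι : Type} [Fintype ι] [DecidableEq ι]
variable {A : Type} [Fintype A] [DecidableEq A] (C : CD k ι A)

def Wt (ν : Fin k → ℚ) : Submodule ℚ (ι → ℚ) where
  carrier := {x | ∀ i, x i ≠ 0 → C.wt i = ν}
  zero_mem' := by intro i h; exact absurd rfl h
  add_mem' := by
    intro x y hx hy i h
    by_cases h1 : x i = 0
    · by_cases h2 : y i = 0
      · simp [h1, h2] at h
      · exact hy i h2
    · exact hx i h1
  smul_mem' := by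
    intro c x hx i h
    exact hx i (right_ne_zero_of_mul (by simpa using h))

def HW (ν : Fin k → ℚ) : Submodule ℚ (ι → ℚ) where
  carrier := {x | x ∈ C.Wt ν ∧ ∀ a, (C.e a).mulVec x = 0}
  zero_mem' := ⟨(C.Wt ν).zero_mem, by simp⟩
  add_mem' := by
    intro x y hx hy
    exact ⟨(C.Wt ν).add_mem hx.1 hy.1, fun a => by rw [Matrix.mulVec_add, hx.2, hy.2, add_zero]⟩
  smul_mem' := by
    intro c x hx
    exact ⟨(C.Wt ν).smul_mem c hx.1, fun a => by rw [Matrix.mulVec_smul, hx.2, smul_zero]⟩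

theorem mul_wt (Z : Matrix ι ι ℚ) (β : Fin k → ℚ) (hZ : ∀ i j, Z i j ≠ 0 → C.wt i = C.wt j + β)
    (ν : Fin k → ℚ) (x) (hx : x ∈ C.Wt ν) : Z.mulVec x ∈ C.Wt (ν + β) := by
  intro i hi
  rw [mulVec, dotProduct] at hi
  obtain ⟨j, _, hj⟩ := Finset.exists_ne_zero_of_sum_ne_zero hi
  rw [hZ i j (left_ne_zero_of_mul hj), hx j (right_ne_zero_of_mul hj)]

theorem e_wt (a) (ν) (x) (hx : x ∈ C.Wt ν) : (C.e a).mulVec x ∈ C.Wt (ν + C.α a) :=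
  C.mul_wt _ _ (C.he a) ν x hx

theorem aeval_wt (p : Polynomial ℚ) (i j) (h : aeval C.Ω p i j ≠ 0) :
    C.wt i = C.wt j := by
  revert i j h
  induction p using Polynomial.induction_on with
  | C a =>
    intro i j h
    rw [aeval_C, Matrix.algebraMap_matrix_apply] at h
    split_ifs at h with hij
    · rw [hij]
    · exact absurd rfl h
  | add p q hp hq =>
    intro i j h
    rw [map_add, Matrix.add_apply] at h
    by_cases h1 : aeval C.Ω p i j = 0
    · rw [h1, zero_add] at h; exact hq i j h
    · exact hp i j h1
  | monomial n a hh =>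
    intro i j h
    rw [pow_succ, ← mul_assoc, map_mul, Polynomial.aeval_X, Matrix.mul_apply] at h
    obtain ⟨m, _, hm⟩ := Finset.exists_ne_zero_of_sum_ne_zero h
    rw [hh i m (left_ne_zero_of_mul hm), C.Ω_wt m j (right_ne_zero_of_mul hm)]

theorem aeval_mem (p : Polynomial ℚ) (ν) (x) (hx : x ∈ C.Wt ν) :
    (aeval C.Ω p).mulVec x ∈ C.Wt ν := by
  have := C.mul_wt _ 0 (fun i j h => by rw [C.aeval_wt p i j h, add_zero]) ν x hx
  rwa [add_zero] at this

theorem aeval_comm (p : Polynomial ℚ) (a) :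
    aeval C.Ω p * C.e a = C.e a * aeval C.Ω p := by
  have : Commute C.Ω (C.e a) := C.hce a
  have h2 : Commute (aeval C.Ω p) (C.e a) := by
    rw [Polynomial.aeval_eq_sum_range]
    refine Commute.sum_left _ _ _ fun i _ => ?_
    exact (this.pow_left i).smul_left _
  exact h2

theorem Ω_hw (ν) (x) (hx : x ∈ C.HW ν) :
    C.Ω.mulVec x = (nsq (ν + C.ρ) - nsq C.ρ) • x := by
  have hd : ∀ q : (Fin k → ℚ) → ℚ, (diagonal (fun i => q (C.wt i))).mulVec x = q ν • x := by
    intro q; ext i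
    rw [mulVec_diagonal, Pi.smul_apply, smul_eq_mul]
    by_cases h : x i = 0
    · simp [h]
    · rw [hx.1 i h]
  have h1 : ∀ a, (C.e a * C.f a + C.f a * C.e a).mulVec x = dt (C.α a) ν • x := by
    intro a
    have : C.e a * C.f a + C.f a * C.e a = diagonal (fun i => dt (C.α a) (C.wt i)) + C.f a * C.e a + C.f a * C.e a := by
      rw [← C.hef]; abel
    rw [this, add_mulVec, add_mulVec, hd, ← mulVec_mulVec, hx.2]; simp
  have hs : (∑ a, (C.e a * C.f a + C.f a * C.e a)).mulVec x = ∑ a, (C.e a * C.f a + C.f a * C.e a).mulVec x := by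
    ext i; simp only [mulVec, dotProduct, Matrix.sum_apply, sum_mul, Finset.sum_apply]
    rw [sum_comm]
  rw [Ω, add_mulVec, hd, hs]
  simp only [h1]
  rw [← sum_smul, ← add_smul]
  by_cases hx0 : x = 0
  · simp [hx0]
  · congr 1
    obtain ⟨i, hi⟩ : ∃ i, x i ≠ 0 := by
      by_contra h; push Not at h; exact hx0 (funext h)
    rw [← hx.1 i hi, ← C.hρ i]
    simp only [nsq, dt_add, add_dt]; rw [dt_comm (C.wt i) C.ρ]; ring

theorem aeval_eig (p : Polynomial ℚ) (x : ι → ℚ) (c : ℚ) (h : C.Ω.mulVec x = c • x) :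
    (aeval C.Ω p).mulVec x = p.eval c • x := by
  induction p using Polynomial.induction_on with
  | C a => 
    rw [aeval_C, Algebra.algebraMap_eq_smul_one, Matrix.smul_mulVec]; simp
  | add p q hp hq => rw [map_add, add_mulVec, hp, hq, Polynomial.eval_add, add_smul]
  | monomial n a hh =>
    rw [pow_succ, ← mul_assoc, map_mul, Polynomial.aeval_X, ← mulVec_mulVec, h, Matrix.mulVec_smul, hh,
      smul_smul]
    congr 1; simp; ring

theorem exists_proj (c : ℚ) : ∃ p u : Polynomial ℚ, ∃ N : ℕ, 1 ≤ N ∧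
    p = 1 - u * (Polynomial.X - Polynomial.C c) ^ N ∧
    aeval C.Ω ((Polynomial.X - Polynomial.C c) ^ N * p) = 0 := by
  obtain ⟨q, hq, hq2⟩ := Polynomial.exists_eq_pow_rootMultiplicity_mul_and_not_dvd C.Ω.charpoly
    (Matrix.charpoly_monic _).ne_zero c
  set n := Polynomial.rootMultiplicity c C.Ω.charpoly
  have hirr : Irreducible (Polynomial.X - Polynomial.C c) := Polynomial.irreducible_X_sub_C c
  have hcop : IsCoprime ((Polynomial.X - Polynomial.C c) ^ (n + 1)) q :=
    ((hirr.coprime_iff_not_dvd).2 hq2).pow_left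
  obtain ⟨u, v, huv⟩ := hcop
  refine ⟨v * q, u, n + 1, by omega, ?_, ?_⟩
  · rw [← huv]; ring
  · have : (Polynomial.X - Polynomial.C c) ^ (n + 1) * (v * q) = (Polynomial.X - Polynomial.C c) * v * C.Ω.charpoly := by
      rw [hq]; ring
    rw [this, map_mul, Matrix.aeval_self_charpoly, mul_zero]

def NΦ : AddSubmonoid (Fin k → ℚ) := AddSubmonoid.closure (Set.range C.α)

theorem NΦ_pos (ξ : Fin k → ℚ) (h : ∀ a, 0 < dt ξ (C.α a)) (β) (hβ : β ∈ C.NΦ) :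
    β = 0 ∨ 0 < dt ξ β := by
  induction hβ using AddSubmonoid.closure_induction with
  | mem x hx => obtain ⟨a, rfl⟩ := hx; exact Or.inr (h a)
  | zero => exact Or.inl rfl
  | add x y _ _ hx hy =>
    rcases hx with rfl | hx
    · simpa using hy
    · rcases hy with rfl | hy
      · right; simpa using hx
      · right; rw [dt_add]; linarith

theorem nsq_nonneg (v : Fin k → ℚ) : 0 ≤ nsq v := by
  unfold nsq dt
  exact Finset.sum_nonneg fun i _ => mul_self_nonneg _

theorem kill (ν) (h : ∀ a, 0 < dt (ν + C.ρ) (C.α a)) (N : ℕ) (β) (hβ : β ∈ C.NΦ) (hβ0 : β ≠ 0)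
    (y : ι → ℚ) (hy : y ∈ C.Wt (ν + β))
    (hyk : (aeval C.Ω ((Polynomial.X - Polynomial.C (nsq (ν + C.ρ) - nsq C.ρ)) ^ N)).mulVec y = 0) :
    y = 0 := by
  classical
  by_contra hy0
  set P := aeval C.Ω ((Polynomial.X - Polynomial.C (nsq (ν + C.ρ) - nsq C.ρ)) ^ N) with hP
  let S : Finset (Fin k → ℚ) := (univ.image C.wt).filter
    (fun η => ∃ β ∈ C.NΦ, β ≠ 0 ∧ η = ν + β ∧ ∃ y ∈ C.Wt η, y ≠ 0 ∧ P.mulVec y = 0)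
  have hmem : ∀ β ∈ C.NΦ, β ≠ 0 → ∀ y ∈ C.Wt (ν + β), y ≠ 0 → P.mulVec y = 0 → ν + β ∈ S := by
    intro β hβ hβ0 y hy hy0 hyk
    simp only [S, mem_filter, Finset.mem_image, mem_univ, true_and]
    refine ⟨?_, β, hβ, hβ0, rfl, y, hy, hy0, hyk⟩
    obtain ⟨i, hi⟩ : ∃ i, y i ≠ 0 := by
      by_contra h; push Not at h; exact hy0 (funext h)
    exact ⟨i, hy i hi⟩
  obtain ⟨η, hη, hmax⟩ := S.exists_max_image (fun η => dt (ν + C.ρ) η) ⟨_, hmem β hβ hβ0 y hy hy0 hyk⟩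
  simp only [S, mem_filter] at hη
  obtain ⟨_, b, hb, hb0, rfl, z, hz, hz0, hzk⟩ := hη
  have hHW : z ∈ C.HW (ν + b) := by
    refine ⟨hz, fun a => ?_⟩
    by_contra hne
    have h1 := C.e_wt a _ z hz
    have h2 : P.mulVec ((C.e a).mulVec z) = 0 := by
      rw [mulVec_mulVec, hP, C.aeval_comm, ← hP, ← mulVec_mulVec, hzk, Matrix.mulVec_zero]
    have hba : b + C.α a ∈ C.NΦ := C.NΦ.add_mem hb (AddSubmonoid.subset_closure ⟨a, rfl⟩)
    have hpos : 0 < dt (ν + C.ρ) (b + C.α a) := by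
      rw [dt_add]
      rcases C.NΦ_pos _ h b hb with h' | h'
      · exact absurd h' hb0
      · have := h a; linarith
    rw [add_assoc] at h1
    have h3 := hmax _ (hmem (b + C.α a) hba (by rintro h0; rw [h0] at hpos; simp [dt] at hpos) _ h1 hne h2)
    have := h a
    simp only [dt_add] at h3
    linarith
  have h4 := C.Ω_hw _ z hHW
  have h5 := C.aeval_eig ((Polynomial.X - Polynomial.C (nsq (ν + C.ρ) - nsq C.ρ)) ^ N) z _ h4
  rw [← hP, hzk] at h5
  have h6 := (smul_eq_zero.1 h5.symm).resolve_right hz0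
  simp only [Polynomial.eval_pow, Polynomial.eval_sub, eval_X, Polynomial.eval_C] at h6
  have h7 := eq_zero_of_pow_eq_zero h6
  have h8 : nsq (ν + b + C.ρ) = nsq (ν + C.ρ) + 2 * dt (ν + C.ρ) b + nsq b := by
    simp only [nsq, dt_add, add_dt]
    rw [dt_comm b ν, dt_comm b C.ρ]; ring
  have h9 := nsq_nonneg b
  rcases C.NΦ_pos _ h b hb with h' | h'
  · exact hb0 h'
  · linarith

theorem coeff_prod (s : Finset A) (F : QR k) (ν : Fin k → ℚ)
    (hF : ∀ β ∈ C.NΦ, β ≠ 0 → F.coeff (ν + β) = 0) (hne : ∀ a, ∀ β ∈ C.NΦ, C.α a + β ≠ 0) :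
    ((∏ a ∈ s, (1 - single (-C.α a) 1)) * F).coeff ν = F.coeff ν ∧
    ∀ β ∈ C.NΦ, β ≠ 0 → ((∏ a ∈ s, (1 - single (-C.α a) 1)) * F).coeff (ν + β) = 0 := by
  induction s using induction_on with
  | empty => simpa using hF
  | insert a s ha ih =>
    have h1 : ∀ (G : QR k) v, ((1 - single (-C.α a) 1) * G).coeff v = G.coeff v - G.coeff (v + C.α a) := by
      intro G v
      rw [sub_mul, one_mul, coeff_sub, Finsupp.sub_apply,
        AddMonoidAlgebra.coeff_single_mul_eq_mul_coeff (v + C.α a), one_mul]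
      intro m _
      constructor
      · rintro rfl; abel
      · rintro rfl; abel
    have ha' : C.α a ∈ C.NΦ := AddSubmonoid.subset_closure ⟨a, rfl⟩
    have ha0 : C.α a ≠ 0 := by simpa using hne a 0 C.NΦ.zero_mem
    rw [prod_insert ha, mul_assoc]
    refine ⟨?_, fun β hβ h0 => ?_⟩
    · rw [h1, ih.1, ih.2 _ ha' ha0, sub_zero]
    · rw [h1, ih.2 β hβ h0, add_assoc, ih.2 _ (C.NΦ.add_mem hβ ha') (by rw [add_comm]; exact hne a β hβ), sub_zero]

theorem coeff_gtr (wt : ι → Fin k → ℚ) (Z : Matrix ι ι ℚ) (v) :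
    (gtr wt Z).coeff v = ∑ i, if wt i = v then Z i i else 0 := by
  simp only [gtr, coeff_sum, coe_finsetSum, Finset.sum_apply,
    AddMonoidAlgebra.coeff_single, Finsupp.single_apply]

theorem lemma1 (hD : qm nsq C.D = nsq C.ρ • C.D) (ν) (h : ∀ a, 0 < dt (ν + C.ρ) (C.α a)) :
    (C.D * gtr C.wt 1).coeff (ν + C.ρ) = (finrank ℚ (C.HW ν) : ℚ) := by
  classical
  set c := nsq (ν + C.ρ) - nsq C.ρ with hc
  obtain ⟨p, u, N, hN, hp, hpk⟩ := C.exists_proj c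
  have hpc : p.eval c = 1 := by
    rw [hp]; simp [zero_pow (by omega : N ≠ 0)]
  have hm := C.main_poly hD p
  set π := aeval C.Ω p with hπ
  have h1 : (C.D * gtr C.wt π).coeff (ν + C.ρ) = (C.D * gtr C.wt 1).coeff (ν + C.ρ) := by
    rw [hm, coeff_qm, ← hc, hpc, one_mul]
  have hker : ∀ x, (aeval C.Ω ((Polynomial.X - Polynomial.C c) ^ N)).mulVec (π.mulVec x) = 0 := by
    intro x; rw [mulVec_mulVec, hπ, ← map_mul, hpk, Matrix.zero_mulVec]
  have hsing : ∀ i, (Pi.single i (1:ℚ) : ι → ℚ) ∈ C.Wt (C.wt i) := by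
    intro i j hj
    by_cases hij : j = i
    · rw [hij]
    · simp [Pi.single_eq_of_ne hij] at hj
  have hkill : ∀ β ∈ C.NΦ, β ≠ 0 → ∀ x ∈ C.Wt (ν + β), π.mulVec x = 0 := by
    intro β hβ hβ0 x hx
    exact C.kill ν h N β hβ hβ0 _ (C.aeval_mem p _ x hx) (hker x)
  have hz : ∀ β ∈ C.NΦ, β ≠ 0 → (gtr C.wt π).coeff (ν + β) = 0 := by
    intro β hβ hβ0
    rw [coeff_gtr]
    refine sum_eq_zero fun i _ => ?_
    split_ifs with hi
    · have := hkill β hβ hβ0 (Pi.single i 1) (hi ▸ hsing i)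
      rw [Matrix.mulVec_single_one] at this
      exact congrFun this i
    · rfl
  have hne : ∀ a, ∀ β ∈ C.NΦ, C.α a + β ≠ 0 := by
    intro a β hβ h0
    have h2 : dt (ν + C.ρ) (C.α a + β) = 0 := by rw [h0]; simp [dt]
    rw [dt_add] at h2
    have h3 := h a
    rcases C.NΦ_pos _ h β hβ with rfl | h'
    · simp [dt] at h2 h3; linarith
    · linarith
  have h2 : (C.D * gtr C.wt π).coeff (ν + C.ρ) = (gtr C.wt π).coeff ν := by
    rw [← (C.coeff_prod univ (gtr C.wt π) ν hz hne).1, D, mul_assoc,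
      AddMonoidAlgebra.coeff_single_mul_eq_mul_coeff ν, one_mul]
    intro m _
    rw [add_comm]; exact add_left_inj _
  rw [← h1, h2]
  set I : Matrix ι ι ℚ := diagonal (fun i => if C.wt i = ν then 1 else 0) with hI
  have h3 : (gtr C.wt π).coeff ν = trace (π * I) := by
    rw [coeff_gtr, trace]
    refine sum_congr rfl fun i _ => ?_
    rw [Matrix.diag_apply, hI, mul_diagonal]; simp
  rw [h3, ← Matrix.trace_toLin'_eq]
  have hIwt : ∀ x, I.mulVec x ∈ C.Wt ν := by
    intro x i hi
    rw [hI, mulVec_diagonal] at hi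
    by_contra hne; simp [hne] at hi
  have hIid : ∀ x ∈ C.Wt ν, I.mulVec x = x := by
    intro x hx; ext i
    rw [hI, mulVec_diagonal]
    by_cases h0 : x i = 0
    · simp [h0]
    · simp [hx i h0]
  refine LinearMap.IsProj.trace ⟨?_, ?_⟩
  · intro x
    rw [Matrix.toLin'_apply, ← mulVec_mulVec]
    refine ⟨C.aeval_mem p _ _ (hIwt x), fun a => ?_⟩
    rw [mulVec_mulVec, ← C.aeval_comm, ← mulVec_mulVec]
    exact hkill (C.α a) (AddSubmonoid.subset_closure ⟨a, rfl⟩) (by simpa using hne a 0 C.NΦ.zero_mem) _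
      (C.e_wt a ν _ (hIwt x))
  · intro x hx
    rw [Matrix.toLin'_apply, ← mulVec_mulVec, hIid x hx.1]
    have := C.aeval_eig p x _ (C.Ω_hw ν x hx)
    rw [← hc, hpc, one_smul] at this
    exact this

end CD

variable {k : ℕ} {ι : Type} [Fintype ι] [DecidableEq ι]

def rfl' (α : Fin k → ℚ) : (Fin k → ℚ) →+ (Fin k → ℚ) where
  toFun v := v - (2 * dt α v / nsq α) • α
  map_zero' := by simp [dt]
  map_add' u v := by rw [dt_add]; ext i; simp; ring

def prj (α : Fin k → ℚ) : (Fin k → ℚ) →+ (Fin k → ℚ) where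
  toFun v := v - (dt α v / nsq α) • α
  map_zero' := by simp [dt]
  map_add' u v := by rw [dt_add]; ext i; simp; ring

theorem nsq_pos (α : Fin k → ℚ) (h : α ≠ 0) : 0 < nsq α := by
  have h0 := CD.nsq_nonneg α
  rcases h0.lt_or_eq with h1 | h1
  · exact h1
  · exfalso; apply h
    unfold nsq dt at h1
    have := (Finset.sum_eq_zero_iff_of_nonneg (fun i _ => mul_self_nonneg (α i))).1 h1.symm
    ext i; simpa using this i (mem_univ i)

theorem smul_dt (c : ℚ) (u v : Fin k → ℚ) : dt (c • u) v = c * dt u v := by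
  simp [dt, mul_sum, mul_assoc]
theorem dt_smul (c : ℚ) (u v : Fin k → ℚ) : dt u (c • v) = c * dt u v := by
  rw [dt_comm, smul_dt, dt_comm]
theorem dt_sub (u v w : Fin k → ℚ) : dt u (v - w) = dt u v - dt u w := by
  rw [sub_eq_add_neg, dt_add, dt_neg]; ring
theorem sub_dt (u v w : Fin k → ℚ) : dt (u - v) w = dt u w - dt v w := by
  rw [dt_comm, dt_sub, dt_comm w u, dt_comm w v]

theorem rfl_rfl (α v : Fin k → ℚ) (h : α ≠ 0) : rfl' α (rfl' α v) = v := by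
  have := (nsq_pos α h).ne'
  have h1 : dt α (rfl' α v) = - dt α v := by
    simp only [rfl', coe_mk, ZeroHom.coe_mk, dt_sub, dt_smul]
    rw [← nsq]; field_simp; ring
  have h2 : rfl' α (rfl' α v) = rfl' α v - (2 * dt α (rfl' α v) / nsq α) • α := rfl
  have h3 : rfl' α v = v - (2 * dt α v / nsq α) • α := rfl
  rw [h2, h1, h3]
  ext i; simp; ring

theorem line (α u v : Fin k → ℚ) (h : α ≠ 0) (h1 : prj α u = prj α v) (h2 : nsq u = nsq v) :
    u = v ∨ u = rfl' α v := by
  have hp := (nsq_pos α h).ne'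
  obtain ⟨t, rfl⟩ : ∃ t : ℚ, u = v + t • α := by
    refine ⟨dt α u / nsq α - dt α v / nsq α, ?_⟩
    simp only [prj, coe_mk, ZeroHom.coe_mk] at h1
    rw [sub_smul, ← sub_eq_iff_eq_add', ← sub_eq_zero] 
    have h3 := sub_eq_zero.2 h1
    rw [← h3]; abel
  have h3 : t * (2 * dt α v + t * nsq α) = 0 := by
    simp only [nsq, dt_add, add_dt, dt_smul, smul_dt] at h2 ⊢
    rw [dt_comm v α] at h2
    linarith
  rcases mul_eq_zero.1 h3 with rfl | h4
  · left; simp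
  · right
    have : t = - (2 * dt α v / nsq α) := by field_simp; linarith
    simp only [rfl', coe_mk, ZeroHom.coe_mk, this, neg_smul, sub_eq_add_neg]

theorem lemma0 (wt : ι → Fin k → ℚ) (α : Fin k → ℚ) (hα : α ≠ 0) (e f : Matrix ι ι ℚ)
    (he : ∀ i j, e i j ≠ 0 → wt i = wt j + α)
    (hf : ∀ i j, f i j ≠ 0 → wt i + α = wt j)
    (hef : e * f - f * e = diagonal (fun i => dt α (wt i))) (v : Fin k → ℚ) :
    (gtr wt 1).coeff (rfl' α v) = (gtr wt 1).coeff v := by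
  classical
  have hfe : f * e = e * f - diagonal (fun i => dt α (wt i)) := by rw [← hef]; abel
  have hnn : ∀ u : Fin k → ℚ, nsq (u + α) = nsq u + 2 * dt α u + nsq α := by
    intro u; simp only [nsq, dt_add, add_dt]; rw [dt_comm u α]; ring
  let C : CD k ι Unit :=
    { wt := wt, α := fun _ => α, e := fun _ => e, f := fun _ => f
      he := fun _ => he, hf := fun _ => hf, hef := fun _ => hef
      ρ := (1/2 : ℚ) • α
      hρ := by intro i; rw [smul_dt]; simp
      hce := by
        intro _
        simp only [univ_unique, sum_singleton]
        have h1 : diagonal (fun i => nsq (wt i)) * e - e * diagonal (fun i => nsq (wt i)) =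
          diagonal (fun i => dt α (wt i)) * e + e * diagonal (fun i => dt α (wt i)) := by
          ext i j
          simp only [Matrix.sub_apply, Matrix.add_apply, Matrix.diagonal_mul, mul_diagonal]
          by_cases h0 : e i j = 0
          · simp [h0]
          · rw [he i j h0, hnn, dt_add]; rw [← nsq]; ring
        rw [hfe, ← sub_eq_zero]
        have h2 : e * f * e = e * (e * f - diagonal (fun i => dt α (wt i))) := by
          rw [mul_assoc, hfe]
        simp only [add_mul, mul_add, sub_mul, mul_sub, h2]
        rw [← sub_eq_zero] at h1
        rw [← h1]; abel
      hcf := by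
        intro _
        simp only [univ_unique, sum_singleton]
        have h1 : diagonal (fun i => nsq (wt i)) * f - f * diagonal (fun i => nsq (wt i)) =
          -(diagonal (fun i => dt α (wt i)) * f + f * diagonal (fun i => dt α (wt i))) := by
          ext i j
          simp only [Matrix.sub_apply, Matrix.add_apply, Matrix.neg_apply, Matrix.diagonal_mul, mul_diagonal]
          by_cases h0 : f i j = 0
          · simp [h0]
          · rw [← hf i j h0, hnn, dt_add]; rw [← nsq]; ring
        have h2 : f * (e * f) = (e * f - diagonal (fun i => dt α (wt i))) * f := by
          rw [← mul_assoc, hfe]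
        rw [hfe, ← sub_eq_zero]
        simp only [add_mul, mul_add, sub_mul, mul_sub, h2]
        rw [← sub_eq_zero] at h1
        rw [← h1]; abel }
  set D := C.D with hDdef
  have hDD : D = single ((1/2:ℚ) • α) 1 - single (-((1/2:ℚ) • α)) 1 := by
    rw [hDdef, CD.D]
    simp only [univ_unique, Finset.prod_singleton, C, mul_sub, mul_one, single_mul_single]
    congr 2
    ext i; simp; ring
  have hD : qm nsq C.D = nsq C.ρ • C.D := by
    rw [← hDdef, hDD, map_sub, qm_single, qm_single]
    have : nsq (-((1/2:ℚ) • α)) = nsq ((1/2:ℚ) • α) := by simp [nsq, dt]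
    rw [this, smul_sub, smul_single, smul_single]
    rfl
  set χ := gtr wt 1 with hχ
  have hmp := fun p => C.main_poly hD p
  set F := D * χ with hF
  let pm := mapDomainRingHom ℚ (prj α)
  have hpa : prj α α = 0 := by
    simp only [prj, coe_mk, ZeroHom.coe_mk]
    rw [← nsq, div_self (nsq_pos α hα).ne', one_smul, sub_self]
  have hps : ∀ c : ℚ, prj α (c • α) = 0 := by
    intro c
    simp only [prj, coe_mk, ZeroHom.coe_mk, dt_smul]
    rw [← nsq, mul_div_assoc, div_self (nsq_pos α hα).ne', mul_one, sub_self]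
  have hpD : pm D = 0 := by
    rw [hDD, map_sub]
    simp only [pm, mapDomainRingHom_apply, mapDomain_single]
    rw [map_neg, hps]; simp
  have hanti : ∀ v, F.coeff (rfl' α v) = - F.coeff v := by
    intro v0
    let s := F.coeff.support.image nsq
    let g : Polynomial ℚ := ∏ x ∈ s.erase (nsq v0), (Polynomial.X - Polynomial.C (x - nsq C.ρ))
    have hg0 : ∀ x ∈ s, x ≠ nsq v0 → g.eval (x - nsq C.ρ) = 0 := by
      intro x hx hne
      rw [Polynomial.eval_prod]
      exact Finset.prod_eq_zero (Finset.mem_erase.2 ⟨hne, hx⟩) (by simp)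
    have hg1 : g.eval (nsq v0 - nsq C.ρ) ≠ 0 := by
      rw [Polynomial.eval_prod, prod_ne_zero_iff]
      intro x hx
      have := (Finset.mem_erase.1 hx).1
      simp; intro h; apply this; linarith
    have h1 := congrArg pm (hmp g)
    rw [map_mul, ← hDdef, hpD, zero_mul] at h1
    have h2 := congrArg (fun G => G.coeff (prj α v0)) h1.symm
    simp only [pm, mapDomainRingHom_apply, coeff_mapDomain, AddMonoidAlgebra.coeff_zero] at h2
    set G := qm (fun v => g.eval (nsq v - nsq C.ρ)) (D * gtr C.wt 1) with hG
    have hGc : ∀ v, G.coeff v = g.eval (nsq v - nsq C.ρ) * F.coeff v := fun v => rfl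
    rw [Finsupp.mapDomain, Finsupp.sum_apply, Finsupp.sum] at h2
    simp only [Finsupp.single_apply, Finsupp.coe_zero, Pi.zero_apply] at h2
    have hsub : G.coeff.support ⊆ insert v0 {rfl' α v0} ∪ G.coeff.support := Finset.subset_union_right
    rw [sum_subset hsub (by
      intro x _ hx
      rw [Finsupp.notMem_support_iff.1 hx]; simp)] at h2
    have hsub2 : (insert v0 {rfl' α v0} : Finset (Fin k → ℚ)) ⊆ insert v0 {rfl' α v0} ∪ G.coeff.support := Finset.subset_union_left
    rw [← sum_subset hsub2 (by
      intro x _ hx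
      split_ifs with hpx
      · by_contra hne
        rw [hGc] at hne
        have hxF : x ∈ F.coeff.support := Finsupp.mem_support_iff.2 (right_ne_zero_of_mul hne)
        have hnx : nsq x = nsq v0 := by
          by_contra hnx
          exact left_ne_zero_of_mul hne (hg0 _ (Finset.mem_image_of_mem _ hxF) hnx)
        rcases line α x v0 hα hpx hnx with h | h
        · apply hx; simp [h]
        · apply hx; simp [h]
      · rfl)] at h2
    have hnr : nsq (rfl' α v0) = nsq v0 := by
      have := (nsq_pos α hα).ne'
      simp only [rfl', coe_mk, ZeroHom.coe_mk]
      simp only [nsq, dt_sub, sub_dt, dt_smul, smul_dt]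
      simp only [nsq] at this
      rw [dt_comm v0 α]; field_simp; ring
    have hpr : prj α (rfl' α v0) = prj α v0 := by
      have h3 : rfl' α v0 = v0 - (2 * dt α v0 / nsq α) • α := rfl
      rw [h3, map_sub, hps, sub_zero]
    by_cases hv : v0 = rfl' α v0
    · rw [← hv]
      rw [← hv] at h2
      simp [hGc] at h2
      rcases h2 with h2 | h2
      · exact absurd h2 hg1
      · rw [h2]; simp
    · rw [sum_insert (by simpa using hv), sum_singleton] at h2
      rw [if_pos rfl, if_pos hpr, hGc, hGc, hnr, ← mul_add] at h2
      have := (mul_eq_zero.1 h2).resolve_left hg1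
      linarith
  let sm := mapDomainRingHom ℚ (rfl' α)
  have hinj : Injective (rfl' α) := fun u v h => by
    rw [← rfl_rfl α u hα, h, rfl_rfl α v hα]
  have hsm : ∀ (G : QR k) v, (sm G).coeff (rfl' α v) = G.coeff v := by
    intro G v
    simp only [sm, mapDomainRingHom_apply, coeff_mapDomain]
    exact mapDomain_apply hinj _ _
  have hsF : sm F = - F := by
    ext v
    have h1 := hsm F (rfl' α v)
    rw [rfl_rfl α v hα, hanti] at h1
    simpa using h1
  have hsr : rfl' α ((1/2:ℚ) • α) = -((1/2:ℚ) • α) := by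
    have := (nsq_pos α hα).ne'
    simp only [rfl', coe_mk, ZeroHom.coe_mk, dt_smul]
    rw [← nsq]
    have : 2 * (1/2 * nsq α) / nsq α = 1 := by field_simp
    rw [this]; ext i; simp; ring
  have hsD : sm D = - D := by
    rw [hDD, map_sub]
    simp only [sm, mapDomainRingHom_apply, mapDomain_single]
    rw [map_neg, hsr]; simp
  have hD0 : D ≠ 0 := by
    intro h0
    have := congrArg (fun G => G.coeff ((1/2:ℚ) • α)) (hDD.symm.trans h0)
    simp [Finsupp.single_apply] at this
    split_ifs at this with hh
    · apply hα
      ext i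
      have := congrFun hh i
      simp at this ⊢; linarith
    · simp at this
  have hfin : sm χ = χ := by
    rw [hF, map_mul, hsD] at hsF
    have : D * sm χ = D * χ := by
      rw [neg_mul] at hsF; exact neg_injective hsF
    exact mul_left_cancel₀ hD0 this
  have := hsm χ v
  rw [hfin] at this
  exact this
end

section
variable {k : ℕ}

theorem mono_add (u v : Fin k → ℚ) : (mono (u + v) : CharRing k) = mono u * mono v := by
  simp [mono, single_mul_single]
theorem mono_zero : (mono (0 : Fin k → ℚ) : CharRing k) = 1 := rfl
theorem mono_sum {B : Type} (s : Finset B) (g : B → Fin k → ℚ) :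
    (mono (∑ b ∈ s, g b) : CharRing k) = ∏ b ∈ s, mono (g b) := by
  classical
  induction s using induction_on with
  | empty => simp [mono_zero]
  | insert a s h ih => rw [sum_insert h, prod_insert h, mono_add, ih]
theorem mono_eq_prod (v : Fin k → ℚ) : (mono v : CharRing k) = ∏ i, mono (Pi.single i (v i)) := by
  rw [← mono_sum]; congr 1; exact (Finset.univ_sum_single v).symm

def xp (i : Fin k) (m : ℚ) : CharRing k := mono (Pi.single i m)
theorem xp_add (i : Fin k) (a b : ℚ) : xp i (a + b) = xp i a * xp i b := by
  rw [xp, Pi.single_add, mono_add]; rfl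
theorem xp_zero (i : Fin k) : xp i 0 = 1 := by simp [xp, mono_zero]
theorem xp_pow (i : Fin k) (a : ℚ) (n : ℕ) : xp i a ^ n = xp i (n * a) := by
  induction n with
  | zero => simp [xp_zero]
  | succ n ih => rw [pow_succ, ih, ← xp_add]; congr 1; push_cast; ring

def MA (v : Fin k → ℚ) : Matrix (Fin k) (Fin k) (CharRing k) := fun i j => xp i (v j)
def br (i : Fin k) (m : ℚ) : CharRing k := xp i m - xp i (-m)
def MY (v : Fin k → ℚ) : Matrix (Fin k) (Fin k) (CharRing k) := fun i j => br i (v j)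

theorem altA_det (r : ℕ) (v : Fin (r+1) → ℚ) : altA r v = (MA v).det := by
  rw [← det_transpose, det_apply']
  refine sum_congr rfl fun σ _ => ?_
  rw [mono_eq_prod, zsmul_eq_mul]
  rfl

theorem altY_det (n : ℕ) (v : Fin n → ℚ) : altY CType.C n v = (MY v).det := by
  rw [← det_transpose, det_apply']
  refine sum_congr rfl fun σ _ => ?_
  have h : ∀ i, (MY v).transpose (σ i) i = ∑ b : Bool, (if b then -1 else 1) * xp i ((if b then -1 else 1) * v (σ i)) := by
    intro i; simp [MY, br, transpose_apply]; ring
  simp only [h]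
  rw [Finset.prod_univ_sum, mul_sum, Fintype.piFinset_univ]
  refine sum_congr rfl fun s _ => ?_
  simp only [reduceCtorEq, false_and, if_false]
  rw [prod_mul_distrib, mono_eq_prod, zsmul_eq_mul]
  push_cast
  rw [mul_assoc]
  congr 2
  rw [Finset.prod_ite]; simp

theorem altA_perm (r : ℕ) (v : Fin (r+1) → ℚ) (τ : Perm (Fin (r+1))) :
    altA r (fun i => v (τ i)) = ((Perm.sign τ : ℤˣ) : ℤ) • altA r v := by
  rw [altA_det, altA_det, show MA (fun i => v (τ i)) = (MA v).submatrix id τ from rfl,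
    Matrix.det_permute', zsmul_eq_mul]
theorem altY_perm (n : ℕ) (v : Fin n → ℚ) (τ : Perm (Fin n)) :
    altY .C n (fun i => v (τ i)) = ((Perm.sign τ : ℤˣ) : ℤ) • altY .C n v := by
  rw [altY_det, altY_det, show MY (fun i => v (τ i)) = (MY v).submatrix id τ from rfl,
    Matrix.det_permute', zsmul_eq_mul]
theorem br_neg (i : Fin k) (m : ℚ) : br i (-m) = - br i m := by simp [br]
theorem altY_neg (n : ℕ) (v : Fin n → ℚ) (j : Fin n) :
    altY .C n (update v j (-(v j))) = - altY .C n v := by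
  rw [altY_det, altY_det]
  have : MY (update v j (-(v j))) = (MY v).updateCol j ((-1 : CharRing n) • fun i => MY v i j) := by
    ext i l : 2
    by_cases h : l = j
    · subst h; simp [MY, br_neg]
    · simp [MY, h]
  rw [this, Matrix.det_updateCol_smul, Matrix.updateCol_eq_self]; simp

theorem altA_rep (r : ℕ) (v : Fin (r+1) → ℚ) (i j) (h : i ≠ j) (hv : v i = v j) : altA r v = 0 := by
  rw [altA_det]; exact Matrix.det_zero_of_column_eq h (by intro l; simp [MA, hv])
theorem altY_rep (n : ℕ) (v : Fin n → ℚ) (i j) (h : i ≠ j) (hv : v i = v j) : altY .C n v = 0 := by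
  rw [altY_det]; exact Matrix.det_zero_of_column_eq h (by intro l; simp [MY, hv])
theorem altY_zero (n : ℕ) (v : Fin n → ℚ) (i) (hv : v i = 0) : altY .C n v = 0 := by
  rw [altY_det]; exact Matrix.det_eq_zero_of_column_eq_zero i (by intro l; simp [MY, hv, br])

theorem coeff_mono (u v : Fin k → ℚ) : (mono u : CharRing k).coeff v = if u = v then 1 else 0 := by
  simp [mono, Finsupp.single_apply]

theorem perm_id {n : ℕ} (u : Fin n → ℚ) (σ : Perm (Fin n)) (h : StrictAnti u)
    (h' : StrictAnti fun i => u (σ i)) : σ = 1 := by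
  have : StrictMono σ := by
    intro i j hij
    have := h' hij
    exact h.lt_iff_gt.mp this
  have h2 := (StrictMono.range_inj this strictMono_id).mp (by simp [σ.surjective.range_eq])
  ext i; simp [h2]

theorem altA_coeff (r : ℕ) (u v : Fin (r+1) → ℚ) (hu : StrictAnti u) (hv : StrictAnti v) :
    (altA r u).coeff v = if u = v then 1 else 0 := by
  simp only [altA, coeff_sum, coe_finsetSum, Finset.sum_apply, coeff_smul, Finsupp.smul_apply,
    coeff_mono]
  rw [sum_eq_single 1]
  · rw [Perm.sign_one]; exact one_smul ℤ _
  · intro σ _ hσ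
    rw [if_neg]; · simp
    intro h
    exact hσ (perm_id u σ hu (by rw [h]; exact hv))
  · simp

theorem altY_coeff (n : ℕ) (u v : Fin n → ℚ) (hu : StrictAnti u) (hv : StrictAnti v)
    (hu0 : ∀ i, 0 < u i) (hv0 : ∀ i, 0 < v i) :
    (altY .C n u).coeff v = if u = v then 1 else 0 := by
  have key : ∀ (σ : Perm (Fin n)) (s : Fin n → Bool), (fun i => (if s i then -1 else 1) * u (σ i)) = v →
      σ = 1 ∧ s = fun _ => false := by
    intro σ s h
    have hs : s = fun _ => false := by
      funext i
      have h1 := congrFun h i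
      have h2 := hv0 i
      have h3 := hu0 (σ i)
      by_contra hc
      simp at hc
      simp [hc] at h1
      linarith
    refine ⟨?_, hs⟩
    subst hs
    simp at h
    exact perm_id u σ hu (by rw [h]; exact hv)
  simp only [altY, coeff_sum, coe_finsetSum, Finset.sum_apply, reduceCtorEq, false_and, if_false,
    coeff_smul, Finsupp.smul_apply, coeff_mono]
  rw [sum_eq_single 1]
  · rw [sum_eq_single (fun _ => false)]
    · simp
    · intro s _ hs
      rw [if_neg]; · simp
      intro h; exact hs (key _ _ h).2
    · simp
  · intro σ _ hσ
    refine sum_eq_zero fun s _ => ?_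
    rw [if_neg]; · simp
    intro h; exact hσ (key _ _ h).1
  · simp

theorem sum_mul_altA (r : ℕ) {S : Type} [Fintype S] (g : S → Fin (r+1) → ℚ)
    (hg : ∀ σ : Perm (Fin (r+1)), ∃ π : Perm S, ∀ s i, g (π s) i = g s (σ i))
    (v : Fin (r+1) → ℚ) : (∑ s, mono (g s)) * altA r v = ∑ s, altA r (v + g s) := by
  simp only [altA]
  rw [sum_comm, mul_sum]
  refine sum_congr rfl fun σ _ => ?_
  obtain ⟨π, hπ⟩ := hg σ
  rw [← sum_comp π, sum_mul]
  refine sum_congr rfl fun s _ => ?_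
  rw [mul_smul_comm, ← mono_add]
  congr 2
  funext i; simp [hπ, add_comm]

def psY (n : ℕ) (m : ℚ) : CharRing n := ∑ i, (xp i m + xp i (-m))

theorem psY_mul (n : ℕ) (m : ℚ) (v : Fin n → ℚ) : psY n m * altY .C n v =
    ∑ j, (altY .C n (update v j (v j + m)) + altY .C n (update v j (v j - m))) := by
  have h : ∀ j, altY .C n (update v j (v j + m)) + altY .C n (update v j (v j - m)) =
      ((MY v).updateCol j (fun i => (xp i m + xp i (-m)) * MY v i j)).det := by
    intro j
    have e1 : ∀ c, MY (update v j c) = (MY v).updateCol j (fun i => br i c) := by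
      intro c; ext i l : 2
      by_cases h : l = j
      · subst h; simp [MY]
      · simp [MY, h]
    rw [altY_det, altY_det, e1, e1, ← Matrix.det_updateCol_add]
    congr 2
    funext i
    simp only [Pi.add_apply, MY, br, sub_eq_add_neg, neg_add, neg_neg, xp_add]
    ring
  simp only [h]
  simp only [altY_det]
  have h2 : ∀ j, ((MY v).updateCol j (fun i => (xp i m + xp i (-m)) * MY v i j)).det =
      ∑ σ : Perm (Fin n), ((Perm.sign σ : ℤˣ) : ℤ) * ((xp (σ j) m + xp (σ j) (-m)) * ∏ i, MY v (σ i) i) := by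
    intro j
    rw [det_apply']
    refine sum_congr rfl fun σ _ => ?_
    congr 1
    rw [← mul_prod_erase _ _ (mem_univ j), ← mul_prod_erase _ (fun i => MY v (σ i) i) (mem_univ j),
      Matrix.updateCol_self, mul_assoc]
    congr 2
    refine prod_congr rfl fun i hi => ?_
    rw [Matrix.updateCol_ne (ne_of_mem_erase hi)]
  simp only [h2]
  rw [sum_comm, det_apply', mul_sum]
  refine sum_congr rfl fun σ _ => ?_
  rw [← mul_sum, ← sum_mul, sum_comp σ (fun i => xp i m + xp i (-m)), psY]
  ring
end

section
variable {k : ℕ}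

abbrev IA (k : ℕ) := {p : Fin k × Fin k // p.1 < p.2}
def ep (i : Fin k) : Fin k → ℚ := Pi.single i 1
def αA (p : IA k) : Fin k → ℚ := ep p.1.1 - ep p.1.2
def αY (p : Fin k × Fin k) : Fin k → ℚ := if p.1 < p.2 then ep p.1 - ep p.2 else ep p.1 + ep p.2

theorem xp1 (i : Fin k) : xp i 1 = mono (ep i) := rfl

theorem prod_IA {R : Type} [CommMonoid R] (F : Fin k → Fin k → R) :
    ∏ p : IA k, F p.1.1 p.1.2 = ∏ i, ∏ j, if i < j then F i j else 1 := by
  rw [← Fintype.prod_prod_type' (f := fun i j => if i < j then F i j else 1)]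
  rw [← Finset.prod_filter]
  exact (Finset.prod_subtype (F := inferInstance) (univ.filter fun p : Fin k × Fin k => p.1 < p.2) (by simp) (fun p : Fin k × Fin k => F p.1 p.2)).symm

theorem prod_Ioi {R : Type} [CommMonoid R] (F : Fin k → Fin k → R) :
    ∏ i, ∏ j ∈ Finset.Ioi i, F i j = ∏ i, ∏ j, if i < j then F i j else 1 := by
  refine prod_congr rfl fun i _ => ?_
  rw [← Finset.prod_filter]
  refine prod_congr ?_ fun _ _ => rfl
  ext j; simp

theorem prod_xp_Ioi (n : ℕ) : ∏ i : Fin n, ∏ j, (if i < j then xp i 1 else 1) = mono (fun i : Fin n => (n : ℚ) - 1 - (i : ℕ)) := by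
  rw [← prod_Ioi, mono_eq_prod]
  refine prod_congr rfl fun i _ => ?_
  rw [Finset.prod_const, Fin.card_Ioi, xp_pow, xp]
  congr 2
  have := i.2
  rw [Nat.sub_sub, cast_sub (by omega)]; push_cast; ring

theorem denA (r : ℕ) : altA r (rhoA r) = mono (rhoA r) * ∏ p : IA (r+1), (1 - mono (-(αA p))) := by
  have h1 : MA (rhoA r) = Matrix.projVandermonde (1 : Fin (r+1) → CharRing (r+1)) (fun i => xp i 1) := by
    ext i j : 2
    simp only [MA, rhoA, Matrix.projVandermonde_apply, Pi.one_apply, one_pow, one_mul, xp_pow]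
    congr 1
    have := j.2
    rw [Fin.val_rev, cast_sub (by omega)]; push_cast; ring
  rw [altA_det, h1, Matrix.det_projVandermonde, prod_Ioi]
  rw [show ∏ p : IA (r+1), (1 - mono (-(αA p))) = _ from prod_IA (fun i j => 1 - mono (-(ep i - ep j)))]
  have := prod_xp_Ioi (r+1)
  rw [show (fun i : Fin (r+1) => ((r+1 : ℕ) : ℚ) - 1 - (i : ℕ)) = rhoA r by
    funext i; simp [rhoA]] at this
  rw [← this]
  simp only [← prod_mul_distrib]
  refine prod_congr rfl fun i _ => prod_congr rfl fun j _ => ?_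
  split_ifs with h
  · simp only [Pi.one_apply, one_mul, mul_sub, mul_one, xp1, ← mono_add]
    congr 2; abel
  · simp

def Sp (R : Type) [CommRing R] : ℕ → Polynomial R
  | 0 => 1
  | 1 => Polynomial.X
  | (n+2) => Polynomial.X * Sp R (n+1) - Sp R n

theorem Sp_deg (R : Type) [CommRing R] [Nontrivial R] (n : ℕ) : ((Sp R n).Monic ∧ (Sp R n).natDegree = n) ∧
    ((Sp R (n+1)).Monic ∧ (Sp R (n+1)).natDegree = n+1) := by
  induction n with
  | zero => exact ⟨⟨Polynomial.monic_one, by simp [Sp]⟩, ⟨monic_X, by simp [Sp]⟩⟩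
  | succ n ih =>
    refine ⟨ih.2, ?_⟩
    have h1 : (Polynomial.X * Sp R (n+1)).Monic := monic_X.mul ih.2.1
    have h2 : (Polynomial.X * Sp R (n+1)).natDegree = n + 2 := by
      rw [monic_X.natDegree_mul ih.2.1, Polynomial.natDegree_X, ih.2.2]; ring
    have h3 : (Sp R n).natDegree < (Polynomial.X * Sp R (n+1)).natDegree := by rw [h2, ih.1.2]; omega
    constructor
    · show (Polynomial.X * Sp R (n+1) - Sp R n).Monic
      exact h1.sub_of_left (Polynomial.degree_lt_degree h3)
    · show (Polynomial.X * Sp R (n+1) - Sp R n).natDegree = _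
      rw [Polynomial.natDegree_sub_eq_left_of_natDegree_lt h3, h2]

theorem Sp_br (i : Fin k) (n : ℕ) : br i (n+1) = br i 1 * (Sp (CharRing k) n).eval (xp i 1 + xp i (-1)) ∧
    br i (n+2) = br i 1 * (Sp (CharRing k) (n+1)).eval (xp i 1 + xp i (-1)) := by
  induction n with
  | zero =>
    constructor
    · simp [Sp]
    · simp only [Sp, eval_X, br, CharP.cast_eq_zero, zero_add]
      rw [show (2:ℚ) = 1 + 1 by norm_num, show (-(1+1) : ℚ) = -1 + -1 by norm_num, xp_add, xp_add]; ring
  | succ n ih =>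
    have e1 : br i (n+2) = br i (((n+1 : ℕ) : ℚ) + 1) := by congr 1; push_cast; ring
    refine ⟨by rw [← e1]; exact ih.2, ?_⟩
    rw [Sp, Polynomial.eval_sub, Polynomial.eval_mul, eval_X, mul_sub, mul_left_comm, ← ih.2, ← ih.1]
    have h1 : xp i 1 * xp i (-1) = 1 := by rw [← xp_add]; simp [xp_zero]
    simp only [br]
    rw [show (((n+1:ℕ):ℚ) + 2) = (n+2) + 1 by push_cast; ring, show (-((n+2:ℚ) + 1)) = (-(n+2)) + -1 by ring,
      show ((n:ℚ)+1) = (n+2) + -1 by ring, show (-((n+2:ℚ) + -1)) = -(n+2) + 1 by ring]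
    simp only [xp_add]; ring

theorem rev_prod {R : Type} [CommMonoid R] (F : Fin k → Fin k → R) :
    (∏ i, ∏ j, if i < j then F (rev j) (rev i) else 1) = ∏ i, ∏ j, if i < j then F i j else 1 := by
  rw [← prod_comp revPerm]
  rw [Finset.prod_comm]
  rw [← prod_comp revPerm]
  refine prod_congr rfl fun i _ => ?_
  refine prod_congr rfl fun j _ => ?_
  simp [Fin.rev_lt_rev]

theorem denY (n : ℕ) : altY .C n (rhoY .C n) = mono (rhoY .C n) * ∏ p : Fin n × Fin n, (1 - mono (-(αY p))) := by
  have h0 : altY .C n (rhoY .C n) = ((MY (rhoY .C n)).submatrix rev rev).det := by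
    rw [altY_det]; exact (Matrix.det_submatrix_equiv_self revPerm _).symm
  have h1 : (MY (rhoY .C n)).submatrix rev rev = Matrix.of fun i j => br (rev i) 1 *
      (Matrix.of fun (i j : Fin n) => ((Sp (CharRing n) j).eval (xp (rev i) 1 + xp (rev i) (-1)))) i j := by
    ext i j : 2
    simp only [submatrix_apply, MY, rhoY, of_apply, ← (Sp_br _ _).1]
    congr 1
    have := j.2
    rw [Fin.val_rev, cast_sub (by omega)]; push_cast; ring
  rw [h0, h1, Matrix.det_mul_column,
    ← Matrix.det_eval_matrixOfPolynomials_eq_det_vandermonde (fun i : Fin n => xp (rev i) 1 + xp (rev i) (-1)) (fun j => Sp (CharRing n) j)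
      (fun j => (Sp_deg _ j).1.2) (fun j => (Sp_deg _ j).1.1), Matrix.det_vandermonde, prod_Ioi]
  rw [rev_prod (fun i j => xp i 1 + xp i (-1) - (xp j 1 + xp j (-1)))]
  rw [show (∏ i : Fin n, br i.rev 1) = _ from prod_comp revPerm (fun i : Fin n => br i 1)]
  have e1 : ∏ p : Fin n × Fin n, (1 - mono (-(αY p))) = (∏ i : Fin n, (1 - mono (-(ep i + ep i)))) *
      ((∏ i, ∏ j, if i < j then (1 - mono (-(ep i - ep j))) else 1) * ∏ i : Fin n, ∏ j, if i < j then (1 - mono (-(ep i + ep j))) else 1) := by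
    rw [Finset.prod_comm (f := fun i j : Fin n => if i < j then (1 - mono (-(ep i + ep j))) else 1)]
    have : (∏ i : Fin n, (1 - mono (-(ep i + ep i)))) = ∏ i : Fin n, ∏ j, if i = j then (1 - mono (-(ep i + ep i))) else 1 := by
      simp
    rw [this, Fintype.prod_prod_type]
    simp only [← prod_mul_distrib]
    refine prod_congr rfl fun i _ => prod_congr rfl fun j _ => ?_
    simp only [αY]
    rcases lt_trichotomy i j with h | h | h
    · simp [h, h.ne, h.le.not_gt]
    · subst h; simp
    · simp [h, h.ne', h.le.not_gt, add_comm (ep i)]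
  have e2 : (mono (rhoY .C n) : CharRing n) = (∏ i : Fin n, xp i 1) * ∏ i : Fin n, ∏ j, (if i < j then xp i 1 else 1) := by
    rw [prod_xp_Ioi]; simp only [xp]; rw [← mono_sum, ← mono_add]
    congr 1; funext i
    simp [rhoY, Finset.sum_apply, Pi.single_apply]; ring
  rw [e1, e2]
  rw [show ∀ a b c d : CharRing n, (a * b) * (c * d) = (a * c) * (b * d) by intros; ring]
  have hc : ∀ a b c d : CharRing n, a = c → b = d → a * b = c * d := by intro a b c d h1 h2; rw [h1, h2]
  refine hc _ _ _ _ ?_ ?_ <;> simp only [← prod_mul_distrib]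
  · refine prod_congr rfl fun i _ => ?_
    rw [mul_sub, xp1, ← mono_add, br, xp, xp]; simp only [ep, mul_one]; congr 2
    rw [← Pi.single_add, ← single_neg, ← Pi.single_add]; norm_num
  · refine prod_congr rfl fun i _ => prod_congr rfl fun j _ => ?_
    split_ifs with h
    · have a1 : (mono (-(ep i - ep j)) : CharRing n) = xp i (-1) * xp j 1 := by
        rw [xp, xp, ← mono_add]; congr 1; simp only [ep, single_neg]; abel
      have a2 : (mono (-(ep i + ep j)) : CharRing n) = xp i (-1) * xp j (-1) := by
        rw [xp, xp, ← mono_add]; congr 1; simp only [ep, single_neg]; abel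
      have h1 : xp i 1 * xp i (-1) = 1 := by rw [← xp_add]; simp [xp_zero]
      have h2 : xp j 1 * xp j (-1) = 1 := by rw [← xp_add]; simp [xp_zero]
      rw [a1, a2]
      linear_combination (xp j 1 + xp j (-1) - xp j 1 * xp j (-1) * xp i (-1)) * h1 - xp i (-1) * h2
    · simp
end

section
variable {k : ℕ}

def toQ : CharRing k →+* QR k := AddMonoidAlgebra.mapRingHom (Fin k → ℚ) (Int.castRingHom ℚ)
theorem coeff_toQ (F : CharRing k) (v) : (toQ F).coeff v = (F.coeff v : ℚ) := by simp [toQ]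
theorem toQ_mono (v : Fin k → ℚ) : toQ (mono v) = single v 1 := by simp [toQ, mono]
theorem toQ_inj : Injective (toQ : CharRing k → QR k) := by
  intro F G h
  ext v
  have := congrArg (fun F => F.coeff v) h
  simpa [coeff_toQ] using this

theorem toQ_denA (r : ℕ) : toQ (altA r (rhoA r)) = single (rhoA r) 1 *
    ∏ p : IA (r+1), (1 - single (-(αA p)) 1) := by
  rw [denA]; simp [toQ_mono]
theorem toQ_denY (n : ℕ) : toQ (altY .C n (rhoY .C n)) = single (rhoY .C n) 1 *
    ∏ p : Fin n × Fin n, (1 - single (-(αY p)) 1) := by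
  rw [denY]; simp [toQ_mono]

theorem lapA (r : ℕ) (v : Fin (r+1) → ℚ) : qm nsq (toQ (altA r v)) = nsq v • toQ (altA r v) := by
  simp only [altA, map_sum, map_zsmul, smul_sum, toQ_mono, qm_single]
  refine sum_congr rfl fun σ _ => ?_
  have h : nsq (fun i => v (σ i)) = nsq v := by
    simp only [nsq, dt]; rw [sum_comp σ (fun i => v i * v i)]
  rw [h, smul_comm, smul_single (nsq v), smul_eq_mul]
theorem lapY (n : ℕ) (v : Fin n → ℚ) : qm nsq (toQ (altY .C n v)) = nsq v • toQ (altY .C n v) := by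
  simp only [altY, map_sum, smul_sum, reduceCtorEq, false_and, if_false, map_zsmul, toQ_mono, qm_single]
  refine sum_congr rfl fun σ _ => sum_congr rfl fun s _ => ?_
  have h : nsq (fun i => (if s i then -1 else 1) * v (σ i)) = nsq v := by
    simp only [nsq, dt]; rw [← sum_comp σ (fun i => v i * v i)]
    refine sum_congr rfl fun i _ => ?_
    split_ifs <;> ring
  rw [h, smul_comm, smul_single (nsq v), smul_eq_mul]

theorem rfl_apply (α v : Fin k → ℚ) : rfl' α v = v - (2 * dt α v / nsq α) • α := rfl
theorem dt_ep (i : Fin k) (v) : dt (ep i) v = v i := by simp [dt, ep, Pi.single_apply]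
theorem dt_single (i : Fin k) (v : Fin k → ℚ) (c) : dt v (Pi.single i c) = v i * c := by
  simp [dt, Pi.single_apply]
theorem ep_apply (i j : Fin k) : ep i j = if j = i then 1 else 0 := by simp [ep, Pi.single_apply]

theorem rfl1 (i j l : Fin k) (h : i ≠ j) (c : ℚ) :
    rfl' (ep i - ep j) (Pi.single l c) = Pi.single (swap i j l) c := by
  have hn : nsq (ep i - ep j) = 2 := by
    simp [nsq, sub_dt, dt_sub, dt_ep, ep_apply, h, h.symm]; norm_num
  rw [rfl_apply, hn, dt_single]
  have hl : (swap i j l) = if l = i then j else if l = j then i else l := swap_apply_def i j l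
  funext m
  simp only [Pi.sub_apply, Pi.smul_apply, ep_apply, Pi.single_apply, hl, smul_eq_mul]
  by_cases h1 : l = i
  · subst h1; by_cases h2 : m = l
    · subst h2; simp [h, h.symm]
    · by_cases h3 : m = j <;> simp [h, h.symm, h2, h3]
  · by_cases h2 : l = j
    · subst h2; by_cases h3 : m = i <;> by_cases h4 : m = l <;> simp [*, Ne.symm h] 
      · subst h3; exact (h h4).elim
      · ring
      · ring
    · simp [h1, h2]

theorem rfl2 (i j l : Fin k) (h : i ≠ j) (c : ℚ) :
    rfl' (ep i + ep j) (Pi.single l c) = Pi.single (swap i j l) (if l = i ∨ l = j then -c else c) := by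
  have hn : nsq (ep i + ep j) = 2 := by
    simp [nsq, add_dt, dt_add, dt_ep, ep_apply, h, h.symm]; norm_num
  rw [rfl_apply, hn, dt_single]
  have hl : (swap i j l) = if l = i then j else if l = j then i else l := swap_apply_def i j l
  funext m
  simp only [Pi.sub_apply, Pi.add_apply, Pi.smul_apply, ep_apply, Pi.single_apply, hl, smul_eq_mul]
  by_cases h1 : l = i
  · subst h1; by_cases h2 : m = l
    · subst h2; simp [h, h.symm]
    · by_cases h3 : m = j <;> simp [h, h.symm, h2, h3]
  · by_cases h2 : l = j
    · subst h2; by_cases h3 : m = i <;> by_cases h4 : m = l <;> simp [*, Ne.symm h] 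
    · simp [h1, h2]

theorem rfl3 (i l : Fin k) (c : ℚ) :
    rfl' (ep i + ep i) (Pi.single l c) = Pi.single l (if l = i then -c else c) := by
  have hn : nsq (ep i + ep i) = 4 := by
    simp [nsq, add_dt, dt_add, dt_ep, ep_apply]; norm_num
  rw [rfl_apply, hn, dt_single]
  funext m
  simp only [Pi.sub_apply, Pi.add_apply, Pi.smul_apply, ep_apply, Pi.single_apply, smul_eq_mul]
  by_cases h1 : l = i
  · subst h1; by_cases h2 : m = l
    · subst h2; simp; ring
    · simp [h2]
  · simp [h1]

abbrev φ (α : Fin k → ℚ) : CharRing k →+* CharRing k := mapDomainRingHom ℤ (rfl' α)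

theorem φ_xp (α : Fin k → ℚ) (l : Fin k) (c : ℚ) : φ α (xp l c) = mono (rfl' α (Pi.single l c)) := by
  simp [φ, xp, mono, mapDomainRingHom_apply, mapDomain_single]

theorem altA_anti (r : ℕ) (v) (p : IA (r+1)) : φ (αA p) (altA r v) = - altA r v := by
  have h : p.1.1 ≠ p.1.2 := p.2.ne
  rw [altA_det, map_det]
  have : (φ (αA p)).mapMatrix (MA v) = (MA v).submatrix (swap p.1.1 p.1.2) id := by
    ext i j : 2
    simp only [mapMatrix_apply, map_apply, MA, φ_xp, αA, rfl1 _ _ _ h]; rfl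
  rw [this, det_permute, Perm.sign_swap h]; simp

theorem altY_anti (n : ℕ) (v) (p : Fin n × Fin n) : φ (αY p) (altY .C n v) = - altY .C n v := by
  rw [altY_det, map_det]
  obtain ⟨i, j⟩ := p
  rcases lt_trichotomy i j with h | h | h
  · have : (φ (αY (i,j))).mapMatrix (MY v) = (MY v).submatrix (swap i j) id := by
      ext l m : 2
      simp only [mapMatrix_apply, map_apply, MY, br, map_sub, φ_xp, αY, h, if_true, rfl1 _ _ _ h.ne]; rfl
    rw [this, det_permute, Perm.sign_swap h.ne]; simp
  · subst h
    have : (φ (αY (i,i))).mapMatrix (MY v) = (MY v).updateRow i ((-1 : CharRing n) • MY v i) := by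
      ext l m : 2
      simp only [mapMatrix_apply, map_apply, MY, br, map_sub, φ_xp, αY, lt_irrefl, if_false, rfl3]
      by_cases hl : l = i
      · subst hl; simp only [if_true, Matrix.updateRow_self, Pi.smul_apply, smul_eq_mul, MY, br, xp, neg_neg]; ring
      · simp only [hl, if_false, Matrix.updateRow_ne hl, MY, br]; rfl
    rw [this, Matrix.det_updateRow_smul, Matrix.updateRow_eq_self]; simp
  · have : (φ (αY (i,j))).mapMatrix (MY v) = Matrix.of fun l m => (if l = i ∨ l = j then (-1 : CharRing n) else 1) *
        (MY v).submatrix (swap i j) id l m := by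
      ext l m : 2
      simp only [mapMatrix_apply, map_apply, MY, br, map_sub, φ_xp, αY, h.le.not_gt, if_false, rfl2 _ _ _ h.ne',
        of_apply, submatrix_apply]
      split_ifs <;> simp [xp]
    rw [this, Matrix.det_mul_column, det_permute, Perm.sign_swap h.ne']
    have h2 : (∏ l, if l = i ∨ l = j then (-1 : CharRing n) else 1) = 1 := by
      rw [Finset.prod_ite]
      simp only [Finset.prod_const, Finset.prod_const_one, mul_one]
      have : (univ.filter fun l => l = i ∨ l = j) = {i, j} := by ext; simp
      rw [this, Finset.card_pair h.ne']; simp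
    rw [h2]; simp

theorem αA_ne (p : IA k) : αA p ≠ 0 := by
  intro h; have := congrFun h p.1.1; simp [αA, ep_apply, p.2.ne] at this
theorem αY_ne (p : Fin k × Fin k) : αY p ≠ 0 := by
  intro h; have := congrFun h p.1
  simp only [αY] at this
  split_ifs at this with h1
  · simp [ep_apply, h1.ne] at this
  · simp [ep_apply] at this
    split_ifs at this <;> norm_num at this

theorem anti_mul (α : Fin k → ℚ) (hα : α ≠ 0) (B F : QR k)
    (hB : mapDomainRingHom ℚ (rfl' α) B = -B)
    (hF : ∀ v, F.coeff (rfl' α v) = F.coeff v) (v) : (B * F).coeff (rfl' α v) = - (B * F).coeff v := by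
  have inj : Injective (rfl' α) := by
    intro u w h; rw [← rfl_rfl α u hα, h, rfl_rfl α w hα]
  have key : ∀ (G : QR k) u, (mapDomainRingHom ℚ (rfl' α) G).coeff (rfl' α u) = G.coeff u := by
    intro G u
    rw [mapDomainRingHom_apply, coeff_mapDomain]
    exact mapDomain_apply inj _ _
  have hF' : mapDomainRingHom ℚ (rfl' α) F = F := by
    ext u
    conv_lhs => rw [← rfl_rfl α u hα]
    rw [key, hF]
  have h1 := key (B * F) v
  rw [map_mul, hB, hF', neg_mul] at h1
  rw [← h1]; simp

theorem toQ_φ (α : Fin k → ℚ) (F : CharRing k) : toQ (φ α F) = mapDomainRingHom ℚ (rfl' α) (toQ F) := by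
  have := AddMonoidAlgebra.mapRingHom_comp_mapDomainRingHom (Int.castRingHom ℚ) (rfl' α)
  exact congrArg (fun f => f F) this

theorem toQA_anti (r : ℕ) (v) (p : IA (r+1)) :
    mapDomainRingHom ℚ (rfl' (αA p)) (toQ (altA r v)) = - toQ (altA r v) := by
  rw [← toQ_φ, altA_anti, map_neg]
theorem toQY_anti (n : ℕ) (v) (p : Fin n × Fin n) :
    mapDomainRingHom ℚ (rfl' (αY p)) (toQ (altY .C n v)) = - toQ (altY .C n v) := by
  rw [← toQ_φ, altY_anti, map_neg]

theorem vanish {A : Type} (α : A → Fin k → ℚ) (ρ : Fin k → ℚ) (hα : ∀ a, α a ≠ 0) (hρ : ∀ a, 0 < dt ρ (α a)) (G : QR k)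
    (hG : ∀ a v, G.coeff (rfl' (α a) v) = - G.coeff v)
    (h0 : ∀ v, (∀ a, 0 < dt v (α a)) → G.coeff v = 0) : G = 0 := by
  by_contra hne
  have hs : G.coeff.support.Nonempty := by
    rw [Finsupp.support_nonempty_iff]; intro h; apply hne; ext v; simp [h]
  obtain ⟨w, hw, hmax⟩ := Finset.exists_max_image G.coeff.support (fun w => dt ρ w) hs
  have hw' : G.coeff w ≠ 0 := by simpa using hw
  refine hw' (h0 w fun a => ?_)
  by_contra hc
  push Not at hc
  rcases hc.lt_or_eq with hc | hc
  · have h1 : rfl' (α a) w ∈ G.coeff.support := by simp [hG, hw']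
    have h2 := hmax _ h1
    rw [rfl_apply, dt_sub, dt_smul] at h2
    have h3 := nsq_pos (α a) (hα a)
    rw [dt_comm] at hc
    have : 2 * dt (α a) w / nsq (α a) * dt ρ (α a) < 0 :=
      mul_neg_of_neg_of_pos (div_neg_of_neg_of_pos (by linarith) h3) (hρ a)
    linarith
  · have h1 : rfl' (α a) w = w := by rw [rfl_apply, dt_comm, hc]; simp
    have h2 := hG a w
    rw [h1] at h2
    apply hw'; linarith

theorem domA (v : Fin k → ℚ) : (∀ p : IA k, 0 < dt v (αA p)) ↔ StrictAnti v := by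
  have : ∀ p : IA k, dt v (αA p) = v p.1.1 - v p.1.2 := by
    intro p; rw [αA, dt_sub, dt_comm, dt_ep, dt_comm, dt_ep]
  simp only [this, sub_pos]
  exact ⟨fun h i j hij => h ⟨(i, j), hij⟩, fun h p => h p.2⟩
theorem domY (v : Fin k → ℚ) : (∀ p : Fin k × Fin k, 0 < dt v (αY p)) ↔ StrictAnti v ∧ ∀ i, 0 < v i := by
  have : ∀ p : Fin k × Fin k, dt v (αY p) = if p.1 < p.2 then v p.1 - v p.2 else v p.1 + v p.2 := by
    intro p; rw [αY]; split_ifs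
    · rw [dt_sub, dt_comm, dt_ep, dt_comm, dt_ep]
    · rw [dt_add, dt_comm, dt_ep, dt_comm, dt_ep]
  simp only [this]
  constructor
  · intro h
    refine ⟨fun i j hij => ?_, fun i => ?_⟩
    · have := h (i, j); simp only [hij, if_true] at this; linarith
    · have := h (i, i); simp at this; linarith
  · rintro ⟨h1, h2⟩ ⟨i, j⟩
    dsimp only
    split_ifs with h
    · have := h1 h; linarith
    · have := h2 i; have := h2 j; linarith
theorem rhoA_anti (r : ℕ) : StrictAnti (rhoA r) := by
  intro i j h
  simp only [rhoA]
  have : ((i : ℕ) : ℚ) < (j : ℕ) := by exact_mod_cast h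
  linarith
theorem rhoY_anti (n : ℕ) : StrictAnti (rhoY .C n) ∧ ∀ i, 0 < rhoY .C n i := by
  constructor
  · intro i j h
    simp only [rhoY]
    have : ((i : ℕ) : ℚ) < (j : ℕ) := by exact_mod_cast h
    linarith
  · intro i; simp only [rhoY]
    have : ((i : ℕ) : ℚ) < n := by exact_mod_cast i.2
    linarith
end

section
variable {k : ℕ} {ι A V : Type} [Fintype ι] [DecidableEq ι] [Fintype A] [DecidableEq A] [AddCommGroup V] [Module ℚ V]

structure RD (k : ℕ) {ι : Type} (A : Type) {V : Type} [Fintype ι] [DecidableEq ι] [Fintype A] [DecidableEq A]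
    [AddCommGroup V] [Module ℚ V] (b : Basis ι ℚ V) where
  wt : ι → Fin k → ℚ
  α : A → Fin k → ℚ
  H : Fin k → End ℚ V
  e : A → End ℚ V
  f : A → End ℚ V
  hb : ∀ j i, H j (b i) = wt i j • b i
  hHe : ∀ j a, H j * e a - e a * H j = α a j • e a
  hHf : ∀ j a, H j * f a - f a * H j = - (α a j • f a)
  hef : ∀ a, e a * f a - f a * e a = ∑ j, α a j • H j
  ρ : Fin k → ℚ
  hρ : ∀ i, 2 * dt ρ (wt i) = ∑ a, dt (α a) (wt i)
  hce : ∀ c, (∑ j, H j * H j + ∑ a, (e a * f a + f a * e a)) * e c =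
    e c * (∑ j, H j * H j + ∑ a, (e a * f a + f a * e a))
  hcf : ∀ c, (∑ j, H j * H j + ∑ a, (e a * f a + f a * e a)) * f c =
    f c * (∑ j, H j * H j + ∑ a, (e a * f a + f a * e a))

namespace RD
variable {b : Basis ι ℚ V} (R : RD k A b)

theorem reprH (j : Fin k) (v : V) (i : ι) : b.repr (R.H j v) i = R.wt i j * b.repr v i := by
  conv_lhs => rw [← b.sum_repr v]
  simp only [map_sum, map_smul, R.hb, coe_finsetSum, Finset.sum_apply, Finsupp.smul_apply,
    Basis.repr_self, Finsupp.single_apply, smul_eq_mul]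
  rw [sum_eq_single i]
  · simp; ring
  · intro l _ h; simp [h]
  · simp

abbrev tm (b : Basis ι ℚ V) : End ℚ V →ₐ[ℚ] Matrix ι ι ℚ := (LinearMap.toMatrixAlgEquiv b).toAlgHom

theorem tm_apply (T : End ℚ V) (i j : ι) : tm b T i j = b.repr (T (b j)) i := by
  simp [LinearMap.toMatrixAlgEquiv_apply]

theorem tmH (j : Fin k) : tm b (R.H j) = diagonal (fun i => R.wt i j) := by
  ext i l
  rw [tm_apply, R.hb, diagonal_apply]
  by_cases h : i = l
  · subst h; simp
  · simp [h, Ne.symm h]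

theorem tm_sumH (c : Fin k → ℚ) : tm b (∑ j, c j • R.H j) = diagonal (fun i => dt c (R.wt i)) := by
  rw [map_sum]; simp only [map_smul, R.tmH, ← Matrix.diagonal_smul]
  ext i l
  rw [Matrix.sum_apply, diagonal_apply]
  by_cases h : i = l
  · subst h; simp [dt]
  · simp [h]

theorem tm_sqH : tm b (∑ j, R.H j * R.H j) = diagonal (fun i => nsq (R.wt i)) := by
  rw [map_sum]; simp only [map_mul, R.tmH, Matrix.diagonal_mul_diagonal]
  ext i l
  rw [Matrix.sum_apply, diagonal_apply]
  by_cases h : i = l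
  · subst h; simp [nsq, dt]
  · simp [h]

theorem tm_cas : tm b (∑ j, R.H j * R.H j + ∑ a, (R.e a * R.f a + R.f a * R.e a)) =
    diagonal (fun i => nsq (R.wt i)) + ∑ a, (tm b (R.e a) * tm b (R.f a) + tm b (R.f a) * tm b (R.e a)) := by
  rw [map_add, R.tm_sqH, map_sum]; simp only [map_add, map_mul]

theorem shift (T : End ℚ V) (β : Fin k → ℚ) (h : ∀ j, R.H j * T - T * R.H j = β j • T) (i l : ι)
    (hne : tm b T i l ≠ 0) : R.wt i = R.wt l + β := by
  funext j
  have h1 := congrArg (fun S => b.repr (S (b l)) i) (h j)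
  simp only [LinearMap.sub_apply, End.mul_apply, map_sub, R.hb, map_smul, Finsupp.sub_apply, R.reprH, LinearMap.smul_apply,
    Finsupp.smul_apply, smul_eq_mul, ← tm_apply] at h1
  have h2 : (R.wt i j - R.wt l j - β j) * tm b T i l = 0 := by linarith
  rcases mul_eq_zero.1 h2 with h3 | h3
  · simp only [Pi.add_apply]; linarith
  · exact absurd h3 hne

def toCD : CD k ι A where
  wt := R.wt
  α := R.α
  e a := tm b (R.e a)
  f a := tm b (R.f a)
  he a i j h := R.shift _ _ (fun l => R.hHe l a) i j h
  hf a i j h := by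
    have := R.shift (R.f a) (-(R.α a)) (fun l => by rw [R.hHf l a]; simp) i j h
    rw [this]; simp
  hef a := by rw [← map_mul, ← map_mul, ← map_sub, R.hef, R.tm_sumH]
  ρ := R.ρ
  hρ := R.hρ
  hce c := by rw [← R.tm_cas, ← map_mul, R.hce, map_mul]
  hcf c := by rw [← R.tm_cas, ← map_mul, R.hcf, map_mul]

def hw (ν : Fin k → ℚ) : Submodule ℚ V where
  carrier := {v | (∀ j, R.H j v = ν j • v) ∧ ∀ a, R.e a v = 0}
  zero_mem' := by simp
  add_mem' := by
    rintro x y ⟨h1, h2⟩ ⟨h3, h4⟩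
    exact ⟨fun j => by rw [map_add, h1, h3, smul_add], fun a => by rw [map_add, h2, h4, add_zero]⟩
  smul_mem' := by
    rintro c x ⟨h1, h2⟩
    exact ⟨fun j => by rw [map_smul, h1, smul_comm], fun a => by rw [map_smul, h2, smul_zero]⟩

theorem mem_hw (ν : Fin k → ℚ) (v : V) : v ∈ R.hw ν ↔ b.equivFun v ∈ R.toCD.HW ν := by
  have e1 : (∀ j, R.H j v = ν j • v) ↔ b.equivFun v ∈ R.toCD.Wt ν := by
    constructor
    · intro h i hi
      funext j
      have := R.reprH j v i
      rw [h j] at this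
      simp only [map_smul, Finsupp.smul_apply, smul_eq_mul] at this
      exact (mul_right_cancel₀ hi this).symm
    · intro h j
      apply b.repr.injective
      ext i
      rw [R.reprH]
      simp only [map_smul, Finsupp.smul_apply, smul_eq_mul]
      by_cases h0 : b.repr v i = 0
      · simp [h0]
      · have := h i h0
        rw [show R.wt i = ν from this]
  have e2 : ∀ a, R.e a v = 0 ↔ (R.toCD.e a).mulVec (b.equivFun v) = 0 := by
    intro a
    have : (R.toCD.e a).mulVec (b.equivFun v) = b.equivFun (R.e a v) :=
      LinearMap.toMatrix_mulVec_repr b b (R.e a) v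
    rw [this]; simp
  constructor
  · rintro ⟨h1, h2⟩; exact ⟨e1.1 h1, fun a => (e2 a).1 (h2 a)⟩
  · rintro ⟨h1, h2⟩; exact ⟨e1.2 h1, fun a => (e2 a).2 (h2 a)⟩

theorem finrank_hw (ν : Fin k → ℚ) : finrank ℚ (R.toCD.HW ν) = finrank ℚ (R.hw ν) := by
  have : R.toCD.HW ν = (R.hw ν).map (b.equivFun : V →ₗ[ℚ] (ι → ℚ)) := by
    ext x
    rw [Submodule.mem_map]
    constructor
    · intro h; exact ⟨b.equivFun.symm x, by rw [R.mem_hw, LinearEquiv.apply_symm_apply]; exact h, LinearEquiv.apply_symm_apply _ _⟩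
    · rintro ⟨v, hv, rfl⟩; exact (R.mem_hw ν v).1 hv
  rw [this]
  exact LinearEquiv.finrank_map_eq b.equivFun (R.hw ν)

theorem mult (B : QR k) (hB : B = single R.ρ 1 * ∏ a, (1 - single (-R.α a) 1))
    (hD : qm nsq B = nsq R.ρ • B) (ν) (h : ∀ a, 0 < dt (ν + R.ρ) (R.α a)) :
    (B * ∑ i, single (R.wt i) 1).coeff (ν + R.ρ) = (finrank ℚ (R.hw ν) : ℚ) := by
  subst hB
  have := R.toCD.lemma1 hD ν h
  rw [R.finrank_hw] at this
  rw [← this]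
  simp [gtr, CD.D]; rfl

theorem sym (a : A) (h : R.α a ≠ 0) (v) :
    (∑ i, single (R.wt i) (1 : ℚ)).coeff (rfl' (R.α a) v) =
    (∑ i, single (R.wt i) (1 : ℚ)).coeff v := by
  have := lemma0 R.wt (R.α a) h (R.toCD.e a) (R.toCD.f a) (R.toCD.he a) (R.toCD.hf a) (R.toCD.hef a) v
  simpa [gtr] using this
end RD
end

section
variable {k : ℕ} {ι V : Type} [Fintype ι] [DecidableEq ι] [AddCommGroup V] [Module ℚ V]
variable {n : Type} [Fintype n] [DecidableEq n]

abbrev E (a b : n) : Matrix n n ℚ := Matrix.single a b 1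

theorem mul_E (Z : Matrix n n ℚ) (a b : n) : Z * E a b = ∑ c, Z c a • E c b := by
  ext i j
  simp [Matrix.mul_apply, Matrix.sum_apply, single_apply]
  by_cases h : b = j <;> simp [h]
theorem E_mul (Z : Matrix n n ℚ) (a b : n) : E a b * Z = ∑ c, Z b c • E a c := by
  ext i j
  simp [Matrix.mul_apply, Matrix.sum_apply, single_apply]
  by_cases h : a = i <;> simp [h]

theorem cas_comm (G : Matrix n n ℚ →ₗ[ℚ] End ℚ V) (T : End ℚ V) (Z : Matrix n n ℚ)
    (h : ∀ Y, T * G Y - G Y * T = G (Z * Y - Y * Z)) :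
    T * (∑ a, ∑ b, G (E a b) * G (E b a)) = (∑ a, ∑ b, G (E a b) * G (E b a)) * T := by
  have h1 : ∀ a b, T * G (E a b) - G (E a b) * T = ∑ c, Z c a • G (E c b) - ∑ c, Z b c • G (E a c) := by
    intro a b
    rw [h, mul_E, E_mul, map_sub, map_sum, map_sum]; simp only [map_smul]
  rw [← sub_eq_zero]
  simp only [mul_sum, sum_mul, ← sum_sub_distrib]
  have h2 : ∀ a b, T * (G (E a b) * G (E b a)) - G (E a b) * G (E b a) * T =
      (T * G (E a b) - G (E a b) * T) * G (E b a) + G (E a b) * (T * G (E b a) - G (E b a) * T) := by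
    intros; noncomm_ring
  simp only [h2, h1, sub_mul, mul_sub, sum_mul, mul_sum, sum_add_distrib, sum_sub_distrib,
    smul_mul_assoc, mul_smul_comm]
  have e1 : ∑ a, ∑ b, ∑ c, Z c a • (G (E c b) * G (E b a)) = ∑ a, ∑ b, ∑ c, Z a c • (G (E a b) * G (E b c)) := by
    calc _ = ∑ b, ∑ a, ∑ c, Z c a • (G (E c b) * G (E b a)) := sum_comm
      _ = ∑ b, ∑ c, ∑ a, Z c a • (G (E c b) * G (E b a)) := sum_congr rfl fun b _ => sum_comm
      _ = _ := sum_comm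
  have e2 : ∑ a, ∑ b, ∑ c, Z b c • (G (E a c) * G (E b a)) = ∑ a, ∑ b, ∑ c, Z c b • (G (E a b) * G (E c a)) :=
    sum_congr rfl fun a _ => sum_comm
  rw [e1, e2]; abel

theorem sum_split {M : Type} [AddCommMonoid M] (F : Fin k → Fin k → M) :
    ∑ i, ∑ j, F i j = ∑ i, F i i + ∑ p : IA k, (F p.1.1 p.1.2 + F p.1.2 p.1.1) := by
  have h : ∑ p : IA k, (F p.1.1 p.1.2 + F p.1.2 p.1.1) = ∑ i, ∑ j, if i < j then F i j + F j i else 0 := by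
    exact prod_IA (R := Multiplicative M) (fun i j => F i j + F j i)
  have h2 : (∑ i, ∑ j, if i < j then F i j + F j i else 0) = (∑ i, ∑ j, if i < j then F i j else 0) +
      ∑ i, ∑ j, if j < i then F i j else 0 := by
    rw [sum_comm (f := fun i j => if j < i then F i j else 0)]
    simp only [← sum_add_distrib]
    refine sum_congr rfl fun i _ => sum_congr rfl fun j _ => ?_
    split_ifs <;> simp
  have h3 : ∑ i, F i i = ∑ i, ∑ j, if i = j then F i j else 0 := by simp
  rw [h, h2, h3]
  simp only [← sum_add_distrib]
  refine sum_congr rfl fun i _ => sum_congr rfl fun j _ => ?_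
  rcases lt_trichotomy i j with h | h | h
  · simp [h, h.ne, h.le.not_gt]
  · subst h; simp
  · simp [h, h.ne', h.le.not_gt]

theorem E_br (a b c d : n) : E a b * E c d - E c d * E a b = (if b = c then E a d else 0) - (if d = a then E c b else 0) := by
  congr 1
  · split_ifs with h
    · subst h; simp
    · simp [h]
  · split_ifs with h
    · subst h; simp
    · simp [h]

def RA (G : MF k →ₗ[ℚ] End ℚ V)
    (hG : ∀ Z Y, G Z * G Y - G Y * G Z = G (Z * Y - Y * Z)) (b : Basis ι ℚ V) (wt : ι → Fin k → ℚ)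
    (hb : ∀ j i, G (E j j) (b i) = wt i j • b i) (ρ : Fin k → ℚ)
    (hρ : ∀ i, 2 * dt ρ (wt i) = ∑ a, dt (αA a) (wt i)) : RD k (IA k) b :=
  have hc : (∑ j, G (E j j) * G (E j j) + ∑ a : IA k, (G (E a.1.1 a.1.2) * G (E a.1.2 a.1.1) + G (E a.1.2 a.1.1) * G (E a.1.1 a.1.2)))
    = ∑ a, ∑ b, G (E a b) * G (E b a) := (sum_split (fun i j => G (E i j) * G (E j i))).symm
  { wt := wt
    α := αA
    H := fun j => G (E j j)
    e := fun p => G (E p.1.1 p.1.2)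
    f := fun p => G (E p.1.2 p.1.1)
    hb := hb
    hHe := by
      intro j p
      rw [hG, ← map_smul, E_br]
      congr 1
      simp only [αA, Pi.sub_apply, ep_apply]
      have := p.2.ne
      by_cases h1 : j = p.1.1
      · subst h1; simp [this, this.symm]
      · by_cases h2 : j = p.1.2
        · subst h2; simp [this, this.symm]
        · simp [h1, h2, Ne.symm h2]
    hHf := by
      intro j p
      rw [hG, ← map_smul, ← map_neg, E_br]
      congr 1
      simp only [αA, Pi.sub_apply, ep_apply]
      have := p.2.ne
      by_cases h1 : j = p.1.1
      · subst h1; simp [this, this.symm]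
      · by_cases h2 : j = p.1.2
        · subst h2; simp [this, this.symm]
        · simp [h1, h2, Ne.symm h1]
    hef := by
      intro p
      rw [hG, E_br]
      simp [αA, ep_apply, sub_smul, sum_sub_distrib]
    ρ := ρ
    hρ := hρ
    hce := by
      intro c; rw [hc]; exact (cas_comm G _ _ (hG _)).symm
    hcf := by
      intro c; rw [hc]; exact (cas_comm G _ _ (hG _)).symm }

abbrev NN (k : ℕ) := Fin k ⊕ Fin k
abbrev MN (k : ℕ) := Matrix (NN k) (NN k) ℚ
def Jm (k : ℕ) : MN k := fromBlocks 0 1 (-1) 0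
def τ (Y : MN k) : MN k := Jm k * Y.transpose * Jm k

theorem Jsq : Jm k * Jm k = -1 := by
  simp [Jm, Matrix.fromBlocks_multiply, ← Matrix.fromBlocks_one, fromBlocks_neg]
theorem τ_mul (Y Z : MN k) : τ (Y * Z) = - (τ Z * τ Y) := by
  have : τ Z * τ Y = Jm k * Z.transpose * (Jm k * Jm k) * Y.transpose * Jm k := by simp only [τ, Matrix.mul_assoc]
  rw [this, Jsq, τ, transpose_mul]; simp [Matrix.mul_assoc]
theorem τ_sub (Y Z : MN k) : τ (Y - Z) = τ Y - τ Z := by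
  simp [τ, Matrix.mul_sub, Matrix.sub_mul]
theorem τ_add (Y Z : MN k) : τ (Y + Z) = τ Y + τ Z := by
  simp [τ, Matrix.mul_add, Matrix.add_mul]
theorem τ_neg (Y : MN k) : τ (-Y) = - τ Y := by
  simp [τ]
theorem τ_smul (c : ℚ) (Y : MN k) : τ (c • Y) = c • τ Y := by
  simp [τ]
theorem τ_br (Y Z : MN k) : τ (Y * Z - Z * Y) = τ Y * τ Z - τ Z * τ Y := by
  rw [τ_sub, τ_mul, τ_mul]; abel
theorem τ_blocks (a b c d : MF k) : τ (fromBlocks a b c d) =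
    fromBlocks (-d.transpose) b.transpose c.transpose (-a.transpose) := by
  simp [τ, Jm, Matrix.fromBlocks_transpose, Matrix.fromBlocks_multiply]

open Sum in
theorem E_ll (i j : Fin k) : E (inl i : NN k) (inl j) = fromBlocks (E i j) 0 0 0 := by
  ext a b; rcases a with a | a <;> rcases b with b | b <;> simp [single_apply]
open Sum in
theorem E_lr (i j : Fin k) : E (inl i : NN k) (inr j) = fromBlocks 0 (E i j) 0 0 := by
  ext a b; rcases a with a | a <;> rcases b with b | b <;> simp [single_apply]
open Sum in
theorem E_rl (i j : Fin k) : E (inr i : NN k) (inl j) = fromBlocks 0 0 (E i j) 0 := by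
  ext a b; rcases a with a | a <;> rcases b with b | b <;> simp [single_apply]
open Sum in
theorem E_rr (i j : Fin k) : E (inr i : NN k) (inr j) = fromBlocks 0 0 0 (E i j) := by
  ext a b; rcases a with a | a <;> rcases b with b | b <;> simp [single_apply]
open Sum in
theorem τ_E (i j : Fin k) : τ (E (inl i : NN k) (inl j)) = - E (inr j) (inr i) ∧ τ (E (inr i : NN k) (inr j)) = - E (inl j) (inl i)
    ∧ τ (E (inl i : NN k) (inr j)) = E (inl j) (inr i) ∧ τ (E (inr i : NN k) (inl j)) = E (inr j) (inl i) := by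
  simp only [E_ll, E_lr, E_rl, E_rr, τ_blocks, fromBlocks_neg]
  simp [E]

def hY (i j : Fin k) : MN k := E (Sum.inl i) (Sum.inl j) - E (Sum.inr j) (Sum.inr i)
def uY (i j : Fin k) : MN k := E (Sum.inl i) (Sum.inr j) + E (Sum.inl j) (Sum.inr i)
def dY (i j : Fin k) : MN k := E (Sum.inr i) (Sum.inl j) + E (Sum.inr j) (Sum.inl i)

theorem τ_h (i j : Fin k) : τ (hY i j) = hY i j := by
  rw [hY, τ_sub, (τ_E i j).1, (τ_E j i).2.1]; abel
theorem τ_u (i j : Fin k) : τ (uY i j) = uY i j := by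
  rw [uY, τ_add, (τ_E i j).2.2.1, (τ_E j i).2.2.1]; abel
theorem τ_d (i j : Fin k) : τ (dY i j) = dY i j := by
  rw [dY, τ_add, (τ_E i j).2.2.2, (τ_E j i).2.2.2]; abel
theorem u_symm (i j : Fin k) : uY i j = uY j i := add_comm _ _
theorem d_symm (i j : Fin k) : dY i j = dY j i := add_comm _ _

theorem hh (l i j : Fin k) : hY l l * hY i j - hY i j * hY l l = ((if l = i then (1:ℚ) else 0) - if l = j then 1 else 0) • hY i j := by
  have e : hY l l * hY i j - hY i j * hY l l = (E (Sum.inl l) (Sum.inl l) * E (Sum.inl i) (Sum.inl j) - E (Sum.inl i) (Sum.inl j) * E (Sum.inl l) (Sum.inl l))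
    + (E (Sum.inr l) (Sum.inr l) * E (Sum.inr j) (Sum.inr i) - E (Sum.inr j) (Sum.inr i) * E (Sum.inr l) (Sum.inr l)) := by
    simp only [hY, sub_mul, mul_sub]; simp; abel
  rw [e, E_br, E_br, hY]
  by_cases h1 : l = i <;> by_cases h2 : l = j <;> simp [h1, h2, eq_comm] <;> (try subst h1) <;> (try subst h2) <;> simp [*, eq_comm] at *
  all_goals (try abel)
theorem hu (l i j : Fin k) : hY l l * uY i j - uY i j * hY l l = ((if l = i then (1:ℚ) else 0) + if l = j then 1 else 0) • uY i j := by
  simp only [hY, uY, sub_mul, mul_sub, mul_add, add_mul]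
  by_cases h1 : l = i <;> by_cases h2 : l = j
  · subst h1; subst h2; simp; ext a b; simp [single_apply]; split_ifs <;> norm_num
  · subst h1; simp [h2]; simp [Ne.symm h2]
  · subst h2; simp [h1, Ne.symm h1]; abel
  · simp [h1, h2, Ne.symm h1, Ne.symm h2]
theorem hd (l i j : Fin k) : hY l l * dY i j - dY i j * hY l l = (-((if l = i then (1:ℚ) else 0) + if l = j then 1 else 0)) • dY i j := by
  simp only [hY, dY, sub_mul, mul_sub, mul_add, add_mul]
  by_cases h1 : l = i <;> by_cases h2 : l = j
  · subst h1; subst h2; simp; ext a b; simp [single_apply]; split_ifs <;> norm_num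
  · subst h1; simp [h2]; simp [Ne.symm h2]; abel
  · subst h2; simp [h1, Ne.symm h1]; abel
  · simp [h1, h2, Ne.symm h1, Ne.symm h2]
theorem hh' (i j : Fin k) (h : i ≠ j) : hY i j * hY j i - hY j i * hY i j = hY i i - hY j j := by
  simp only [hY, sub_mul, mul_sub]; simp [h, h.symm]; abel
theorem ud (i j : Fin k) (h : i ≠ j) : uY i j * dY i j - dY i j * uY i j = hY i i + hY j j := by
  simp only [hY, uY, dY, add_mul, mul_add]; simp [h, h.symm]; abel
theorem ud' (i : Fin k) : uY i i * dY i i - dY i i * uY i i = (4 : ℚ) • hY i i := by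
  simp only [hY, uY, dY, add_mul, mul_add]; simp; module
end

section
variable {k : ℕ} {ι V : Type} [Fintype ι] [DecidableEq ι] [AddCommGroup V] [Module ℚ V]

def eM (p : Fin k × Fin k) : MN k := if p.1 < p.2 then hY p.1 p.2 else uY p.1 p.2
def fM (p : Fin k × Fin k) : MN k := if p.1 < p.2 then hY p.2 p.1 else (if p.1 = p.2 then (1/2:ℚ) else 1) • dY p.1 p.2
theorem τ_eM (p : Fin k × Fin k) : τ (eM p) = eM p := by
  unfold eM; split_ifs <;> simp [τ_h, τ_u]
theorem τ_fM (p : Fin k × Fin k) : τ (fM p) = fM p := by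
  unfold fM; split_ifs <;> simp [τ_h, τ_d, τ_smul]

theorem casY (G : MN k →ₗ[ℚ] End ℚ V) (hτ : ∀ Y, G (τ Y) = G Y) :
    (∑ j, G (hY j j) * G (hY j j) + ∑ a : Fin k × Fin k, (G (eM a) * G (fM a) + G (fM a) * G (eM a)))
    = (2:ℚ) • ∑ a, ∑ b, G (E a b) * G (E b a) := by
  have g1 : ∀ i j : Fin k, G (E (Sum.inl i) (Sum.inl j)) = (1/2:ℚ) • G (hY i j) := by
    intro i j
    have := hτ (E (Sum.inl i) (Sum.inl j))
    rw [(τ_E i j).1, map_neg] at this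
    rw [hY, map_sub, sub_eq_add_neg, this]; module
  have g2 : ∀ i j : Fin k, G (E (Sum.inr i) (Sum.inr j)) = (-1/2:ℚ) • G (hY j i) := by
    intro i j
    have := hτ (E (Sum.inr i) (Sum.inr j))
    rw [(τ_E i j).2.1, map_neg] at this
    have h2 : G (E (Sum.inl j) (Sum.inl i)) = - G (E (Sum.inr i) (Sum.inr j)) := by rw [← this, neg_neg]
    rw [hY, map_sub, h2]; module
  have g3 : ∀ i j : Fin k, G (E (Sum.inl i) (Sum.inr j)) = (1/2:ℚ) • G (uY i j) := by
    intro i j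
    have := hτ (E (Sum.inl i) (Sum.inr j))
    rw [(τ_E i j).2.2.1] at this
    rw [uY, map_add, this]; module
  have g4 : ∀ i j : Fin k, G (E (Sum.inr i) (Sum.inl j)) = (1/2:ℚ) • G (dY i j) := by
    intro i j
    have := hτ (E (Sum.inr i) (Sum.inl j))
    rw [(τ_E i j).2.2.2] at this
    rw [dY, map_add, this]; module
  have key : (2:ℚ) • ∑ a, ∑ b, G (E a b) * G (E b a) = ∑ i : Fin k, ∑ j : Fin k, (G (hY i j) * G (hY j i) + (1/2:ℚ) • (G (uY i j) * G (dY i j) + G (dY i j) * G (uY i j))) := by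
    simp only [Fintype.sum_sum_type, g1, g2, g3, g4, smul_mul_assoc, mul_smul_comm, smul_smul, sum_add_distrib]
    have e1 : ∑ i : Fin k, ∑ j : Fin k, ((-1/2:ℚ)*(-1/2)) • (G (hY j i) * G (hY i j)) = ∑ i : Fin k, ∑ j : Fin k, ((1/2:ℚ)*(1/2)) • (G (hY i j) * G (hY j i)) := by
      rw [sum_comm]; norm_num
    rw [e1]
    simp only [d_symm (_ : Fin k) _, u_symm]
    simp only [← smul_sum]
    simp only [sum_add_distrib]
    module
  rw [key, sum_split, Fintype.sum_prod_type, sum_split, ← add_assoc]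
  congr 1
  · rw [← sum_add_distrib]
    refine sum_congr rfl fun i _ => ?_
    simp [eM, fM]
  · refine sum_congr rfl fun p _ => ?_
    have h := p.2
    simp only [eM, fM, h, h.le.not_gt, h.ne', if_true, if_false]
    rw [d_symm p.1.2 p.1.1, u_symm p.1.2 p.1.1]
    simp only [map_smul, one_smul]
    module

def RY (G : MN k →ₗ[ℚ] End ℚ V) (hτ : ∀ Y, G (τ Y) = G Y)
    (hG : ∀ Z Y, τ Z = Z → G Z * G Y - G Y * G Z = G (Z * Y - Y * Z)) (b : Basis ι ℚ V) (wt : ι → Fin k → ℚ)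
    (hb : ∀ j i, G (hY j j) (b i) = wt i j • b i) (ρ : Fin k → ℚ)
    (hρ : ∀ i, 2 * dt ρ (wt i) = ∑ a, dt (αY a) (wt i)) : RD k (Fin k × Fin k) b :=
  { wt := wt
    α := αY
    H := fun j => G (hY j j)
    e := fun p => G (eM p)
    f := fun p => G (fM p)
    hb := hb
    hHe := by
      intro j p
      rw [hG _ _ (τ_h _ _), ← map_smul]
      congr 1
      unfold eM αY; split_ifs
      · rw [hh]; simp [ep_apply]
      · rw [hu]; simp [ep_apply]
    hHf := by
      intro j p
      rw [hG _ _ (τ_h _ _), ← map_smul, ← map_neg]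
      congr 1
      unfold fM αY; split_ifs
      · rw [hh]; simp only [Pi.sub_apply, ep_apply]; module
      · rw [mul_smul_comm, smul_mul_assoc, ← smul_sub, hd]; simp only [Pi.add_apply, ep_apply]; module
      · rw [mul_smul_comm, smul_mul_assoc, ← smul_sub, hd]; simp only [Pi.add_apply, ep_apply]; module
    hef := by
      intro p
      rw [hG _ _ (τ_eM _)]
      have : ∀ c : Fin k → ℚ, ∑ j, c j • G (hY j j) = G (∑ j, c j • hY j j) := by
        intro c; simp [map_sum]
      rw [this]; congr 1
      unfold eM fM αY; split_ifs with h h2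
      · rw [hh' _ _ h.ne]; simp [ep_apply, sub_smul, sum_sub_distrib]
      · rw [mul_smul_comm, smul_mul_assoc, ← smul_sub, h2, ud']; simp [ep_apply, add_smul, sum_add_distrib]; module
      · rw [one_smul, ud _ _ h2]; simp [ep_apply, add_smul, sum_add_distrib]
    ρ := ρ
    hρ := hρ
    hce := by
      intro c; rw [casY G hτ, smul_mul_assoc, mul_smul_comm, cas_comm G (G (eM c)) (eM c) (fun Y => hG _ _ (τ_eM _))]
    hcf := by
      intro c; rw [casY G hτ, smul_mul_assoc, mul_smul_comm, cas_comm G (G (fM c)) (fM c) (fun Y => hG _ _ (τ_fM _))] }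

theorem sum_αY : ∑ a : Fin 10 × Fin 10, αY a = (2:ℚ) • rhoY .C 10 := by
  funext i
  rw [Finset.sum_apply, Fintype.sum_prod_type]
  simp only [αY, ep, rhoY]
  fin_cases i <;> decide +kernel
theorem sum_αA : ∑ a : IA 6, αA a = (2:ℚ) • rhoA 5 - fun _ => 5 := by
  funext i
  rw [Finset.sum_apply]
  simp only [αA, ep, rhoA]
  fin_cases i <;> decide +kernel
end

section
variable {k : ℕ}

abbrev Bk (k : ℕ) := MvPolynomial ((Fin k × Fin k) ⊕ (Fin k × Fin k)) ℚ
def Pm (k : ℕ) : Matrix (Fin k) (Fin k) (Bk k) := Matrix.of fun i j => MvPolynomial.X (Sum.inl (i, j))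
def Sm (k : ℕ) : Matrix (Fin k) (Fin k) (Bk k) := Matrix.of fun i j => MvPolynomial.X (Sum.inr (i, j)) + MvPolynomial.X (Sum.inr (j, i))
def xm (k : ℕ) : Matrix (NN k) (Fin k) (Bk k) := Matrix.fromRows (Pm k) (Sm k * Pm k)
def cm {a b : Type} (m : Matrix a b ℚ) : Matrix a b (Bk k) := m.map MvPolynomial.C

theorem Sm_symm : (Sm k).transpose = Sm k := by
  ext1 i j; simp [Sm, add_comm]
theorem cm_mul {a b c : Type} [Fintype b] (m : Matrix a b ℚ) (n : Matrix b c ℚ) : (cm (m * n) : Matrix a c (Bk k)) = (cm m : Matrix a b (Bk k)) * (cm n : Matrix b c (Bk k)) := Matrix.map_mul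
theorem cm_sub {a b : Type} (m n : Matrix a b ℚ) : (cm (m - n) : Matrix a b (Bk k)) = cm m - cm n := by
  ext1 i j; simp [cm]
theorem cm_add {a b : Type} (m n : Matrix a b ℚ) : (cm (m + n) : Matrix a b (Bk k)) = cm m + cm n := by
  ext1 i j; simp [cm]
theorem cm_smul {a b : Type} (c : ℚ) (m : Matrix a b ℚ) : (cm (c • m) : Matrix a b (Bk k)) = c • cm m := by
  ext1 i j; simp [cm, smul_eq_C_mul]

def pa (Y : MN k) : MF k := (1/2:ℚ) • (Y.toBlocks₁₁ - Y.toBlocks₂₂.transpose)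
def pb (Y : MN k) : MF k := (1/2:ℚ) • (Y.toBlocks₁₂ + Y.toBlocks₁₂.transpose)
def pc (Y : MN k) : MF k := (1/2:ℚ) • (Y.toBlocks₂₁ + Y.toBlocks₂₁.transpose)
def pr (Y : MN k) : MN k := (1/2:ℚ) • (Y + τ Y)
theorem pr_eq (Y : MN k) : pr Y = fromBlocks (pa Y) (pb Y) (pc Y) (-(pa Y).transpose) := by
  rw [pr]
  conv_lhs => rw [← fromBlocks_toBlocks Y]
  rw [τ_blocks, fromBlocks_add, Matrix.fromBlocks_smul]
  congr 1
  · unfold pa; module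
  · ext i j; simp [pa]; ring
theorem pr_of (Z : MN k) (h : τ Z = Z) : pr Z = Z := by
  rw [pr, h]; module
theorem pr_br (Z Y : MN k) (h : τ Z = Z) : pr (Z * Y - Y * Z) = Z * pr Y - pr Y * Z := by
  rw [pr, τ_br, h, pr]; simp only [mul_smul_comm, smul_mul_assoc, mul_add, add_mul]; module
theorem τ_pr (Y : MN k) : pr (τ Y) = pr Y := by
  have : τ (τ Y) = Y := by
    rw [← fromBlocks_toBlocks Y, τ_blocks, τ_blocks]; simp
  rw [pr, pr, this, add_comm]

def dP (Y : MN k) : Matrix (Fin k) (Fin k) (Bk k) := cm (pa Y).transpose * Pm k + cm (pc Y) * (Sm k * Pm k)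
def dS (Y : MN k) : Matrix (Fin k) (Fin k) (Bk k) :=
  cm (pb Y) - cm (pa Y) * Sm k - Sm k * cm (pa Y).transpose - Sm k * cm (pc Y) * Sm k

theorem toBl_add (Y Z : MN k) : pa (Y + Z) = pa Y + pa Z ∧ pb (Y + Z) = pb Y + pb Z ∧ pc (Y + Z) = pc Y + pc Z := by
  refine ⟨?_, ?_, ?_⟩ <;> ext i j <;> simp [pa, pb, pc, toBlocks₁₁, toBlocks₁₂, toBlocks₂₁, toBlocks₂₂] <;> ring
theorem toBl_smul (c : ℚ) (Y : MN k) : pa (c • Y) = c • pa Y ∧ pb (c • Y) = c • pb Y ∧ pc (c • Y) = c • pc Y := by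
  refine ⟨?_, ?_, ?_⟩ <;> ext i j <;> simp [pa, pb, pc, toBlocks₁₁, toBlocks₁₂, toBlocks₂₁, toBlocks₂₂] <;> ring

def Gf (Y : MN k) : (Fin k × Fin k) ⊕ (Fin k × Fin k) → Bk k :=
  elim (fun p => dP Y p.1 p.2) (fun p => (1/2:ℚ) • dS Y p.1 p.2)

theorem Gf_add (Y Z : MN k) (s) : Gf (Y + Z) s = Gf Y s + Gf Z s := by
  obtain ⟨h1, h2, h3⟩ := toBl_add Y Z
  rcases s with p | p
  · simp only [Gf, elim_inl, dP, h1, h3, cm_add, transpose_add, add_mul, Matrix.add_apply, Pi.add_apply]; abel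
  · simp only [Gf, elim_inr, dS, h1, h2, h3, cm_add, transpose_add, add_mul, mul_add, Matrix.add_apply, Matrix.sub_apply, Pi.add_apply]; module
theorem Gf_smul (c : ℚ) (Y : MN k) (s) : Gf (c • Y) s = c • Gf Y s := by
  obtain ⟨h1, h2, h3⟩ := toBl_smul c Y
  rcases s with p | p
  · simp only [Gf, elim_inl, dP, h1, h3, cm_smul, transpose_smul, smul_mul_assoc, Matrix.add_apply, Matrix.smul_apply, Pi.smul_apply, id_apply, smul_add]
  · simp only [Gf, elim_inr, dS, h1, h2, h3, cm_smul, transpose_smul, smul_mul_assoc, mul_smul_comm, Matrix.smul_apply, Matrix.sub_apply, Pi.smul_apply, id_apply]; module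
def GD : MN k →ₗ[ℚ] Derivation ℚ (Bk k) (Bk k) where
  toFun Y := MvPolynomial.mkDerivation ℚ (Gf Y)
  map_add' Y Z := MvPolynomial.derivation_ext fun s => by
    rw [Derivation.add_apply, mkDerivation_X, mkDerivation_X, mkDerivation_X, Gf_add]
  map_smul' c Y := MvPolynomial.derivation_ext fun s => by
    rw [id_apply, Derivation.smul_apply, mkDerivation_X, mkDerivation_X, Gf_smul]

theorem GD_X (Y : MN k) (s) : GD Y (MvPolynomial.X s) = Gf Y s :=
  mkDerivation_X _ _ _

theorem map_D_mul {a b c : Type} [Fintype b] {R : Type} [CommRing R] [Algebra ℚ R] (D : Derivation ℚ R R) (m : Matrix a b R) (n : Matrix b c R) :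
    (m * n).map D = m.map D * n + m * n.map D := by
  ext1 i j
  simp only [map_apply, Matrix.mul_apply, Matrix.add_apply, map_sum, leibniz, smul_eq_mul, ← sum_add_distrib]
  exact sum_congr rfl fun _ _ => by ring
theorem map_D_cm {a b : Type} (D : Derivation ℚ (Bk k) (Bk k)) (m : Matrix a b ℚ) : (cm m : Matrix a b (Bk k)).map D = 0 := by
  ext1 i j; simp [cm]

theorem dS_symm (Y : MN k) : (dS Y).transpose = dS Y := by
  have hb : (cm (pb Y) : Matrix _ _ (Bk k)).transpose = cm (pb Y) := by
    ext1 i j; simp [cm, pb, add_comm]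
  have hc : (cm (pc Y) : Matrix _ _ (Bk k)).transpose = cm (pc Y) := by
    ext1 i j; simp [cm, pc, add_comm]
  have ha : (cm (pa Y).transpose : Matrix _ _ (Bk k)) = (cm (pa Y)).transpose := rfl
  rw [dS, ha]
  simp only [Matrix.transpose_sub, transpose_mul, hb, hc, Sm_symm, Matrix.transpose_transpose, Matrix.mul_assoc]; abel

theorem GD_P (Y : MN k) : (Pm k).map (GD Y) = dP Y := by
  ext1 i j; simp [Pm, GD_X, Gf]
theorem GD_S (Y : MN k) : (Sm k).map (GD Y) = dS Y := by
  ext1 i j; simp only [Sm, map_apply, of_apply, map_add, GD_X, Gf, elim_inr]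
  have : dS Y j i = dS Y i j := by conv_lhs => rw [← dS_symm, transpose_apply]
  rw [this]; module

theorem GD_x (Y : MN k) : (xm k).map (GD Y) = (cm (pr Y).transpose : Matrix (NN k) (NN k) (Bk k)) * xm k := by
  have h1 : (xm k).map (GD Y) = Matrix.fromRows (dP Y) (dS Y * Pm k + Sm k * dP Y) := by
    rw [← GD_P, ← GD_S, ← map_D_mul]; ext1 i j; rcases i with i | i <;> rfl
  have h2 : (cm (pr Y).transpose : Matrix (NN k) (NN k) (Bk k)) = fromBlocks (cm (pa Y).transpose) (cm (pc Y)) (cm (pb Y)) (-cm (pa Y)) := by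
    rw [pr_eq]
    ext1 i j; rcases i with i | i <;> rcases j with j | j <;> simp [cm, pb, pc, add_comm]
  rw [h1, h2, xm, Matrix.fromBlocks_mul_fromRows]
  congr 1
  rw [dS, dP]; simp only [Matrix.sub_mul, Matrix.mul_add, Matrix.mul_assoc, Matrix.neg_mul]; abel

def Rx (k : ℕ) : Submodule ℚ (Bk k) := Submodule.span ℚ (Set.range fun p : NN k × Fin k => xm k p.1 p.2)
def Rd (k d : ℕ) : Submodule ℚ (Bk k) := Rx k ^ d

theorem x_mem (a : NN k) (j : Fin k) : xm k a j ∈ Rx k := Submodule.subset_span ⟨(a, j), rfl⟩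

theorem GD_Rx (Y : MN k) {r : Bk k} (hr : r ∈ Rx k) : GD Y r ∈ Rx k := by
  refine Submodule.span_induction ?_ ?_ ?_ ?_ hr
  · rintro _ ⟨⟨a, j⟩, rfl⟩
    have := congrFun (congrFun (GD_x Y) a) j
    rw [map_apply, Matrix.mul_apply] at this
    simp only [this]
    refine Submodule.sum_mem _ fun b _ => ?_
    simp only [cm, map_apply, ← smul_eq_C_mul]
    exact smul_mem _ _ (x_mem _ _)
  · simp
  · intro x y _ _ h1 h2; rw [map_add]; exact add_mem _ h1 h2
  · intro c x _ h; rw [Derivation.map_smul]; exact smul_mem _ _ h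

theorem GD_Rd (Y : MN k) {d : ℕ} {r : Bk k} (hr : r ∈ Rd k d) : GD Y r ∈ Rd k d := by
  induction d generalizing r with
  | zero =>
    rw [Rd, pow_zero, mem_one] at hr
    obtain ⟨c, rfl⟩ := hr
    rw [map_algebraMap]; exact Submodule.zero_mem _
  | succ d ih =>
    rw [Rd, pow_succ] at hr ⊢
    refine Submodule.mul_induction_on hr ?_ ?_
    · intro m hm n hn
      rw [leibniz, smul_eq_mul, smul_eq_mul]
      exact add_mem _ (mul_mem_mul hm (GD_Rx Y hn)) (by rw [mul_comm n]; exact mul_mem_mul (ih hm) hn)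
    · intro x y h1 h2; rw [map_add]; exact add_mem _ h1 h2

theorem Rd_adjoin {d : ℕ} {r : Bk k} (hr : r ∈ Rd k d) : r ∈ adjoin ℚ (Set.range fun p : NN k × Fin k => xm k p.1 p.2) := by
  have h1 : Rx k ≤ Subalgebra.toSubmodule (adjoin ℚ (Set.range fun p : NN k × Fin k => xm k p.1 p.2)) :=
    Submodule.span_le.2 Algebra.subset_adjoin
  induction d generalizing r with
  | zero =>
    rw [Rd, pow_zero, mem_one] at hr
    obtain ⟨c, rfl⟩ := hr
    exact Subalgebra.algebraMap_mem _ _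
  | succ d ih =>
    rw [Rd, pow_succ] at hr
    refine Submodule.mul_induction_on hr ?_ ?_
    · intro m hm n hn; exact Subalgebra.mul_mem _ (ih hm) (h1 hn)
    · intro x y h1 h2; exact Subalgebra.add_mem _ h1 h2

theorem GD_ext (D1 D2 : Derivation ℚ (Bk k) (Bk k)) (h : (xm k).map D1 = (xm k).map D2) {d : ℕ} {r : Bk k} (hr : r ∈ Rd k d) : D1 r = D2 r := by
  refine Derivation.eqOn_adjoin ?_ (Rd_adjoin hr)
  rintro _ ⟨⟨a, j⟩, rfl⟩
  exact congrFun (congrFun h a) j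

theorem GD_br (Z Y : MN k) (h : τ Z = Z) {d : ℕ} {r : Bk k} (hr : r ∈ Rd k d) :
    GD Z (GD Y r) - GD Y (GD Z r) = GD (Z * Y - Y * Z) r := by
  have := GD_ext ⁅GD Z, GD Y⁆ (GD (Z * Y - Y * Z)) ?_ hr
  · rw [← this, Derivation.commutator_apply]
  · have e : (xm k).map (⁅GD Z, GD Y⁆ : Derivation ℚ (Bk k) (Bk k)) = ((xm k).map (GD Y)).map (GD Z) - ((xm k).map (GD Z)).map (GD Y) := by
      ext1 i j; simp [Derivation.commutator_apply]
    rw [e, GD_x, GD_x, GD_x, map_D_mul, map_D_mul, map_D_cm, map_D_cm, GD_x, GD_x, pr_br _ _ h, pr_of Z h]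
    simp only [Matrix.transpose_sub, transpose_mul, cm_sub, cm_mul, Matrix.sub_mul, Matrix.zero_mul, zero_add, Matrix.mul_assoc]

theorem GD_τ (Y : MN k) {d : ℕ} {r : Bk k} (hr : r ∈ Rd k d) : GD (τ Y) r = GD Y r := by
  refine GD_ext _ _ ?_ hr
  rw [GD_x, GD_x, τ_pr]
end

section
variable {k : ℕ}

theorem D_prod {R ι : Type} [CommRing R] [Algebra ℚ R] [DecidableEq ι] (D : Derivation ℚ R R) (s : Finset ι) (f : ι → R) :
    D (∏ i ∈ s, f i) = ∑ i ∈ s, D (f i) * ∏ j ∈ s.erase i, f j := by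
  induction s using induction_on with
  | empty => simp
  | insert a s ha ih =>
    rw [prod_insert ha, leibniz, ih, sum_insert ha, Finset.erase_insert ha, smul_eq_mul, smul_eq_mul, mul_sum, add_comm, mul_comm]
    congr 1
    refine sum_congr rfl fun i hi => ?_
    have : a ≠ i := fun h => ha (h ▸ hi)
    rw [Finset.erase_insert_of_ne this, prod_insert (by simp [ha])]; ring

theorem det_D {R m : Type} [CommRing R] [Algebra ℚ R] [Fintype m] [DecidableEq m] (D : Derivation ℚ R R) (A N : Matrix m m R)
    (h : A.map D = N * A) : D A.det = N.trace * A.det := by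
  have h1 : D A.det = ∑ i, (A.updateRow i (fun j => D (A i j))).det := by
    rw [← det_transpose, det_apply, map_sum]
    simp only [transpose_apply]
    have : ∀ i, (A.updateRow i (fun j => D (A i j))).det = ∑ σ : Perm m, Perm.sign σ • (D (A i (σ i)) * ∏ j ∈ univ.erase i, A j (σ j)) := by
      intro i
      rw [← det_transpose, det_apply]
      refine sum_congr rfl fun σ _ => ?_
      congr 1
      simp only [transpose_apply]
      rw [← mul_prod_erase _ _ (mem_univ i)]
      congr 1
      · simp
      · refine prod_congr rfl fun j hj => ?_
        rw [Matrix.updateRow_ne (ne_of_mem_erase hj)]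
    simp only [this]
    rw [sum_comm]
    refine sum_congr rfl fun σ _ => ?_
    rw [← smul_sum, ← D_prod]
    rcases Int.units_eq_one_or (Perm.sign σ) with h | h <;> simp [h]
  rw [h1, trace, sum_mul]
  refine sum_congr rfl fun i _ => ?_
  have e : (fun j => D (A i j)) = ∑ l, N i l • A l := by
    funext j
    have := congrFun (congrFun h i) j
    rw [map_apply, Matrix.mul_apply] at this
    rw [this]; simp
  rw [e, Matrix.det_updateRow_sum]; rfl

def lead {R : Type} (l : Fin k) (A : Matrix (Fin k) (Fin k) R) : Matrix {i : Fin k // i ≤ l} {i : Fin k // i ≤ l} R :=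
  A.submatrix Subtype.val Subtype.val

theorem lead_mul {R : Type} [CommRing R] (l : Fin k) (A B : Matrix (Fin k) (Fin k) R)
    (h : ∀ i j m, i ≤ l → j ≤ l → l < m → A i m * B m j = 0) : lead l (A * B) = lead l A * lead l B := by
  ext1 i j
  simp only [lead, submatrix_apply, Matrix.mul_apply]
  rw [← sum_subset (Finset.subset_univ (univ.filter (· ≤ l)))]
  · exact Finset.sum_subtype _ (by simp) _
  · intro m _ hm; exact h _ _ _ i.2 j.2 (not_le.1 (by simpa using hm))

def UT (Q : MF k) : Prop := ∀ i j, j < i → Q i j = 0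
def psi (Q : MF k) : Bk k →ₐ[ℚ] Bk k :=
  MvPolynomial.aeval (elim (fun p => (Pm k * (cm Q : Matrix (Fin k) (Fin k) (Bk k))) p.1 p.2) (fun p => MvPolynomial.X (Sum.inr p)))

theorem psi_l (Q : MF k) (p) : psi Q (MvPolynomial.X (Sum.inl p)) = (Pm k * (cm Q : Matrix (Fin k) (Fin k) (Bk k))) p.1 p.2 := by
  rw [psi, MvPolynomial.aeval_X, elim_inl]
theorem psi_r (Q : MF k) (p) : psi Q (MvPolynomial.X (Sum.inr p)) = MvPolynomial.X (Sum.inr p) := by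
  rw [psi, MvPolynomial.aeval_X, elim_inr]
theorem psi_P (Q : MF k) : (Pm k).map (psi Q) = Pm k * (cm Q : Matrix (Fin k) (Fin k) (Bk k)) := by
  ext1 i j; rw [map_apply]
  exact psi_l Q (i, j)
theorem psi_S (Q : MF k) : (Sm k).map (psi Q) = Sm k := by
  ext1 i j; rw [map_apply, Sm, of_apply, map_add, psi_r, psi_r]
theorem psi_cm (Q : MF k) {a b : Type} (m : Matrix a b ℚ) : (cm m : Matrix a b (Bk k)).map (psi Q) = cm m := by
  ext1 i j; exact (psi Q).commutes _

theorem psi_GD (Q : MF k) (Y) (r : Bk k) : psi Q (GD Y r) = GD Y (psi Q r) := by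
  have hP : (dP Y).map (psi Q) = (Pm k * (cm Q : Matrix (Fin k) (Fin k) (Bk k))).map (GD Y) := by
    rw [map_D_mul, map_D_cm, GD_P, Matrix.mul_zero, add_zero, dP]
    rw [Matrix.map_add _ (fun _ _ => map_add _ _ _), Matrix.map_mul, Matrix.map_mul, Matrix.map_mul, psi_P, psi_S, psi_cm, psi_cm]
    simp only [Matrix.add_mul, Matrix.mul_assoc]
  have hS : (dS Y).map (psi Q) = dS Y := by
    rw [dS]
    simp only [Matrix.map_sub _ (fun _ _ => map_sub _ _ _), Matrix.map_mul, psi_S, psi_cm]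
  induction r using MvPolynomial.induction_on with
  | C a =>
    have e : (MvPolynomial.C a : Bk k) = algebraMap ℚ _ a := rfl
    rw [e, AlgHom.commutes, map_algebraMap, map_zero]
  | add p q hp hq => rw [map_add, map_add, map_add, map_add, hp, hq]
  | mul_X p s hp =>
    have hX : psi Q (GD Y (MvPolynomial.X s)) = GD Y (psi Q (MvPolynomial.X s)) := by
      rcases s with p | p
      · have := congrFun (congrFun hP p.1) p.2
        rw [GD_X]
        rw [psi_l]; exact this
      · have := congrFun (congrFun hS p.1) p.2
        rw [psi_r, GD_X]
        simp only [Gf, elim_inr, map_smul]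
        rw [map_apply] at this
        rw [this]
    rw [leibniz, map_add, smul_eq_mul, smul_eq_mul, map_mul, map_mul, map_mul, hX, hp, leibniz, smul_eq_mul, smul_eq_mul]

def chi (lam : Fin k → ℕ) (Q : MF k) : ℚ := ∏ l, (lead l Q).det ^ lam l
def degY (lam : Fin k → ℕ) : ℕ := ∑ l : Fin k, lam l * (l.val + 1)
theorem chi_add (lam mu : Fin k → ℕ) (Q) : chi (lam + mu) Q = chi lam Q * chi mu Q := by
  simp [chi, pow_add, prod_mul_distrib]
theorem degY_add (lam mu : Fin k → ℕ) : degY (lam + mu) = degY lam + degY mu := by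
  simp [degY, add_mul, sum_add_distrib]

def Mo (lam : Fin k → ℕ) : Submodule ℚ (Bk k) where
  carrier := {r | r ∈ Rd k (degY lam) ∧ ∀ Q, UT Q → psi Q r = chi lam Q • r}
  zero_mem' := ⟨Submodule.zero_mem _, by simp⟩
  add_mem' := by
    rintro x y ⟨h1, h2⟩ ⟨h3, h4⟩
    exact ⟨add_mem _ h1 h3, fun Q hQ => by rw [map_add, h2 Q hQ, h4 Q hQ, smul_add]⟩
  smul_mem' := by
    rintro c x ⟨h1, h2⟩
    exact ⟨smul_mem _ _ h1, fun Q hQ => by rw [map_smul, h2 Q hQ, smul_comm]⟩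

theorem Mo_GD (lam : Fin k → ℕ) (Y) {r : Bk k} (hr : r ∈ Mo lam) : GD Y r ∈ Mo lam :=
  ⟨GD_Rd Y hr.1, fun Q hQ => by rw [psi_GD, hr.2 Q hQ, Derivation.map_smul]⟩
theorem Mo_mul {lam mu : Fin k → ℕ} {r s : Bk k} (hr : r ∈ Mo lam) (hs : s ∈ Mo mu) : r * s ∈ Mo (lam + mu) :=
  ⟨by rw [degY_add, Rd, pow_add]; exact mul_mem_mul hr.1 hs.1,
   fun Q hQ => by rw [map_mul, hr.2 Q hQ, hs.2 Q hQ, chi_add, smul_mul_smul_comm]⟩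
theorem Mo_one : (1 : Bk k) ∈ Mo (0 : Fin k → ℕ) := by
  refine ⟨?_, fun Q hQ => by simp [chi]⟩
  simp only [degY, Rd, Pi.zero_apply, zero_mul, sum_const_zero, pow_zero]
  exact mem_one.2 ⟨1, map_one _⟩

def vk (l : Fin k) : Bk k := (lead l (Pm k)).det
theorem vk_mem (l : Fin k) : vk l ∈ Mo (Pi.single l 1) := by
  constructor
  · have hd : degY (Pi.single l 1 : Fin k → ℕ) = l.val + 1 := by
      simp [degY, Pi.single_apply]
    rw [hd, vk, det_apply]
    refine Submodule.sum_mem _ fun σ _ => ?_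
    have hm : ∏ i, lead l (Pm k) (σ i) i ∈ Rd k (l.val + 1) := by
      have hc : l.val + 1 = (univ : Finset {i : Fin k // i ≤ l}).card := by
        rw [Finset.card_univ, Fintype.card_subtype]
        have : (univ.filter (· ≤ l)) = Finset.Iic l := by ext; simp
        rw [this, Fin.card_Iic]
      rw [hc, Rd]
      have gen : ∀ s : Finset {i : Fin k // i ≤ l}, ∏ i ∈ s, lead l (Pm k) (σ i) i ∈ Rx k ^ s.card := by
        intro s
        induction s using induction_on with
        | empty => rw [prod_empty, Finset.card_empty, pow_zero]; exact mem_one.2 ⟨1, map_one _⟩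
        | insert a s ha ih =>
          rw [prod_insert ha, Finset.card_insert_of_notMem ha, pow_succ']
          exact mul_mem_mul (x_mem (Sum.inl (σ a).1) a.1) ih
      exact gen _
    rcases Int.units_eq_one_or (Perm.sign σ) with h | h
    · rw [h, one_smul]; exact hm
    · rw [h, Units.neg_smul, one_smul]; exact Submodule.neg_mem _ hm
  · intro Q hQ
    have hc : chi (Pi.single l 1) Q = (lead l Q).det := by
      rw [chi, Finset.prod_eq_single l] <;> simp +contextual [Pi.single_apply]
    have e : (lead l (Pm k)).map (psi Q) = lead l (Pm k) * (cm (lead l Q) : Matrix _ _ (Bk k)) := by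
      have : (lead l (Pm k)).map (psi Q) = lead l ((Pm k).map (psi Q)) := rfl
      rw [this, psi_P, lead_mul]
      · rfl
      · intro i j m h1 h2 h3
        simp [cm, hQ m j (lt_of_le_of_lt h2 h3)]
    have e2 : (cm (lead l Q) : Matrix _ _ (Bk k)).det = MvPolynomial.C (lead l Q).det := by
      rw [map_det]; rfl
    rw [vk, AlgHom.map_det, hc]
    show ((lead l (Pm k)).map (psi Q)).det = _
    rw [e, Matrix.det_mul, e2, smul_eq_C_mul, mul_comm]

def vl (lam : Fin k → ℕ) : Bk k := ∏ l, vk l ^ lam l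
theorem vl_mem (lam : Fin k → ℕ) : vl lam ∈ Mo lam := by
  have h1 : ∀ l (c : ℕ), vk l ^ c ∈ Mo (Pi.single l c : Fin k → ℕ) := by
    intro l c
    induction c with
    | zero => simpa using Mo_one
    | succ c ih => rw [pow_succ, Pi.single_add]; exact Mo_mul ih (vk_mem l)
  have h2 : ∀ s : Finset (Fin k), ∏ l ∈ s, vk l ^ lam l ∈ Mo (∑ l ∈ s, Pi.single l (lam l)) := by
    intro s
    induction s using induction_on with
    | empty => simpa using Mo_one
    | insert a s ha ih => rw [prod_insert ha, sum_insert ha]; exact Mo_mul (h1 a _) ih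
  have := h2 univ
  rwa [Finset.univ_sum_single] at this

theorem hY_bl (i j : Fin k) : hY i j = fromBlocks (E i j) 0 0 (-E j i) := by
  rw [hY, E_ll, E_rr, sub_eq_add_neg, fromBlocks_neg, fromBlocks_add]; simp
theorem uY_bl (i j : Fin k) : uY i j = fromBlocks 0 (E i j + E j i) 0 0 := by
  rw [uY, E_lr, E_lr, fromBlocks_add]; simp
theorem p_h (i j : Fin k) : pa (hY i j) = E i j ∧ pb (hY i j) = 0 ∧ pc (hY i j) = 0 := by
  have := pr_of _ (τ_h i j)
  rw [pr_eq, hY_bl, Matrix.fromBlocks_inj] at this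
  rw [hY_bl]; exact ⟨this.1, this.2.1, this.2.2.1⟩
theorem p_u (i j : Fin k) : pa (uY i j) = 0 ∧ pb (uY i j) = E i j + E j i ∧ pc (uY i j) = 0 := by
  have := pr_of _ (τ_u i j)
  rw [pr_eq, uY_bl, Matrix.fromBlocks_inj] at this
  rw [uY_bl]; exact ⟨this.1, this.2.1, this.2.2.1⟩

theorem GD_h_vk (i j l : Fin k) (hij : i ≤ j) : GD (hY i j) (vk l) = (if i = j ∧ i ≤ l then 1 else 0 : ℚ) • vk l := by
  have h0 : (cm (0 : MF k) : Matrix _ _ (Bk k)) = 0 := by ext1; simp [cm]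
  have e : (lead l (Pm k)).map (GD (hY i j)) = lead l (cm (E j i) : Matrix _ _ (Bk k)) * lead l (Pm k) := by
    have : (lead l (Pm k)).map (GD (hY i j)) = lead l ((Pm k).map (GD (hY i j))) := rfl
    rw [this, GD_P, dP, (p_h i j).1, (p_h i j).2.2, h0, Matrix.zero_mul, add_zero, ← lead_mul]
    · simp [E]
    · intro a b m h1 h2 h3
      have : ¬ (j = a ∧ i = m) := by
        rintro ⟨rfl, rfl⟩; exact absurd (lt_of_lt_of_le h3 (hij.trans h1)) (lt_irrefl _)
      simp [cm, single_apply, this]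
  rw [vk, det_D _ _ _ e, smul_eq_C_mul]
  congr 1
  simp only [trace, Matrix.diag, lead, submatrix_apply, cm, map_apply, E, single_apply]
  rw [← map_sum]
  congr 1
  by_cases h : i = j
  · subst h
    by_cases h2 : i ≤ l
    · rw [sum_eq_single ⟨i, h2⟩]
      · simp [h2]
      · intro b _ hb
        have : ¬ i = b.1 := fun h => hb (Subtype.ext h.symm)
        simp [this]
      · simp
    · rw [sum_eq_zero]
      · simp [h2]
      · intro b _
        have : ¬ i = b.1 := fun h => h2 (h ▸ b.2)
        simp [this]
  · rw [sum_eq_zero]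
    · simp [h]
    · intro b _
      have : ¬ (j = b.1 ∧ i = b.1) := fun h' => h (h'.2.trans h'.1.symm)
      simp [this]

theorem GD_u_P (i j : Fin k) : (Pm k).map (GD (uY i j)) = 0 := by
  have h0 : (cm (0 : MF k) : Matrix _ _ (Bk k)) = 0 := by ext1; simp [cm]
  rw [GD_P, dP, (p_u i j).1, (p_u i j).2.2, Matrix.transpose_zero, h0, Matrix.zero_mul, Matrix.zero_mul, add_zero]
theorem GD_u_vk (i j l : Fin k) : GD (uY i j) (vk l) = 0 := by
  have e : (lead l (Pm k)).map (GD (uY i j)) = 0 * lead l (Pm k) := by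
    have : (lead l (Pm k)).map (GD (uY i j)) = lead l ((Pm k).map (GD (uY i j))) := rfl
    rw [this, GD_u_P, Matrix.zero_mul]; rfl
  rw [vk, det_D _ _ _ e]; simp
theorem GD_e_vk (a : Fin k × Fin k) (l : Fin k) : GD (eM a) (vk l) = 0 := by
  unfold eM; split_ifs with h
  · rw [GD_h_vk _ _ _ h.le, if_neg (fun h' => h.ne h'.1), zero_smul]
  · exact GD_u_vk _ _ _
end

section
variable {k : ℕ}
open Polynomial in
def pth (N S0 : Fin k × Fin k → ℚ) : Bk k →ₐ[ℚ] Polynomial ℚ :=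
  MvPolynomial.aeval (elim (fun p => C (if p.1 = p.2 then 1 else 0) + X * C (N p)) (fun p => X * C (S0 p)))

theorem cmφ {R a b : Type} [CommRing R] [Algebra ℚ R] (φ : Bk k →ₐ[ℚ] R) (m : Matrix a b ℚ) : (cm m : Matrix a b (Bk k)).map φ = m.map (algebraMap ℚ R) := by
  ext1 i j; exact φ.commutes _

theorem sum_E {R : Type} [CommRing R] [Algebra ℚ R] (A : Matrix (Fin k) (Fin k) R) : ∑ i, ∑ j, A i j • (E i j).map (algebraMap ℚ R) = A := by
  conv_rhs => rw [Matrix.matrix_eq_sum_single A]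
  refine sum_congr rfl fun i _ => sum_congr rfl fun j _ => ?_
  ext1 a b
  simp [single_apply]

theorem lz {R : Type} [CommRing R] [Algebra ℚ R] (φ : Bk k →ₐ[ℚ] R) (D : Fin k → Fin k → Derivation ℚ (Bk k) (Bk k)) (c : Fin k → Fin k → R) (p q : Bk k) :
    ∑ i, ∑ j, c i j * φ (D i j (p * q)) = φ p * ∑ i, ∑ j, c i j * φ (D i j q) + φ q * ∑ i, ∑ j, c i j * φ (D i j p) := by
  simp only [mul_sum, ← sum_add_distrib]
  refine sum_congr rfl fun i _ => sum_congr rfl fun j _ => ?_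
  rw [leibniz, map_add, smul_eq_mul, smul_eq_mul, map_mul, map_mul]; ring

section
variable (N S0 : Fin k × Fin k → ℚ) 
open Polynomial

set_option maxHeartbeats 1000000 in
theorem const_path (hN : ∀ p : Fin k × Fin k, p.1 ≤ p.2 → N p = 0) (hS : ∀ i j, S0 (i, j) = S0 (j, i)) (r : Bk k)
    (hr : ∀ a, GD (eM a) r = 0) : derivative (pth N S0 r) = 0 := by
  set φ := pth N S0 with hφ
  let L : Matrix (Fin k) (Fin k) ℚ[X] := (Pm k).map φ
  let T : Matrix (Fin k) (Fin k) ℚ[X] := (Sm k).map φ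
  have φl : ∀ p, φ (MvPolynomial.X (Sum.inl p)) = C (if p.1 = p.2 then 1 else 0) + X * C (N p) := by
    intro p; rw [hφ, pth, MvPolynomial.aeval_X, elim_inl]
  have φr : ∀ p, φ (MvPolynomial.X (Sum.inr p)) = X * C (S0 p) := by
    intro p; rw [hφ, pth, MvPolynomial.aeval_X, elim_inr]
  have hL : ∀ i j, L i j = C (if i = j then 1 else 0) + X * C (N (i, j)) := fun i j => φl (i, j)
  have hLt : L.BlockTriangular OrderDual.toDual := by
    intro i j h
    have h' : i < j := h
    rw [hL, hN _ h'.le, if_neg h'.ne]; simp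
  have hdet : L.det = 1 := by
    rw [Matrix.det_of_lowerTriangular _ hLt]
    refine Finset.prod_eq_one fun i _ => ?_
    rw [hL, hN _ le_rfl]; simp
  haveI : Invertible L := Matrix.invertibleOfIsUnitDet L (by rw [hdet]; exact isUnit_one)
  have hLi : (L⁻¹).BlockTriangular OrderDual.toDual := Matrix.blockTriangular_inv_of_blockTriangular hLt
  let N' : Matrix (Fin k) (Fin k) ℚ[X] := Matrix.of fun i j => C (N (i, j))
  let A := N' * L⁻¹
  have hAL : A * L = N' := by
    show N' * L⁻¹ * L = N'
    rw [Matrix.mul_assoc, Matrix.inv_mul_of_invertible, Matrix.mul_one]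
  have hA : ∀ i j, i ≤ j → A i j = 0 := by
    intro i j h
    show (N' * L⁻¹) i j = 0
    rw [Matrix.mul_apply]
    refine sum_eq_zero fun l _ => ?_
    by_cases h1 : i ≤ l
    · simp [N', hN (i, l) h1]
    · have : L⁻¹ l j = 0 := hLi (show l < j from lt_of_lt_of_le (not_le.1 h1) h)
      rw [this, mul_zero]
  let S' : Matrix (Fin k) (Fin k) ℚ[X] := Matrix.of fun i j => C (S0 (i, j))
  have hS' : S'.transpose = S' := by ext1 i j; simp [S', hS i j]
  have hT : T.transpose = T := by
    show ((Sm k).transpose).map φ = _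
    rw [Sm_symm]
  let b := (2:ℚ) • S' + A.transpose * T + T * A
  have hb : b.transpose = b := by
    show ((2:ℚ) • S' + A.transpose * T + T * A).transpose = _
    simp only [transpose_add, transpose_mul, Matrix.transpose_transpose, hT, transpose_smul, hS']
    show _ = (2:ℚ) • S' + A.transpose * T + T * A
    abel
  have h0 : (0 : MF k).map (algebraMap ℚ ℚ[X]) = 0 := by ext1; simp
  have iP : ∀ Y, pc Y = 0 → (dP Y).map φ = (pa Y).transpose.map (algebraMap ℚ ℚ[X]) * L := by
    intro Y h
    rw [dP, h, Matrix.map_add _ (fun _ _ => map_add _ _ _), Matrix.map_mul, Matrix.map_mul, cmφ, cmφ, h0, Matrix.zero_mul, add_zero]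
  have iS : ∀ Y, pc Y = 0 → (dS Y).map φ = (pb Y).map (algebraMap ℚ ℚ[X]) - (pa Y).map (algebraMap ℚ ℚ[X]) * T - T * (pa Y).transpose.map (algebraMap ℚ ℚ[X]) := by
    intro Y h
    rw [dS, h]
    simp only [Matrix.map_sub _ (fun _ _ => map_sub _ _ _), Matrix.map_mul, cmφ, h0, Matrix.zero_mul, Matrix.mul_zero, sub_zero]
    rfl
  have key : ∀ r : Bk k, derivative (φ r) = ∑ i, ∑ j, A i j * φ (GD (hY j i) r) + ∑ i, ∑ j, ((1/2:ℚ) • b i j) * φ (GD (uY i j) r) := by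
    intro r
    induction r using MvPolynomial.induction_on with
    | C a =>
      have e : (MvPolynomial.C a : Bk k) = algebraMap ℚ _ a := rfl
      have e2 : algebraMap ℚ ℚ[X] a = C a := rfl
      simp only [e, AlgHom.commutes, map_algebraMap, map_zero, mul_zero, sum_const_zero, e2, derivative_C, add_zero]
    | add p q hp hq =>
      simp only [map_add, hp, hq, mul_add, sum_add_distrib]; abel
    | mul_X p s hp =>
      have hX : derivative (φ (MvPolynomial.X s)) = ∑ i, ∑ j, A i j * φ (GD (hY j i) (MvPolynomial.X s)) + ∑ i, ∑ j, ((1/2:ℚ) • b i j) * φ (GD (uY i j) (MvPolynomial.X s)) := by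
        rcases s with ⟨p, q⟩ | ⟨p, q⟩
        · have e1 : ∀ i j, φ (GD (hY j i) (MvPolynomial.X (Sum.inl (p, q)))) = ((E i j).map (algebraMap ℚ ℚ[X]) * L) p q := by
            intro i j
            rw [GD_X]
            have := congrFun (congrFun (iP (hY j i) (p_h j i).2.2) p) q
            rw [(p_h j i).1] at this
            rw [show (E j i : MF k).transpose = E i j from by simp [E]] at this
            exact this
          have e2 : ∀ i j, φ (GD (uY i j) (MvPolynomial.X (Sum.inl (p, q)))) = 0 := by
            intro i j
            have := congrFun (congrFun (GD_u_P i j) p) q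
            have h : GD (uY i j) (MvPolynomial.X (Sum.inl (p, q))) = 0 := this
            rw [h, map_zero]
          simp only [e1, e2, mul_zero, sum_const_zero, add_zero]
          have e3 : ∑ i, ∑ j, A i j * ((E i j).map (algebraMap ℚ ℚ[X]) * L) p q = (A * L) p q := by
            conv_rhs => rw [← sum_E A]
            simp only [sum_mul, Matrix.sum_apply, smul_mul, Matrix.smul_apply, smul_eq_mul]
          rw [e3, hAL, φl]
          simp only [derivative_add, derivative_C, derivative_mul, derivative_X, one_mul, mul_zero, zero_add, add_zero]; rfl
        · have e1 : ∀ i j, φ (GD (hY j i) (MvPolynomial.X (Sum.inr (p, q)))) = (1/2:ℚ) • (- ((E j i).map (algebraMap ℚ ℚ[X]) * T) p q - (T * (E i j).map (algebraMap ℚ ℚ[X])) p q) := by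
            intro i j
            rw [GD_X]
            have := congrFun (congrFun (iS (hY j i) (p_h j i).2.2) p) q
            rw [(p_h j i).1, (p_h j i).2.1, h0] at this
            rw [show (E j i : MF k).transpose = E i j from by simp [E], zero_sub] at this
            simp only [Gf, elim_inr, map_smul]
            rw [map_apply] at this
            rw [this]; rfl
          have e2 : ∀ i j, φ (GD (uY i j) (MvPolynomial.X (Sum.inr (p, q)))) = (1/2:ℚ) • ((E i j).map (algebraMap ℚ ℚ[X]) p q + (E j i).map (algebraMap ℚ ℚ[X]) p q) := by
            intro i j
            rw [GD_X]
            have := congrFun (congrFun (iS (uY i j) (p_u i j).2.2) p) q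
            rw [(p_u i j).1, (p_u i j).2.1, Matrix.transpose_zero, h0, Matrix.zero_mul, Matrix.mul_zero, sub_zero, sub_zero, Matrix.map_add _ (fun _ _ => map_add _ _ _)] at this
            simp only [Gf, elim_inr, map_smul]
            rw [map_apply] at this
            rw [this]; rfl
          simp only [e1, e2]
          have c1 : ∑ i, ∑ j, A i j * ((E j i).map (algebraMap ℚ ℚ[X]) * T) p q = (A.transpose * T) p q := by
            conv_rhs => rw [← sum_E A.transpose]
            rw [sum_comm]
            simp only [sum_mul, Matrix.sum_apply, smul_mul, Matrix.smul_apply, smul_eq_mul, transpose_apply]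
          have c2 : ∑ i, ∑ j, A i j * (T * (E i j).map (algebraMap ℚ ℚ[X])) p q = (T * A) p q := by
            conv_rhs => rw [← sum_E A]
            simp only [mul_sum, Matrix.sum_apply, Matrix.mul_smul, Matrix.smul_apply, smul_eq_mul]
          have c3 : ∑ i, ∑ j, b i j * (E i j).map (algebraMap ℚ ℚ[X]) p q = b p q := by
            conv_rhs => rw [← sum_E b]
            simp only [Matrix.sum_apply, Matrix.smul_apply, smul_eq_mul]
          have c4 : ∑ i, ∑ j, b i j * (E j i).map (algebraMap ℚ ℚ[X]) p q = b p q := by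
            conv_rhs => rw [← hb, ← sum_E b.transpose]
            rw [sum_comm]
            simp only [Matrix.sum_apply, Matrix.smul_apply, smul_eq_mul, transpose_apply]
          have d1 : ∑ i, ∑ j, A i j * ((1/2:ℚ) • (- ((E j i).map (algebraMap ℚ ℚ[X]) * T) p q - (T * (E i j).map (algebraMap ℚ ℚ[X])) p q))
            = (1/2:ℚ) • (-(A.transpose * T) p q - (T * A) p q) := by
            rw [← c1, ← c2]
            simp only [mul_smul_comm, mul_sub, mul_neg, smul_sum, smul_sub, smul_neg, sum_sub_distrib, Finset.sum_neg_distrib]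
          have d2 : ∑ i, ∑ j, ((1/2:ℚ) • b i j) * ((1/2:ℚ) • ((E i j).map (algebraMap ℚ ℚ[X]) p q + (E j i).map (algebraMap ℚ ℚ[X]) p q))
            = (1/2:ℚ) • b p q := by
            have : (1/2:ℚ) • b p q = (1/4:ℚ) • (b p q + b p q) := by module
            rw [this]
            nth_rewrite 1 [← c3]
            rw [← c4]
            simp only [← sum_add_distrib, smul_sum, smul_mul_smul_comm, ← mul_add]; norm_num
          rw [d1, d2]
          have : b p q = (2:ℚ) • S' p q + (A.transpose * T) p q + (T * A) p q := rfl
          rw [this, φr]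
          have : derivative (X * C (S0 (p, q))) = S' p q := by simp [S']
          rw [this]; module
      have l1 := lz φ (fun i j => GD (hY j i)) (fun i j => A i j) p (MvPolynomial.X s)
      have l2 := lz φ (fun i j => GD (uY i j)) (fun i j => (1/2:ℚ) • b i j) p (MvPolynomial.X s)
      refine Eq.trans ?_ (congrArg₂ (· + ·) l1 l2).symm
      rw [map_mul, derivative_mul, hp, hX]
      ring
  rw [key r]
  have z1 : ∀ i j, A i j * φ (GD (hY j i) r) = 0 := by
    intro i j
    by_cases h : i ≤ j
    · rw [hA i j h, zero_mul]
    · have := hr (j, i)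
      rw [eM, if_pos (not_le.1 h)] at this
      rw [this, map_zero, mul_zero]
  have z2 : ∀ i j, φ (GD (uY i j) r) = 0 := by
    intro i j
    by_cases h : i < j
    · have := hr (j, i)
      rw [eM, if_neg (not_lt.2 h.le)] at this
      rw [u_symm, this, map_zero]
    · have := hr (i, j)
      rw [eM, if_neg h] at this
      rw [this, map_zero]
  simp only [z1, z2, mul_zero, sum_const_zero, add_zero]
end
end

section
variable {k : ℕ}

theorem hom_Rd {R : Type} [CommRing R] [Algebra ℚ R] (f g : Bk k →ₐ[ℚ] R) (hP : (Pm k).map f = (Pm k).map g) (hS : (Sm k).map f = (Sm k).map g)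
    {d : ℕ} {r : Bk k} (hr : r ∈ Rd k d) : f r = g r := by
  have hx : (xm k).map f = (xm k).map g := by
    have h2 : (Sm k * Pm k).map f = (Sm k * Pm k).map g := by rw [Matrix.map_mul, Matrix.map_mul, hP, hS]
    ext1 i j
    rcases i with i | i
    · exact congrFun (congrFun hP i) j
    · exact congrFun (congrFun h2 i) j
  have : adjoin ℚ (Set.range fun p : NN k × Fin k => xm k p.1 p.2) ≤ AlgHom.equalizer f g := by
    refine Algebra.adjoin_le ?_
    rintro _ ⟨p, rfl⟩
    exact congrFun (congrFun hx p.1) p.2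
  exact this (Rd_adjoin hr)

def dl (p : Fin k × Fin k) : ℚ := if p.1 = p.2 then 1 else 0
def ev0 : Bk k →ₐ[ℚ] ℚ := MvPolynomial.aeval (elim dl 0)

theorem const_eval (N S0 : Fin k × Fin k → ℚ) (hN : ∀ p : Fin k × Fin k, p.1 ≤ p.2 → N p = 0) (hS : ∀ i j, S0 (i, j) = S0 (j, i)) (r : Bk k)
    (hr : ∀ a, GD (eM a) r = 0) : MvPolynomial.aeval (elim (dl + N) S0) r = ev0 r := by
  have h := const_path N S0 hN hS r hr
  obtain ⟨c, hc⟩ := Polynomial.natDegree_eq_zero.1 (Polynomial.natDegree_eq_zero_of_derivative_eq_zero h)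
  have e : ∀ t : ℚ, MvPolynomial.aeval (elim (dl + t • N) (t • S0)) r = c := by
    intro t
    have : (MvPolynomial.aeval (elim (dl + t • N) (t • S0)) : Bk k →ₐ[ℚ] ℚ) = (aeval t).comp (pth N S0) := by
      ext s
      rcases s with s | s
      · simp [pth, dl]
        split_ifs <;> simp [mul_comm]
      · simp [pth]; ring
    rw [this, AlgHom.comp_apply, ← hc]; simp
  have e1 := e 1
  have e0 := e 0
  rw [one_smul, one_smul] at e1
  rw [zero_smul, zero_smul, add_zero] at e0
  rw [e1, ← e0]; rfl

theorem exQ (P0 : MF k) (hd : ∀ l, (lead l P0).det ≠ 0) : ∃ Q : MF k, UT Q ∧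
    (∀ i j, i ≤ j → (P0 * Q) i j = dl (i, j)) ∧ ∀ l, (lead l Q).det ≠ 0 := by
  obtain ⟨Q, hQdef⟩ : ∃ Q : MF k, Q = Matrix.of fun i j => if h : i ≤ j then ((lead j P0)⁻¹) ⟨i, h⟩ ⟨j, le_rfl⟩ else 0 := ⟨_, rfl⟩
  have hQ : UT Q := by intro i j h; simp only [hQdef, of_apply, dif_neg (not_le.2 h)]
  have hlm : ∀ l, lead l (P0 * Q) = lead l P0 * lead l Q := fun l => lead_mul l _ _ (fun i j m _ hj hm => by rw [hQ m j (lt_of_le_of_lt hj hm), mul_zero])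
  have hPQ : ∀ i j, i ≤ j → (P0 * Q) i j = dl (i, j) := by
    intro i j hij
    have h1 : (lead j P0 * (lead j P0)⁻¹) ⟨i, hij⟩ ⟨j, le_rfl⟩ = dl (i, j) := by
      rw [Matrix.mul_nonsing_inv _ (IsUnit.mk0 _ (hd j)), Matrix.one_apply, dl]; simp [Subtype.ext_iff]
    rw [← h1]
    have h2 := congrFun (congrFun (hlm j) ⟨i, hij⟩) ⟨j, le_rfl⟩
    rw [show (P0 * Q) i j = lead j (P0 * Q) ⟨i, hij⟩ ⟨j, le_rfl⟩ from rfl, h2, Matrix.mul_apply, Matrix.mul_apply]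
    refine sum_congr rfl fun x _ => ?_
    congr 1
    simp only [lead, submatrix_apply, hQdef, of_apply]
    rw [dif_pos x.2]
  refine ⟨Q, hQ, hPQ, fun l h => ?_⟩
  have h2 := congrArg Matrix.det (hlm l)
  rw [Matrix.det_mul, h, mul_zero, Matrix.det_of_lowerTriangular] at h2
  · refine prod_ne_zero_iff.2 (fun i _ => ?_) h2
    show (P0 * Q) i.1 i.1 ≠ 0
    rw [hPQ _ _ le_rfl, dl, if_pos rfl]; exact one_ne_zero
  · intro i j h3
    have h4 : i.1 < j.1 := h3
    show (P0 * Q) i.1 j.1 = 0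
    rw [hPQ _ _ h4.le, dl, if_neg h4.ne]

theorem uniq {lam : Fin k → ℕ} {r : Bk k} (hr : r ∈ Mo lam) (he : ∀ a, GD (eM a) r = 0) (h0 : ev0 r = 0) : r = 0 := by
  by_contra hne
  have hvk : ∀ l : Fin k, vk l ≠ 0 := by
    intro l h
    have : ev0 (vk l) = 1 := by
      rw [vk, AlgHom.map_det]
      have : ev0.mapMatrix (lead l (Pm k)) = 1 := by
        ext i j
        simp only [lead, Pm, AlgHom.mapMatrix_apply, map_apply, submatrix_apply, of_apply, ev0, MvPolynomial.aeval_X, elim_inl, dl, Matrix.one_apply, Subtype.ext_iff]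
      rw [this, Matrix.det_one]
    rw [h, map_zero] at this
    exact one_ne_zero this.symm
  have hp : r * ∏ l, vk l ≠ 0 := mul_ne_zero hne (prod_ne_zero_iff.2 fun l _ => hvk l)
  obtain ⟨z, hz⟩ : ∃ z, MvPolynomial.aeval z (r * ∏ l, vk l) ≠ (0:ℚ) := by
    by_contra! H
    exact hp (MvPolynomial.funext fun z => by rw [map_zero]; exact H z)
  rw [map_mul, map_prod] at hz
  have hzr := left_ne_zero_of_mul hz
  have hzl := prod_ne_zero_iff.1 (right_ne_zero_of_mul hz)
  let P0 : MF k := Matrix.of fun i j => z (Sum.inl (i, j))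
  have hPz : (Pm k).map (MvPolynomial.aeval z : Bk k →ₐ[ℚ] ℚ) = P0 := by ext i j; simp [Pm, P0]
  have hd : ∀ l, (lead l P0).det ≠ 0 := by
    intro l
    have := hzl l (mem_univ _)
    rw [vk, AlgHom.map_det] at this
    rw [← hPz]; exact this
  obtain ⟨Q, hQ, hPQ, hQd⟩ := exQ P0 hd
  let N : Fin k × Fin k → ℚ := fun p => (P0 * Q) p.1 p.2 - dl p
  let S0 : Fin k × Fin k → ℚ := fun p => (1/2:ℚ) * (z (Sum.inr (p.1, p.2)) + z (Sum.inr (p.2, p.1)))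
  have c := const_eval N S0 (fun p hp => by simp only [N]; rw [hPQ _ _ hp, sub_self]) (fun i j => by simp only [S0]; ring) r he
  rw [h0] at c
  have c2 : MvPolynomial.aeval z (psi Q r) = (0:ℚ) := by
    rw [← c]
    refine hom_Rd ((MvPolynomial.aeval z : Bk k →ₐ[ℚ] ℚ).comp (psi Q)) _ ?_ ?_ hr.1
    · show (((Pm k).map (psi Q))).map (MvPolynomial.aeval z : Bk k →ₐ[ℚ] ℚ) = _
      rw [psi_P, Matrix.map_mul, cmφ, hPz]
      ext i j
      simp [Pm, N, MvPolynomial.aeval_X]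
    · show (((Sm k).map (psi Q))).map (MvPolynomial.aeval z : Bk k →ₐ[ℚ] ℚ) = _
      rw [psi_S]
      ext i j
      simp [Sm, S0]; ring
  rw [hr.2 Q hQ, map_smul, smul_eq_mul] at c2
  rcases mul_eq_zero.1 c2 with h | h
  · rw [chi, Finset.prod_eq_zero_iff] at h
    obtain ⟨l, _, h⟩ := h
    have h' := eq_zero_of_pow_eq_zero h
    exact hQd l h'
  · exact hzr h
end

section
variable {k : ℕ}

def Wt (w : Fin k → ℚ) : Submodule ℚ (Bk k) where
  carrier := {v | ∀ j, GD (hY j j) v = w j • v}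
  zero_mem' := by simp
  add_mem' := by intro a b ha hb j; rw [map_add, ha j, hb j, smul_add]
  smul_mem' := by intro c a ha j; rw [Derivation.map_smul, ha j, smul_comm]

theorem Wt_mul {w w' : Fin k → ℚ} {r s : Bk k} (hr : r ∈ Wt w) (hs : s ∈ Wt w') : r * s ∈ Wt (w + w') := by
  intro j
  rw [leibniz, hr j, hs j, Pi.add_apply, smul_eq_mul, smul_eq_mul, mul_smul_comm, mul_smul_comm, add_smul, mul_comm s r, add_comm]

theorem Wt_one : (1 : Bk k) ∈ Wt (0 : Fin k → ℚ) := by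
  intro j; simp

theorem Wt_x (a : NN k) (c : Fin k) : ∃ w, xm k a c ∈ Wt w := by
  refine ⟨fun j => elim (fun i => if i = j then 1 else 0) (fun i => if i = j then -1 else 0) a, fun j => ?_⟩
  have h := congrFun (congrFun (GD_x (hY j j)) a) c
  rw [pr_of _ (τ_h j j), Matrix.mul_apply] at h
  refine h.trans ?_
  rw [sum_eq_single a]
  · rw [hY_bl]
    rcases a with i | i
    · simp only [cm, map_apply, transpose_apply, Matrix.fromBlocks_apply₁₁, elim_inl]
      by_cases h : i = j <;> simp [h, single_apply, eq_comm]
      intro h2; exact absurd h2.symm h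
    · simp only [cm, map_apply, transpose_apply, Matrix.fromBlocks_apply₂₂, elim_inr]
      by_cases h : i = j <;> simp [h, single_apply, eq_comm]
      intro h2; exact absurd h2.symm h
  · intro b _ hb
    have : hY j j b a = 0 := by
      rw [hY_bl]
      rcases a with a | a <;> rcases b with b | b <;> simp [single_apply]
      · rintro rfl rfl; exact hb rfl
      · rintro rfl rfl; exact hb rfl
    simp [cm, this]
  · simp

theorem Rd_Wt (d : ℕ) : Rd k d ≤ ⨆ w, Wt w := by
  unfold Rd
  induction d with
  | zero => 
    rw [pow_zero, Submodule.one_le]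
    exact mem_iSup_of_mem 0 Wt_one
  | succ d ih =>
    rw [pow_succ]
    refine (mul_le_mul' ih (show Rx k ≤ ⨆ w, Wt w from ?_)).trans ?_
    · rw [Rx, Submodule.span_le]
      rintro _ ⟨p, rfl⟩
      obtain ⟨w, hw⟩ := Wt_x p.1 p.2
      exact mem_iSup_of_mem w hw
    · rw [Submodule.iSup_mul]
      refine iSup_le fun w => ?_
      rw [Submodule.mul_iSup]
      refine iSup_le fun w' => ?_
      rw [Submodule.mul_le]
      intro m hm n hn
      exact mem_iSup_of_mem _ (Wt_mul hm hn)

theorem sep {V : Type} [AddCommGroup V] [Module ℚ V] (H : Fin k → V →ₗ[ℚ] V) (M : Submodule ℚ V) (hM : ∀ j m, m ∈ M → H j m ∈ M)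
    (T : Finset (Fin k → ℚ)) : ∀ (v : (Fin k → ℚ) → V) (hv : ∀ w ∈ T, ∀ j, H j (v w) = w j • v w) (hs : ∑ w ∈ T, v w ∈ M), ∀ w ∈ T, v w ∈ M := by
  classical
  induction T using induction_on with
  | empty => simp
  | insert w0 T h0 ih =>
    intro v hv hs
    have h1 : ∀ w ∈ T, v w ∈ M := by
      intro w1 hw1
      have hne : w1 ≠ w0 := fun h => h0 (h ▸ hw1)
      obtain ⟨j, hj⟩ := Function.ne_iff.1 hne
      have h2 := ih (fun w => (w j - w0 j) • v w) (by
        intro w hw i; rw [map_smul, hv w (Finset.mem_insert_of_mem hw), smul_comm]) (by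
        have h3 := M.sub_mem (hM j _ hs) (M.smul_mem (w0 j) hs)
        rw [sum_insert h0, map_add, map_sum, hv w0 (Finset.mem_insert_self _ _), smul_add, add_sub_add_left_eq_sub, smul_sum, ← sum_sub_distrib] at h3
        convert h3 using 1
        refine sum_congr rfl fun w hw => ?_
        rw [hv w (Finset.mem_insert_of_mem hw), sub_smul]) w1 hw1
      have h4 := M.smul_mem (w1 j - w0 j)⁻¹ h2
      rwa [smul_smul, inv_mul_cancel₀ (sub_ne_zero.2 hj), one_smul] at h4
    intro w hw
    rcases Finset.mem_insert.1 hw with rfl | hw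
    · rw [sum_insert h0] at hs
      have := M.sub_mem hs (M.sum_mem (fun w hw => h1 w hw))
      simpa using this
    · exact h1 w hw

instance Mo_fin (lam : Fin k → ℕ) : Module.Finite ℚ (Mo lam) := by
  have : (Rd k (degY lam)).FG := by
    refine Submodule.FG.pow ?_ _
    exact Submodule.fg_span (Set.finite_range _)
  have h2 : Mo lam ≤ Rd k (degY lam) := fun r hr => hr.1
  haveI : Module.Finite ℚ (Rd k (degY lam)) := Module.Finite.iff_fg.2 this
  exact Module.Finite.of_injective (Submodule.inclusion h2) (Submodule.inclusion_injective h2)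

theorem exists_wb (lam : Fin k → ℕ) : ∃ (n : ℕ) (b : Basis (Fin n) ℚ (Mo lam)) (wt : Fin n → Fin k → ℚ),
    ∀ j i, GD (hY j j) (b i : Bk k) = wt i j • (b i : Bk k) := by
  classical
  let S : Set (Mo lam) := {m | ∃ w : Fin k → ℚ, (m : Bk k) ∈ Wt w}
  have hS : ⊤ ≤ Submodule.span ℚ S := by
    rintro ⟨r, hr⟩ _
    obtain ⟨f, hf, hs⟩ := (Submodule.mem_iSup_iff_exists_finsupp _ _).1 (Rd_Wt _ hr.1)
    have h1 := sep (fun j => (GD (hY j j) : Bk k →ₗ[ℚ] Bk k)) (Mo lam) (fun j m hm => Mo_GD lam _ hm) f.support f (fun w _ j => hf w j) (by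
      rw [Finsupp.sum] at hs; rw [hs]; exact hr)
    have h2 : (⟨r, hr⟩ : Mo lam) = ∑ w ∈ f.support.attach, ⟨f w, h1 w w.2⟩ := by
      apply Subtype.ext
      rw [Submodule.coe_sum]
      show r = _
      rw [← hs, Finsupp.sum, ← Finset.sum_attach]
    rw [h2]
    exact Submodule.sum_mem _ fun w _ => Submodule.subset_span ⟨w, hf w⟩
  let b := Basis.ofSpan hS
  have hb : ∀ i, ∃ w, (b i : Bk k) ∈ Wt w := fun i => Basis.ofSpan_subset hS ⟨i, rfl⟩
  haveI := Module.Finite.finite_basis b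
  haveI := Fintype.ofFinite ((linearIndepOn_empty ℚ (id : Mo lam → Mo lam)).extend (Set.empty_subset S))
  let e := Fintype.equivFin ((linearIndepOn_empty ℚ (id : Mo lam → Mo lam)).extend (Set.empty_subset S))
  choose w hw using hb
  refine ⟨_, b.reindex e, fun i => w (e.symm i), fun j i => ?_⟩
  rw [Basis.reindex_apply]
  exact hw _ j

def GV (lam : Fin k → ℕ) : MN k →ₗ[ℚ] End ℚ (Mo lam) where
  toFun Y := ((GD Y : Bk k →ₗ[ℚ] Bk k)).restrict (fun r hr => Mo_GD lam Y hr)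
  map_add' Y Z := by ext r; simp
  map_smul' c Y := by ext r; simp

theorem GV_apply (lam : Fin k → ℕ) (Y) (r : Mo lam) : ((GV lam Y r : Mo lam) : Bk k) = GD Y r := rfl
theorem GV_τ (lam : Fin k → ℕ) (Y) : GV lam (τ Y) = GV lam Y := by
  ext1 r; apply Subtype.ext; exact GD_τ Y r.2.1
theorem GV_br (lam : Fin k → ℕ) (Z Y) (h : τ Z = Z) : GV lam Z * GV lam Y - GV lam Y * GV lam Z = GV lam (Z * Y - Y * Z) := by
  ext1 r; apply Subtype.ext; exact GD_br Z Y h r.2.1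

def nb (lam : Fin k → ℕ) : ℕ := (exists_wb lam).choose
def bb (lam : Fin k → ℕ) : Basis (Fin (nb lam)) ℚ (Mo lam) := (exists_wb lam).choose_spec.choose
def wb (lam : Fin k → ℕ) : Fin (nb lam) → Fin k → ℚ := (exists_wb lam).choose_spec.choose_spec.choose
theorem hwb (lam : Fin k → ℕ) : ∀ j i, GV lam (hY j j) (bb lam i) = wb lam i j • bb lam i := fun j i =>
  Subtype.ext ((exists_wb lam).choose_spec.choose_spec.choose_spec j i)

theorem GD_h_vl (lam : Fin k → ℕ) (j : Fin k) : GD (hY j j) (vl lam) = epsWt .C k lam j • vl lam := by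
  have h1 : ∀ l : Fin k, vk l ∈ Wt (fun j => if j ≤ l then 1 else 0) := by
    intro l j; rw [GD_h_vk j j l le_rfl]; simp
  have h2 : ∀ (l : Fin k) (n : ℕ), vk l ^ n ∈ Wt (fun j => if j ≤ l then (n:ℚ) else 0) := by
    intro l n
    induction n with
    | zero => rw [pow_zero]; convert Wt_one using 2; ext; simp
    | succ n ih => rw [pow_succ]; convert Wt_mul ih (h1 l) using 2; ext; simp only [Pi.add_apply]; split_ifs <;> simp
  have h3 : ∀ T : Finset (Fin k), ∏ l ∈ T, vk l ^ lam l ∈ Wt (fun j => ∑ l ∈ T, if j ≤ l then (lam l:ℚ) else 0) := by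
    intro T
    induction T using induction_on with
    | empty => rw [prod_empty]; convert Wt_one using 2; simp; rfl
    | insert a T ha ih => 
      rw [prod_insert ha]; convert Wt_mul (h2 a (lam a)) ih using 2; ext
      rw [sum_insert ha]; rfl
  have := h3 univ j
  rw [vl, this]
  congr 1
  simp only [epsWt, sub_zero]
  rw [sum_filter]
  rfl

theorem GD_e_vl (lam : Fin k → ℕ) (a) : GD (eM a) (vl lam) = 0 := by
  rw [vl, D_prod]
  refine sum_eq_zero fun l _ => ?_
  rw [Derivation.leibniz_pow, GD_e_vk]; simp

theorem ev0_vl (lam : Fin k → ℕ) : ev0 (vl lam) = 1 := by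
  rw [vl, map_prod]
  refine Finset.prod_eq_one fun l _ => ?_
  rw [map_pow, vk, AlgHom.map_det]
  have : ev0.mapMatrix (lead l (Pm k)) = 1 := by
    ext i j
    simp only [lead, Pm, AlgHom.mapMatrix_apply, map_apply, submatrix_apply, of_apply, ev0, MvPolynomial.aeval_X, elim_inl, dl, Matrix.one_apply, Subtype.ext_iff]
  rw [this, Matrix.det_one, one_pow]

def Ry (lam : Fin 10 → ℕ) : RD 10 (Fin 10 × Fin 10) (bb lam) :=
  RY (GV lam) (GV_τ lam) (GV_br lam) (bb lam) (wb lam) (hwb lam) (rhoY .C 10) (fun i => by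
    have := congrArg (fun v => dt v (wb lam i)) sum_αY
    simp only [smul_dt] at this
    rw [← this]
    simp only [dt, Finset.sum_apply, sum_mul]
    exact sum_comm)

theorem hwY_iff (lam : Fin 10 → ℕ) (ν) (v : Mo lam) (hv : v ∈ (Ry lam).hw ν) : ∃ c : ℚ, (v : Bk 10) = c • vl lam := by
  refine ⟨ev0 (v : Bk 10), sub_eq_zero.1 (uniq (lam := lam) ?_ ?_ ?_)⟩
  · exact (Mo lam).sub_mem v.2 ((Mo lam).smul_mem _ (vl_mem lam))
  · intro a
    have : GD (eM a) (v : Bk 10) = 0 := congrArg Subtype.val (hv.2 a)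
    rw [map_sub, Derivation.map_smul, GD_e_vl, this]; simp
  · rw [map_sub, map_smul, ev0_vl]; simp

theorem vl_ne (lam : Fin k → ℕ) : vl lam ≠ 0 := by
  intro h; have := ev0_vl lam; rw [h, map_zero] at this; exact one_ne_zero this.symm

theorem finrank_hwY (lam : Fin 10 → ℕ) (ν) : finrank ℚ ((Ry lam).hw ν) = if epsWt .C 10 lam = ν then 1 else 0 := by
  split_ifs with h
  · subst h
    let v0 : Mo lam := ⟨vl lam, vl_mem lam⟩
    have h0 : v0 ∈ (Ry lam).hw (epsWt .C 10 lam) := ⟨fun j => Subtype.ext (GD_h_vl lam j), fun a => Subtype.ext (GD_e_vl lam a)⟩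
    refine finrank_eq_one (⟨v0, h0⟩ : (Ry lam).hw (epsWt .C 10 lam)) ?_ ?_
    · intro hh; exact vl_ne lam (congrArg (fun x => ((x : (Ry lam).hw _) : Mo lam).1) hh)
    · rintro ⟨v, hv⟩
      obtain ⟨c, hc⟩ := hwY_iff lam _ v hv
      exact ⟨c, Subtype.ext (Subtype.ext hc.symm)⟩
  · have : (Ry lam).hw ν = ⊥ := by
      rw [eq_bot_iff]
      intro v hv
      obtain ⟨c, hc⟩ := hwY_iff lam _ v hv
      by_cases h0 : c = 0
      · rw [Submodule.mem_bot]; apply Subtype.ext; rw [hc, h0, zero_smul]; rfl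
      · exfalso; apply h
        funext j
        have h1 : GD (hY j j) (v : Bk 10) = ν j • (v : Bk 10) := congrArg Subtype.val (hv.1 j)
        rw [hc, Derivation.map_smul, GD_h_vl, smul_comm (ν j), ← sub_eq_zero, ← smul_sub, ← sub_smul, smul_smul] at h1
        rcases smul_eq_zero.1 h1 with h2 | h2
        · rcases mul_eq_zero.1 h2 with h3 | h3
          · exact absurd h3 h0
          · linarith
        · exact absurd h2 (vl_ne lam)
    rw [this]; simp

def chY (lam : Fin 10 → ℕ) : CharRing 10 := ∑ i, mono (wb lam i)

theorem eps_dom (lam : Fin 10 → ℕ) : StrictAnti (epsWt .C 10 lam + rhoY .C 10) ∧ ∀ i, 0 < (epsWt .C 10 lam + rhoY .C 10) i := by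
  have h0 : ∀ i, 0 ≤ epsWt .C 10 lam i := fun i => by
    simp only [epsWt, sub_zero]; exact Finset.sum_nonneg fun _ _ => by positivity
  have h1 : Antitone (epsWt .C 10 lam) := by
    intro i j h
    simp only [epsWt, sub_zero]
    refine Finset.sum_le_sum_of_subset_of_nonneg ?_ (fun _ _ _ => by positivity)
    intro x; simp only [mem_filter, mem_univ, true_and]; exact fun hx => le_trans h hx
  exact ⟨fun i j h => add_lt_add_of_le_of_lt (h1 h.le) ((rhoY_anti 10).1 h), fun i => add_pos_of_nonneg_of_pos (h0 i) ((rhoY_anti 10).2 i)⟩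

theorem chY_isChar (lam : Fin 10 → ℕ) : IsCharY .C 10 lam (chY lam) := by
  apply toQ_inj
  rw [← sub_eq_zero]
  have hch : toQ (chY lam) = ∑ i, single (wb lam i) 1 := by simp only [chY, map_sum, toQ_mono]
  refine vanish αY (rhoY .C 10) αY_ne ((domY _).2 (rhoY_anti 10)) _ ?_ ?_
  · intro a v
    rw [map_mul, coeff_sub, Finsupp.sub_apply, Finsupp.sub_apply]
    rw [anti_mul (αY a) (αY_ne a) _ _ (toQY_anti 10 _ a) (by rw [hch]; exact (Ry lam).sym a (αY_ne a))]
    have := anti_mul (αY a) (αY_ne a) _ 1 (toQY_anti 10 (epsWt .C 10 lam + rhoY .C 10) a) (by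
      intro v
      have h0 : (1 : QR 10) = single 0 1 := rfl
      have h : rfl' (αY a) v = 0 ↔ v = 0 := by
        constructor
        · intro h; rw [← rfl_rfl (αY a) v (αY_ne a), h]; simp [rfl', dt]
        · rintro rfl; simp [rfl', dt]
      simp only [h0, AddMonoidAlgebra.coeff_single, Finsupp.single_apply, eq_comm (a := (0 : Fin 10 → ℚ)), h]) v
    rw [mul_one] at this
    rw [this]; ring
  · intro v hv
    have h1 := (Ry lam).mult _ (toQ_denY 10) (lapY 10 _) (v - rhoY .C 10) (by
      intro a; show 0 < dt (v - rhoY .C 10 + rhoY .C 10) (αY a); rw [sub_add_cancel]; exact hv a)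
    rw [show (Ry lam).ρ = rhoY .C 10 from rfl, sub_add_cancel, show (Ry lam).wt = wb lam from rfl, ← hch, finrank_hwY] at h1
    rw [map_mul, coeff_sub, Finsupp.sub_apply, h1, coeff_toQ]
    have hd := (domY v).1 hv
    rw [altY_coeff _ _ _ (eps_dom lam).1 hd.1 (eps_dom lam).2 hd.2]
    simp only [eq_sub_iff_add_eq]
    split_ifs <;> simp

theorem chY_uniq (lam : Fin 10 → ℕ) (f) (hf : IsCharY .C 10 lam f) : f = chY lam := by
  have h : altY .C 10 (rhoY .C 10) ≠ 0 := by
    intro h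
    have := altY_coeff 10 (rhoY .C 10) (rhoY .C 10) (rhoY_anti 10).1 (rhoY_anti 10).1 (rhoY_anti 10).2 (rhoY_anti 10).2
    rw [h] at this; simp at this
  exact mul_left_cancel₀ h (hf.trans (chY_isChar lam).symm)
end

def TT : ℕ := 2650747435780025192737003578011341401197003827540243203563569095656424481427016119293557865917322230312870397751012501299093573700876750259980879915725434106412672304005851072191962900120420675084524672679565079368914842215865478795262767008708828215838036136352659093545110016316826850346986701762233030122347117171471059172624227937415003443202855475333551401658517963940802026895538246212384676457833442652272964946431260918895809293721301912432350308414614124704546855423489787722200307757469021115933929130537480092301033867047869150576423247422551895299390706737461382635340897286914897823920425824523848961242501684298374370718825676060684692895123791617705713771707753742377457217395525884092340694077276210475944465132517999422245975127500592676627574111790688809178629781147497861016718281535348596645288289267095284095039097690897139585114628615883121293341290920707046655206984482042214258513178713210842711784052289371030494886925282163000140983698488790804468944798561764274800850661784031876499909082482796718094556965341357855140599184740030097031489908929657407520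
def CC : ℕ := 513105510153058329844591480515592635648631392469855643731114971045201807389728659827827727566547157086066414787013133859339560362319621462815085015554030954696568286171084073114673813714001282749341554023865432946649515334432880726352180580969803260866683401028618824662413169390299949232603750908216746208533723423205523868481180289358587699985495448671178663663197444240682663384969778821056080950330606966857730526027670886896981
def tN (i j b : ℕ) : ℕ := (TT >>> (5 * (120 * i + 20 * j + b))) % 32
def cN (i j b : ℕ) : ℕ := (CC >>> (2 * (120 * i + 20 * j + b))) % 4
def cZ (i j b : ℕ) : ℤ := if cN i j b = 1 then 1 else if cN i j b = 2 then -1 else 0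
def mZ (i j a b : ℕ) : ℤ := if a = tN i j b then cZ i j b else 0

def chk (i j k l b a : ℕ) : Prop :=
  (if a = tN i j (tN k l b) then cZ k l b * cZ i j (tN k l b) else 0) - (if a = tN k l (tN i j b) then cZ i j b * cZ k l (tN i j b) else 0)
   = (if j = k then mZ i l a b else 0) - (if l = i then mZ k j a b else 0)
instance (i j k l b a : ℕ) : Decidable (chk i j k l b a) := by unfold chk; infer_instance

theorem tlt : ∀ i < 6, ∀ j < 6, ∀ b < 20, tN i j b < 20 := by decide +kernel
def chk4 (i j k l b : ℕ) : Bool :=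
   (Nat.beq (cN k l b) 0 || Nat.beq (cN i j (tN k l b)) 0 || decide (chk i j k l b (tN i j (tN k l b)))) &&
   ((Nat.beq (cN i j b) 0 || Nat.beq (cN k l (tN i j b)) 0 || decide (chk i j k l b (tN k l (tN i j b)))) &&
   ((!(Nat.beq j k) || Nat.beq (cN i l b) 0 || decide (chk i j k l b (tN i l b))) && (!(Nat.beq l i) || Nat.beq (cN k j b) 0 || decide (chk i j k l b (tN k j b)))))
theorem chk_ok : ∀ i < 6, ∀ j < 6, ∀ k < 6, ∀ l < 6, ∀ b < 20, chk4 i j k l b = true := by decide +kernel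
def SymP (i j r s : ℕ) : Prop := mZ i j r s = - mZ i j (10 + s) (10 + r) + (if i = j ∧ r = s then 1 else 0) ∧
   mZ i j r (10 + s) = mZ i j s (10 + r) ∧ mZ i j (10 + r) s = mZ i j (10 + s) r ∧ (i < j → (mZ i j (10 + r) s = 0 ∧ (s ≤ r → mZ i j r s = 0)))
instance (i j r s : ℕ) : Decidable (SymP i j r s) := by unfold SymP; infer_instance
theorem sym_ok : ∀ i < 6, ∀ j < 6, ∀ r < 10, ∀ s < 10, SymP i j r s := by decide +kernel

theorem chk_all (i j k l b a : ℕ) (hi : i < 6) (hj : j < 6) (hk : k < 6) (hl : l < 6) (hb : b < 20) : chk i j k l b a := by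
  have h := chk_ok i hi j hj k hk l hl b hb
  simp only [chk4, and_eq_true, Bool.or_eq_true, beq_eq, decide_eq_true_eq, Bool.not_eq_true'] at h
  obtain ⟨h1, h2, h3, h4⟩ := h
  have z : ∀ i j b, cN i j b = 0 → cZ i j b = 0 := by intro i j b h; simp [cZ, h]
  by_contra hc
  have e1 : (if a = tN i j (tN k l b) then cZ k l b * cZ i j (tN k l b) else 0) = 0 := by
    split_ifs with h
    · rcases h1 with (h1 | h1) | h1
      · rw [z _ _ _ h1, zero_mul]
      · rw [z _ _ _ h1, mul_zero]
      · exact absurd (h ▸ h1) hc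
    · rfl
  have e2 : (if a = tN k l (tN i j b) then cZ i j b * cZ k l (tN i j b) else 0) = 0 := by
    split_ifs with h
    · rcases h2 with (h1 | h1) | h1
      · rw [z _ _ _ h1, zero_mul]
      · rw [z _ _ _ h1, mul_zero]
      · exact absurd (h ▸ h1) hc
    · rfl
  have e3 : (if j = k then mZ i l a b else 0) = 0 := by
    unfold mZ
    split_ifs with hh h
    · rcases h3 with (h1 | h1) | h1
      · subst hh; simp at h1
      · rw [z _ _ _ h1]
      · exact absurd (h ▸ h1) hc
    · rfl
    · rfl
  have e4 : (if l = i then mZ k j a b else 0) = 0 := by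
    unfold mZ
    split_ifs with hh h
    · rcases h4 with (h1 | h1) | h1
      · subst hh; simp at h1
      · rw [z _ _ _ h1]
      · exact absurd (h ▸ h1) hc
    · rfl
    · rfl
  apply hc
  rw [chk, e1, e2, e3, e4]

def fE : NN 10 ≃ Fin 20 := finSumFinEquiv
def T20 (i j : Fin 6) : Matrix (Fin 20) (Fin 20) ℚ := Matrix.of fun a b => (mZ i j a b : ℚ)

theorem T20_mul (i j k l : Fin 6) (a b : Fin 20) : (T20 i j * T20 k l) a b =
    (((if a = tN i j (tN k l b) then cZ k l b * cZ i j (tN k l b) else 0 : ℤ)) : ℚ) := by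
  rw [Matrix.mul_apply, sum_eq_single ⟨tN k l b, tlt k k.2 l l.2 b b.2⟩]
  · simp only [T20, of_apply, mZ, if_true]
    push_cast
    split_ifs <;> ring
  · intro c _ hc
    have : (c : ℕ) ≠ tN k l b := fun h => hc (Fin.ext h)
    simp [T20, mZ, this]
  · simp

theorem T20_br (i j k l : Fin 6) : T20 i j * T20 k l - T20 k l * T20 i j = (if j = k then T20 i l else 0) - (if l = i then T20 k j else 0) := by
  ext a b
  rw [Matrix.sub_apply, T20_mul, T20_mul, ← Int.cast_sub, chk_all i j k l b a i.2 j.2 k.2 l.2 b.2]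
  rw [Matrix.sub_apply]
  push_cast
  congr 1 <;> simp only [ext_iff] <;> split_ifs <;> simp [T20]

def Yr (i j : Fin 6) : Matrix (NN 10) (NN 10) ℚ := (T20 i j).submatrix fE fE - (if i = j then (1/2:ℚ) else 0) • 1

theorem Yr_br (i j k l : Fin 6) : Yr i j * Yr k l - Yr k l * Yr i j = (if j = k then Yr i l else 0) - (if l = i then Yr k j else 0) := by
  have h := congrArg (fun M => M.submatrix fE fE) (T20_br i j k l)
  have h2 : ∀ A B : Matrix (Fin 20) (Fin 20) ℚ, (A * B).submatrix fE fE = A.submatrix fE fE * B.submatrix fE fE := fun A B =>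
    (Matrix.submatrix_mul_equiv A B _ _ _).symm
  simp only [Matrix.submatrix_sub, Pi.sub_apply, h2] at h
  have e : Yr i j * Yr k l - Yr k l * Yr i j = (T20 i j).submatrix fE fE * (T20 k l).submatrix fE fE
    - (T20 k l).submatrix fE fE * (T20 i j).submatrix fE fE := by
    simp only [Yr, sub_mul, mul_sub, smul_mul, Matrix.mul_smul, Matrix.one_mul, Matrix.mul_one]
    rw [smul_comm]; abel
  rw [e]
  refine h.trans ?_
  by_cases h1 : j = k <;> by_cases h3 : l = i
  · subst h1 h3; simp [Yr]
  · have : i ≠ l := fun h => h3 h.symm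
    subst h1; simp [Yr, h3, this]
  · have : k ≠ j := fun h => h1 h.symm
    subst h3; simp [Yr, h1, this]
  · simp [h1, h3]

theorem Yr_bl (i j : Fin 6) : ∃ a b c : Matrix (Fin 10) (Fin 10) ℚ, Yr i j = fromBlocks a b c (-a.transpose) ∧ b.transpose = b ∧ c.transpose = c ∧
    (i < j → c = 0 ∧ ∀ r s, s ≤ r → a r s = 0) ∧ (∀ r s, a r s = mZ i j r s - if i = j ∧ r = s then 1/2 else 0) ∧ (∀ r s : Fin 10, b r s = mZ i j r (10 + s)) ∧ (∀ r s : Fin 10, c r s = mZ i j (10 + r) s) := by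
  have hS := fun r s : Fin 10 => sym_ok i i.2 j j.2 r r.2 s s.2
  have v1 : ∀ r : Fin 10, ((fE (Sum.inl r : NN 10) : Fin 20) : ℕ) = r := fun r => by simp [fE]; rfl
  have v2 : ∀ r : Fin 10, ((fE (Sum.inr r : NN 10) : Fin 20) : ℕ) = 10 + r := fun r => by simp [fE]; rfl
  have w : ∀ x y : NN 10, Yr i j x y = (mZ i j (fE x) (fE y) : ℚ) - if i = j ∧ x = y then 1/2 else 0 := by
    intro x y
    simp only [Yr, Matrix.sub_apply, submatrix_apply, T20, of_apply, Matrix.smul_apply, Matrix.one_apply]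
    congr 1
    by_cases h1 : i = j <;> by_cases h2 : x = y <;> simp [h1, h2]
  refine ⟨(Yr i j).toBlocks₁₁, (Yr i j).toBlocks₁₂, (Yr i j).toBlocks₂₁, ?_, ?_, ?_, ?_, ?_, ?_, ?_⟩
  · conv_lhs => rw [← fromBlocks_toBlocks (Yr i j)]
    congr 1
    ext r s
    simp only [toBlocks₂₂, toBlocks₁₁, of_apply, Matrix.neg_apply, transpose_apply, w, v1, v2]
    have := (hS s r).1
    rw [this]
    simp only [ext_iff, eq_comm (a := (s:ℕ)), Sum.inr.injEq, Sum.inl.injEq]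
    split_ifs <;> push_cast <;> ring
  · ext r s
    simp only [toBlocks₁₂, of_apply, transpose_apply, w, v1, v2]
    rw [(hS s r).2.1]; simp
  · ext r s
    simp only [toBlocks₂₁, of_apply, transpose_apply, w, v1, v2]
    rw [(hS s r).2.2.1]; simp
  · intro hij
    have hne : i ≠ j := hij.ne
    constructor
    · ext r s
      simp only [toBlocks₂₁, of_apply, w, v1, v2]
      rw [((hS r s).2.2.2 hij).1]; simp
    · intro r s h
      simp only [toBlocks₁₁, of_apply, w, v1, v2]
      rw [((hS r s).2.2.2 hij).2 h]; simp [hne]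
  · intro r s
    simp only [toBlocks₁₁, of_apply, w, v1, Sum.inl.injEq]
  · intro r s
    simp [toBlocks₁₂, of_apply, w, v1, v2]
  · intro r s
    simp [toBlocks₂₁, of_apply, w, v1, v2]

theorem τ_Yr (i j : Fin 6) : τ (Yr i j) = Yr i j := by
  obtain ⟨a, b, c, h, hb, hc, -⟩ := Yr_bl i j
  rw [h, τ_blocks]; simp [hb, hc]

def YR : Matrix (Fin 6) (Fin 6) ℚ →ₗ[ℚ] Matrix (NN 10) (NN 10) ℚ where
  toFun Z := ∑ i, ∑ j, Z i j • Yr i j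
  map_add' Z Y := by simp [add_smul, sum_add_distrib]
  map_smul' c Z := by simp [smul_sum, smul_smul]

theorem YR_E (i j : Fin 6) : YR (E i j) = Yr i j := by
  show ∑ a, ∑ b, (E i j) a b • Yr a b = _
  rw [sum_eq_single i, sum_eq_single j]
  · simp
  · intro b _ h; simp [single_apply, h.symm]
  · simp
  · intro b _ h; simp [single_apply, h.symm]
  · simp

theorem τ_YR (Z) : τ (YR Z) = YR Z := by
  induction Z using induction_on' with
  | h_zero => rw [map_zero]; simp [τ]
  | h_add p q hp hq => rw [map_add, τ_add, hp, hq]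
  | h_std_basis i j x => 
    rw [show Matrix.single i j x = x • E i j by simp, map_smul, τ_smul, YR_E, τ_Yr]

theorem YR_br (Z Y) : YR Z * YR Y - YR Y * YR Z = YR (Z * Y - Y * Z) := by
  induction Z using induction_on' with
  | h_zero => simp
  | h_add p q hp hq => rw [add_mul, mul_add, map_add, add_mul, mul_add, add_sub_add_comm, hp, hq, add_sub_add_comm, map_add]
  | h_std_basis i j x => 
    induction Y using induction_on' with
    | h_zero => simp
    | h_add p q hp hq => rw [add_mul, mul_add, map_add, add_mul, mul_add, add_sub_add_comm, hp, hq, add_sub_add_comm, map_add]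
    | h_std_basis k l y =>
      rw [show Matrix.single i j x = x • E i j by simp, show Matrix.single k l y = y • E k l by simp, map_smul, map_smul, YR_E, YR_E]
      simp only [smul_mul, Matrix.mul_smul]
      rw [smul_comm y x, smul_comm y x, ← smul_sub, ← smul_sub, ← smul_sub, ← smul_sub, map_smul, map_smul, Yr_br, E_br, map_sub]
      congr 3 <;> split_ifs <;> simp [YR_E]

theorem GD_blk (a b : Matrix (Fin 10) (Fin 10) ℚ) (hb : b.transpose = b) :
    (fromBlocks a b 0 (-a.transpose) : Matrix (NN 10) (NN 10) ℚ) = ∑ r, ∑ s, a r s • hY r s + ∑ r, ∑ s, (1/2 * b r s) • uY r s := by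
  have hb' : ∀ r s, b s r = b r s := fun r s => congrFun (congrFun hb r) s
  ext x y
  rcases x with x | x <;> rcases y with y | y <;> simp [hY_bl, uY_bl, Matrix.sum_apply, single_apply, sum_add_distrib, mul_add, ite_and] <;> try rw [hb' x y]; ring

def GDx (x : Bk 10) : Matrix (NN 10) (NN 10) ℚ →ₗ[ℚ] Bk 10 where
  toFun Y := GD Y x
  map_add' Y Z := by rw [map_add, Derivation.add_apply]
  map_smul' c Y := by rw [map_smul, Derivation.smul_apply]; rfl

theorem GDx_sum (x : Bk 10) (f : Fin 10 → Fin 10 → ℚ) (g : Fin 10 → Fin 10 → Matrix (NN 10) (NN 10) ℚ) :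
    GDx x (∑ r, ∑ s, f r s • g r s) = ∑ r, ∑ s, f r s • GDx x (g r s) := by
  rw [map_sum]; refine sum_congr rfl fun r _ => ?_
  rw [map_sum]; refine sum_congr rfl fun s _ => ?_
  rw [map_smul]

theorem GD_Yr_vk (i j : Fin 6) (hij : i < j) (l : Fin 10) : GD (Yr i j) (vk l) = 0 := by
  obtain ⟨a, b, c, h, hb, -, hc, -⟩ := Yr_bl i j
  obtain ⟨rfl, ha⟩ := hc hij
  rw [h, GD_blk a b hb]
  show GDx (vk l) _ = 0
  rw [map_add]
  refine (congrArg₂ (·+·) (GDx_sum (vk l) (fun r s => a r s) hY) (GDx_sum (vk l) (fun r s => 1/2*b r s) uY)).trans ?_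
  have h1 : ∀ r s, GDx (vk l) (uY r s) = 0 := fun r s => GD_u_vk r s l
  simp only [h1, smul_zero, sum_const_zero, add_zero]
  refine sum_eq_zero fun r _ => sum_eq_zero fun s _ => ?_
  by_cases hrs : s ≤ r
  · rw [ha r s hrs, zero_smul]
  · have : r ≠ s := fun h => hrs h.ge
    have h2 : GDx (vk l) (hY r s) = 0 := (GD_h_vk r s l (le_of_not_ge hrs)).trans (by simp [this])
    rw [h2, smul_zero]

def w0 (r : Fin 10) (i : Fin 6) : ℚ := (mZ i i r r : ℚ) - 1/2

theorem diag_ok : ∀ i < 6, ∀ r < 20, ∀ s < 20, r ≠ s → mZ i i r s = 0 := by decide +kernel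

theorem Yr_diag (i : Fin 6) : Yr i i = ∑ r, w0 r i • hY r r := by
  obtain ⟨a, b, c, h, hb, hc, -, ha, hb', hc'⟩ := Yr_bl i i
  have b0 : b = 0 := by
    ext r s; rw [hb', diag_ok i i.2 r (by omega) (10 + s) (by omega) (by omega)]; simp
  have c0 : c = 0 := by
    ext r s; rw [hc', diag_ok i i.2 (10 + r) (by omega) s (by omega) (by omega)]; simp
  rw [h, b0, c0, GD_blk a 0 (by simp)]
  simp only [Matrix.zero_apply, mul_zero, zero_smul, sum_const_zero, add_zero]
  refine sum_congr rfl fun r _ => ?_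
  rw [sum_eq_single r]
  · rw [ha, w0]; simp
  · intro s _ hs
    have : (r : ℕ) ≠ s := fun h => hs (Fin.ext h.symm)
    rw [ha, diag_ok i i.2 r (by omega) s (by omega) this]
    simp [Ne.symm hs]
  · simp

theorem w0_tr (r : Fin 10) : ∑ i, w0 r i = 0 := by
  simp only [w0]; revert r; decide +kernel

def wX (lam : Fin 10 → ℕ) (i : Fin (nb lam)) : Fin 6 → ℚ := fun j => ∑ r, wb lam i r * w0 r j

theorem GV_diag (lam : Fin 10 → ℕ) (j : Fin 6) : GV lam (YR (E j j)) = ∑ r, w0 r j • GV lam (hY r r) := by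
  rw [YR_E, Yr_diag, map_sum]; simp only [map_smul]

def RX (lam : Fin 10 → ℕ) : RD 6 (IA 6) (bb lam) :=
  RA ((GV lam).comp YR) (fun Z Y => by
      show GV lam (YR Z) * GV lam (YR Y) - GV lam (YR Y) * GV lam (YR Z) = GV lam (YR _)
      rw [GV_br lam _ _ (τ_YR Z), YR_br]) (bb lam) (wX lam) (fun j i => by
      show GV lam (YR (E j j)) (bb lam i) = _
      rw [GV_diag]
      simp only [LinearMap.sum_apply, LinearMap.smul_apply, hwb, smul_smul, ← sum_smul, wX]
      congr 1; exact sum_congr rfl fun r _ => mul_comm _ _) (rhoA 5) (fun i => by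
    have h1 : dt (fun _ => 5) (wX lam i) = 0 := by
      simp only [dt, wX, ← mul_sum]
      rw [sum_comm]; simp only [← mul_sum, w0_tr]; simp
    have := congrArg (fun v => dt v (wX lam i)) sum_αA
    simp only [sub_dt, smul_dt, h1, sub_zero] at this
    rw [← this]
    simp only [dt, Finset.sum_apply, sum_mul]
    exact sum_comm)

theorem res_mono (w : Fin 10 → Fin 6 → ℚ) (v) : resChar (r := 5) w (mono v) = mono (∑ i, v i • w i) := by
  simp [resChar, mono, mapDomain_single]

def resH (w : Fin 10 → Fin 6 → ℚ) : CharRing 10 →+* CharRing 6 :=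
  mapDomainRingHom ℤ
    ({ toFun := fun v : Fin 10 → ℚ => ∑ i : Fin 10, v i • w i
       map_zero' := by simp
       map_add' := fun a b => by simp [add_smul, sum_add_distrib] } : (Fin 10 → ℚ) →+ (Fin 6 → ℚ))

theorem resH_eq (w : Fin 10 → Fin 6 → ℚ) (F) : resChar (r := 5) w F = resH w F := by
  simp only [resH, resChar, mapDomainRingHom_apply]; rfl

theorem res_chY (lam : Fin 10 → ℕ) : resH w0 (chY lam) = ∑ i, mono (wX lam i) := by
  rw [chY, map_sum]
  refine sum_congr rfl fun i _ => ?_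
  rw [← resH_eq, res_mono]; congr 1

theorem multX (lam : Fin 10 → ℕ) (ν : Fin 6 → ℚ) (h : StrictAnti (ν + rhoA 5)) :
    (resH w0 (chY lam) * altA 5 (rhoA 5)).coeff (ν + rhoA 5) = (finrank ℚ ((RX lam).hw ν) : ℤ) := by
  have h1 := (RX lam).mult _ (toQ_denA 5) (lapA 5 _) ν (by
      intro a; show 0 < dt (ν + rhoA 5) (αA a); exact (domA _).2 h a)
  have hch : toQ (resH w0 (chY lam)) = ∑ i, single (wX lam i) 1 := by
    rw [res_chY]; simp only [map_sum, toQ_mono]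
  rw [show (RX lam).ρ = rhoA 5 from rfl, show (RX lam).wt = wX lam from rfl, ← hch, ← map_mul, coeff_toQ, mul_comm] at h1
  exact_mod_cast h1

def Bad (lam : Fin 10 → ℕ) : Prop := ∃ ν, StrictAnti (ν + rhoA 5) ∧ 2 ≤ finrank ℚ ((RX lam).hw ν)

theorem bad_of (lam : Fin 10 → ℕ) (ν : Fin 6 → ℚ) (h : StrictAnti ν)
    (h2 : 2 ≤ (resH w0 (chY lam) * altA 5 (rhoA 5)).coeff ν) : Bad lam := by
  refine ⟨ν - rhoA 5, by rwa [sub_add_cancel], ?_⟩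
  have := multX lam (ν - rhoA 5) (by rwa [sub_add_cancel])
  rw [sub_add_cancel] at this; rw [this] at h2; exact_mod_cast h2

theorem GD_Yr_vl (i j : Fin 6) (hij : i < j) (mu : Fin 10 → ℕ) : GD (Yr i j) (vl mu) = 0 := by
  have h1 : ∀ x y : Bk 10, GD (Yr i j) x = 0 → GD (Yr i j) y = 0 → GD (Yr i j) (x * y) = 0 := by
    intro x y hx hy; rw [leibniz, hx, hy]; simp
  refine Finset.prod_induction _ (fun x => GD (Yr i j) x = 0) h1 (by simp) fun l _ => ?_
  rw [Derivation.leibniz_pow, GD_Yr_vk i j hij]; simp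

def shX (mu : Fin 10 → ℕ) : Fin 6 → ℚ := fun i => ∑ r, w0 r i * epsWt .C 10 mu r

theorem GD_diag_vl (i : Fin 6) (mu : Fin 10 → ℕ) : GD (Yr i i) (vl mu) = shX mu i • vl mu := by
  have : GDx (vl mu) (Yr i i) = shX mu i • vl mu := by
    rw [Yr_diag, map_sum, shX, sum_smul]
    refine sum_congr rfl fun r _ => ?_
    rw [map_smul, show GDx (vl mu) (hY r r) = _ from GD_h_vl mu r, smul_smul]
  exact this

def pz (l i : ℕ) : ℤ := ((range (l+1)).map fun r => mZ i i r r).sum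
theorem pz_ok : ∀ l < 10, ∀ i < 6, ∀ j < 6, i ≤ j → pz l j ≤ pz l i := by decide +kernel

theorem shX_eq (mu : Fin 10 → ℕ) (i : Fin 6) : shX mu i = ∑ l : Fin 10, (mu l : ℚ) * ((pz l i : ℚ) - ((l : ℕ) + 1) / 2) := by
  have h1 : ∀ l : Fin 10, ((pz l i : ℚ) - ((l : ℕ) + 1) / 2) = ∑ r : Fin 10, if (r : ℕ) ≤ l then w0 r i else 0 := by
    intro l
    simp only [w0]; revert l i; decide +kernel
  simp only [h1, shX, epsWt, sub_zero, mul_sum, sum_filter]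
  rw [sum_comm]
  refine sum_congr rfl fun r _ => sum_congr rfl fun l _ => ?_
  split_ifs <;> ring

theorem shX_anti (mu : Fin 10 → ℕ) : Antitone (shX mu) := by
  intro i j h
  rw [shX_eq, shX_eq]
  refine Finset.sum_le_sum fun l _ => ?_
  have : (pz l j : ℚ) ≤ pz l i := by exact_mod_cast pz_ok l l.2 i i.2 j j.2 h
  have h0 : (0:ℚ) ≤ mu l := by positivity
  nlinarith

def mulv (lam mu : Fin 10 → ℕ) : Mo lam →ₗ[ℚ] Mo (lam + mu) where
  toFun x := ⟨x.1 * vl mu, Mo_mul x.2 (vl_mem mu)⟩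
  map_add' x y := Subtype.ext (by simp [add_mul])
  map_smul' c x := Subtype.ext (by simp)

theorem Bad_add (lam mu : Fin 10 → ℕ) (h : Bad lam) : Bad (lam + mu) := by
  obtain ⟨ν, h1, h2⟩ := h
  refine ⟨ν + shX mu, ?_, ?_⟩
  · intro i j hij
    have a := h1 hij
    have b := shX_anti mu hij.le
    simp only [Pi.add_apply] at *
    linarith
  · have hinj : Injective (mulv lam mu) := by
      intro x y hxy
      exact Subtype.ext (mul_right_cancel₀ (vl_ne mu) (congrArg Subtype.val hxy))
    have hle : ((RX lam).hw ν).map (mulv lam mu) ≤ (RX (lam + mu)).hw (ν + shX mu) := by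
      rintro _ ⟨x, ⟨hx1, hx2⟩, rfl⟩
      refine ⟨fun j => Subtype.ext ?_, fun a => Subtype.ext ?_⟩
      · have e1 : GD (YR (E j j)) (x : Bk 10) = ν j • (x : Bk 10) := congrArg Subtype.val (hx1 j)
        show GD (YR (E j j)) ((x : Bk 10) * vl mu) = (ν j + shX mu j) • ((x : Bk 10) * vl mu)
        rw [leibniz, e1, YR_E, GD_diag_vl, add_smul]
        simp only [smul_eq_mul, Algebra.smul_def]; ring
      · have e1 : GD (YR (E a.1.1 a.1.2)) (x : Bk 10) = 0 := congrArg Subtype.val (hx2 a)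
        show GD (YR (E a.1.1 a.1.2)) ((x : Bk 10) * vl mu) = 0
        rw [leibniz, e1, YR_E, GD_Yr_vl _ _ a.2]; simp
    calc 2 ≤ _ := h2
      _ = finrank ℚ (((RX lam).hw ν).map (mulv lam mu)) := (LinearEquiv.finrank_eq (Submodule.equivMapOfInjective _ hinj _))
      _ ≤ _ := Submodule.finrank_mono hle

theorem Bad_mono {lam mu : Fin 10 → ℕ} (h : lam ≤ mu) (hb : Bad lam) : Bad mu := by
  have : mu = lam + (mu - lam) := by funext i; have h' : lam i ≤ mu i := h i; simp only [Pi.add_apply, Pi.sub_apply]; omega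
  rw [this]; exact Bad_add _ _ hb

theorem sl_anti (d : Fin 5 → ℕ) : StrictAnti (slWt 5 d + rhoA 5) := by
  intro i j hij
  have h1 : partLift 5 d j ≤ partLift 5 d i := by
    refine Finset.sum_le_sum_of_subset_of_nonneg ?_ (fun _ _ _ => by positivity)
    intro x; simp only [mem_filter, mem_univ, true_and]; exact fun hx => le_trans hij.le hx
  have h2 := rhoA_anti 5 hij
  simp only [Pi.add_apply, slWt]; linarith

theorem sl_inj {d d' : Fin 5 → ℕ} (h : slWt 5 d + rhoA 5 = slWt 5 d' + rhoA 5) : d = d' := by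
  have h := add_right_cancel h
  have h0 : ∀ (d : Fin 5 → ℕ) (i : Fin 5), slWt 5 d i.castSucc - slWt 5 d i.succ = d i := by
    intro d i
    simp only [slWt, partLift]
    rw [sub_sub_sub_cancel_right]
    simp only [sum_filter, Fin.sum_univ_five]
    fin_cases i <;> simp
  funext i
  have := h0 d i
  rw [h, h0 d' i] at this
  have this := this.symm
  exact_mod_cast this

theorem Bad_not (hw0 : WtSys .C 10 5 (MFPaper.e 5 3) w0) (lam : Fin 10 → ℕ) (hb : Bad lam) : ¬ IsMFRes .C 10 5 (MFPaper.e 5 3) lam := by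
  intro hmf
  obtain ⟨c, h1, h2⟩ := hmf w0 hw0 (chY lam) (chY_isChar lam)
  obtain ⟨ν, h3, h4⟩ := hb
  have h5 := multX lam ν h3
  rw [← resH_eq, h1, Finsupp.sum, coeff_sum, coe_finsetSum, Finset.sum_apply] at h5
  have h6 : ∀ μ ∈ c.support, ((c μ : ℤ) • altA 5 (slWt 5 μ + rhoA 5)).coeff (ν + rhoA 5) = if slWt 5 μ + rhoA 5 = ν + rhoA 5 then (c μ : ℤ) else 0 := by
    intro μ _
    have := altA_coeff 5 _ _ (sl_anti μ) h3
    generalize altA 5 (slWt 5 μ + rhoA 5) = Z at *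
    rw [coeff_smul, Finsupp.smul_apply, this, smul_eq_mul, mul_ite, mul_one, mul_zero]
  rw [sum_congr rfl h6] at h5
  have h7 : (∑ μ ∈ c.support, if slWt 5 μ + rhoA 5 = ν + rhoA 5 then (c μ : ℤ) else 0) ≤ 1 := by
    by_cases hh : ∃ μ, slWt 5 μ + rhoA 5 = ν + rhoA 5
    · obtain ⟨μ, hμ⟩ := hh
      rw [← hμ]
      calc _ = ∑ x ∈ c.support, if x = μ then (c x : ℤ) else 0 := sum_congr rfl fun x _ => by
            congr 1; exact propext ⟨sl_inj, fun h => by rw [h]⟩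
        _ ≤ 1 := by
          rw [Finset.sum_ite_eq']
          split_ifs
          · exact_mod_cast h2 μ
          · norm_num
    · push Not at hh
      simp [hh]
  have : (2:ℤ) ≤ finrank ℚ ((RX lam).hw ν) := by exact_mod_cast h4
  omega

section
abbrev LL := List (ℤ × List ℕ)

section gen
variable {R : Type} [AddCommGroup R] (Φ : List ℕ → R)

def ev (L : LL) : R := (L.map fun p => p.1 • Φ p.2).sum
theorem ev_nil : ev Φ [] = 0 := rfl
theorem ev_cons (p : ℤ × List ℕ) (L : LL) : ev Φ (p :: L) = p.1 • Φ p.2 + ev Φ L := by simp [ev]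
theorem ev_app (L M : LL) : ev Φ (L ++ M) = ev Φ L + ev Φ M := by simp [ev]
theorem ev_flat {α : Type} (K : List α) (f : α → LL) : ev Φ (K.flatMap f) = (K.map fun x => ev Φ (f x)).sum := by
  induction K with
  | nil => rfl
  | cons a K ih => rw [List.flatMap_cons, ev_app, ih]; simp

structure AltF : Prop where
  sw : ∀ p a b s, Φ (p ++ a :: b :: s) = - Φ (p ++ b :: a :: s)
  eq : ∀ p a s, Φ (p ++ a :: a :: s) = 0

def ins (x : ℕ) : List ℕ → Option (Bool × List ℕ)
  | [] => some (false, [x])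
  | y :: l => match Nat.blt y x with
    | true => some (false, x :: y :: l)
    | false => match Nat.beq x y with
      | true => none
      | false => match ins x l with
        | none => none
        | some (s, l') => some (!s, y :: l')

def srt : List ℕ → Option (Bool × List ℕ)
  | [] => some (false, [])
  | x :: l => match srt l with
    | none => none
    | some (s, l') => match ins x l' with
      | none => none
      | some (s', l'') => some (xor s s', l'')

def vO (p : List ℕ) : Option (Bool × List ℕ) → R
  | none => 0
  | some (s, l) => (if s then (-1 : ℤ) else 1) • Φ (p ++ l)

variable {Φ}
theorem ins_ok (h : AltF Φ) (x : ℕ) (l : List ℕ) (p : List ℕ) : vO Φ p (ins x l) = Φ (p ++ x :: l) := by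
  induction l generalizing p with
  | nil => simp [ins, vO]
  | cons y l ih =>
    rw [ins]
    split
    · simp [vO]
    · split
      · rename_i h2
        have := eq_of_beq_eq_true h2; subst this
        rw [h.eq]; rfl
      · have := ih (p ++ [y])
        rw [h.sw]
        rw [List.append_assoc] at this
        change _ = Φ (p ++ (y :: x :: l)) at this
        rw [← this]
        rcases ins x l with _ | ⟨s, l'⟩
        · simp [vO]
        · cases s <;> simp [vO]

theorem srt_ok (h : AltF Φ) (l : List ℕ) (p : List ℕ) : vO Φ p (srt l) = Φ (p ++ l) := by
  induction l generalizing p with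
  | nil => simp [srt, vO]
  | cons x l ih =>
    have h1 := ih (p ++ [x])
    rw [List.append_assoc] at h1
    change _ = Φ (p ++ (x :: l)) at h1
    rw [srt, ← h1]
    rcases srt l with _ | ⟨s, l'⟩
    · simp [vO]
    · have h2 := ins_ok h x l' p
      have h3 : vO Φ (p ++ [x]) (some (s, l')) = (if s then (-1 : ℤ) else 1) • vO Φ p (ins x l') := by
        rw [h2]; simp [vO]
      rw [h3]; clear h2 h3
      dsimp only
      rcases ins x l' with _ | ⟨s', l''⟩
      · simp [vO]
      · cases s <;> cases s' <;> simp [vO]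

def lcK {α : Type} (lt eq gt : α) (l : List ℕ) : List ℕ → α :=
  @List.rec ℕ (fun _ => List ℕ → α) (fun m => @List.rec ℕ (fun _ => α) eq (fun _ _ _ => lt) m)
    (fun a _ ih m => @List.rec ℕ (fun _ => α) gt (fun b m' _ =>
      @Bool.rec (fun _ => α) (@Bool.rec (fun _ => α) gt lt (Nat.ble a b)) (ih m') (Nat.beq a b)) m) l
def lc (l m : List ℕ) : ℕ := lcK 0 1 2 l m

theorem lcK_cons {α : Type} (lt eq gt : α) (a b l m) : lcK lt eq gt (a :: l) (b :: m) =
    if a < b then lt else if b < a then gt else lcK lt eq gt l m := by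
  show @Bool.rec (fun _ => α) (@Bool.rec (fun _ => α) gt lt (Nat.ble a b)) (lcK lt eq gt l m) (Nat.beq a b) = _
  rcases lt_trichotomy a b with h | h | h
  · rw [if_pos h, show Nat.beq a b = false from eq_false_iff.2 fun h' => h.ne (eq_of_beq_eq_true h'), show Nat.ble a b = true from Nat.ble_eq_true_of_le h.le]
  · subst h; simp
  · rw [if_neg h.not_gt, if_pos h, show Nat.beq a b = false from eq_false_iff.2 fun h' => h.ne' (eq_of_beq_eq_true h'),
      show Nat.ble a b = false from eq_false_iff.2 fun h' => absurd (Nat.le_of_ble_eq_true h') (by omega)]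

theorem lcK_spec {α : Type} (lt eq gt : α) : ∀ l m, (lc l m = 0 ∧ lcK lt eq gt l m = lt) ∨ (lc l m = 2 ∧ lcK lt eq gt l m = gt) ∨
    (l = m ∧ lc l m = 1 ∧ lcK lt eq gt l m = eq)
  | [], [] => .inr (.inr ⟨rfl, rfl, rfl⟩)
  | [], _ :: _ => .inl ⟨rfl, rfl⟩
  | _ :: _, [] => .inr (.inl ⟨rfl, rfl⟩)
  | a :: l, b :: m => by
    have := lcK_spec lt eq gt l m
    rw [lc, lcK_cons, lcK_cons]
    split_ifs with h1 h2
    · simp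
    · simp
    · rw [show a = b by omega]; simpa [lc] using this

theorem lc_eq (l m) (h : lc l m = 1) : l = m := by
  rcases lcK_spec 0 0 0 l m with h1 | h1 | h1
  · omega
  · omega
  · exact h1.1

def add0 (z : ℤ) (l : List ℕ) (r : LL) : LL :=
  @Int.rec (fun _ => LL) (fun n => @Nat.rec (fun _ => LL) r (fun k _ => (.ofNat (Nat.succ k), l) :: r) n) (fun n => (.negSucc n, l) :: r) z
theorem add0_ok (z : ℤ) (l : List ℕ) (r : LL) : ev Φ (add0 z l r) = z • Φ l + ev Φ r := by
  rcases z with (_ | n) | n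
  · show ev Φ r = (0 : ℤ) • Φ l + ev Φ r
    simp
  · exact ev_cons Φ _ _
  · exact ev_cons Φ _ _
def mg (n : ℕ) : LL → LL → LL :=
  @Nat.rec (fun _ => LL → LL → LL) (fun a b => a ++ b) (fun _ ih a b =>
    @List.rec (ℤ × List ℕ) (fun _ => LL) b (fun p a' _ =>
      @List.rec (ℤ × List ℕ) (fun _ => LL) a (fun q b' _ =>
        lcK (p :: ih a' b) (add0 (Int.add p.1 q.1) p.2 (ih a' b')) (q :: ih a b') p.2 q.2) b) a) n

theorem mg_ok (n : ℕ) (a b : LL) : ev Φ (mg n a b) = ev Φ a + ev Φ b := by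
  induction n generalizing a b with
  | zero => exact ev_app Φ a b
  | succ n ih =>
    rcases a with _ | ⟨p, a⟩
    · show ev Φ b = _
      simp [ev_nil]
    · rcases b with _ | ⟨q, b⟩
      · show ev Φ (p :: a) = _
        simp [ev_nil]
      · show ev Φ (lcK (p :: mg n a (q :: b)) (add0 (Int.add p.1 q.1) p.2 (mg n a b)) (q :: mg n (p :: a) b) p.2 q.2) = _
        rcases lcK_spec (p :: mg n a (q :: b)) (add0 (Int.add p.1 q.1) p.2 (mg n a b)) (q :: mg n (p :: a) b) p.2 q.2 with h | h | h
        · rw [h.2, ev_cons, ih]; simp only [ev_cons]; abel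
        · rw [h.2, ev_cons, ih]; simp only [ev_cons]; abel
        · rw [h.2.2, add0_ok, ih]; simp only [ev_cons, ← h.1]
          rw [show Int.add p.1 q.1 = p.1 + q.1 from rfl, add_smul]; abel

def sp (L : LL) : LL × LL := @List.rec (ℤ × List ℕ) (fun _ => LL × LL) ([],[]) (fun x _ r => (x :: r.2, r.1)) L

theorem sp_ok (L : LL) : ev Φ (sp L).1 + ev Φ (sp L).2 = ev Φ L := by
  induction L with
  | nil => simp [sp, ev_nil]
  | cons x l ih =>
    show ev Φ (x :: (sp l).2) + ev Φ (sp l).1 = _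
    simp only [ev_cons, ← ih]; abel

def ms (n : ℕ) : LL → LL :=
  @Nat.rec (fun _ => LL → LL) (fun L => L) (fun _ ih L =>
    @List.rec (ℤ × List ℕ) (fun _ => LL) [] (fun x L' _ => @List.rec (ℤ × List ℕ) (fun _ => LL) [x] (fun _ _ _ =>
       @Prod.rec LL LL (fun _ => LL) (fun a b => mg 100000 (ih a) (ih b)) (sp L)) L') L) n

theorem ms_ok (n : ℕ) (L : LL) : ev Φ (ms n L) = ev Φ L := by
  induction n generalizing L with
  | zero => rfl
  | succ n ih =>
    rcases L with _ | ⟨x, _ | ⟨y, L⟩⟩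
    · rfl
    · rfl
    · show ev Φ (mg 100000 (ms n (sp (x :: y :: L)).1) (ms n (sp (x :: y :: L)).2)) = _
      rw [mg_ok, ih, ih, sp_ok]

def ng (s : Bool) (c : ℤ) : ℤ := match s with
  | true => -c
  | false => c

def pre (nf : List ℕ → List ℕ) : LL → LL
  | [] => []
  | (c, l) :: L => match srt l with
    | none => pre nf L
    | some (s, l') => (ng s c, nf l') :: pre nf L

theorem pre_ok (h : AltF Φ) (nf : List ℕ → List ℕ) (hn : ∀ l, Φ (nf l) = Φ l) (L : LL) : ev Φ (pre nf L) = ev Φ L := by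
  induction L with
  | nil => rfl
  | cons x L ih =>
    rcases x with ⟨c, l⟩
    have h1 := srt_ok h l []
    rw [List.nil_append] at h1
    rw [pre, ev_cons, ← h1]
    rcases srt l with _ | ⟨s, l'⟩
    · simp [vO, ih]
    · cases s <;> simp [vO, ih, ev_cons, ng, hn]

def nrm (nf : List ℕ → List ℕ) (L : LL) : LL := ms 20 (pre nf L)
theorem nrm_ok (h : AltF Φ) (nf : List ℕ → List ℕ) (hn : ∀ l, Φ (nf l) = Φ l) (L : LL) : ev Φ (nrm nf L) = ev Φ L := by
  rw [nrm, ms_ok, pre_ok h nf hn]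

def sc (k : ℤ) (L : LL) : LL := L.map fun p => (k * p.1, p.2)
theorem sc_ok (k : ℤ) (L : LL) : ev Φ (sc k L) = k • ev Φ L := by
  induction L with
  | nil => simp [sc, ev_nil]
  | cons x L ih =>
    have : sc k (x :: L) = (k * x.1, x.2) :: sc k L := rfl
    rw [this, ev_cons, ev_cons, ih, smul_add, mul_smul]
end gen

theorem getD_sw (p : List ℕ) (a b : ℕ) (s : List ℕ) (i : ℕ) :
    (p ++ b :: a :: s).getD i 0 = (p ++ a :: b :: s).getD (if i = p.length then p.length + 1 else if i = p.length + 1 then p.length else i) 0 := by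
  induction p generalizing i with
  | nil => rcases i with _ | _ | i <;> simp
  | cons x p ih =>
    rcases i with _ | i
    · simp
    · have := ih i
      simp only [List.cons_append, List.getD_cons_succ, length_cons, this, add_left_inj]
      split_ifs <;> simp

theorem getD_sw' {n : ℕ} (p : List ℕ) (a b : ℕ) (s : List ℕ) (h : (p ++ a :: b :: s).length = n) :
    ∃ k k' : Fin n, k ≠ k' ∧ (∀ i : Fin n, (p ++ b :: a :: s).getD i 0 = (p ++ a :: b :: s).getD (swap k k' i) 0) ∧
      (p ++ a :: b :: s).getD k 0 = a ∧ (p ++ a :: b :: s).getD k' 0 = b := by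
  simp only [List.length_append, length_cons] at h
  refine ⟨⟨p.length, by omega⟩, ⟨p.length + 1, by omega⟩, by simp, fun i => ?_, by simp, ?_⟩
  · rw [getD_sw, swap_apply_def]
    simp only [ext_iff]
    split_ifs <;> rfl
  · simp [List.getD_append_right]

def θ (l : List ℕ) (i : Fin 6) : ℚ := (l.getD i 0 : ℕ) - (l.sum : ℕ) / 6 + 5 / 2
def ΦX (l : List ℕ) : CharRing 6 := if l.length = 6 then altA 5 (θ l) else 0
def yv (l : List ℕ) (i : Fin 10) : ℚ := (l.getD i 0 : ℕ)
def ΦY (l : List ℕ) : CharRing 10 := if l.length = 10 then altY .C 10 (yv l) else 0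

theorem altX : AltF ΦX where
  sw p a b s := by
    have e1 : (p ++ b :: a :: s).length = (p ++ a :: b :: s).length := by simp
    simp only [ΦX, e1]
    split_ifs with h
    · obtain ⟨k, k', h1, h2, -⟩ := getD_sw' p a b s h
      have : θ (p ++ b :: a :: s) = fun i => θ (p ++ a :: b :: s) (swap k k' i) := by
        funext i
        have hs : (p ++ b :: a :: s).sum = (p ++ a :: b :: s).sum := by simp; omega
        simp only [θ, h2, hs]
      rw [this, altA_perm, Perm.sign_swap h1]; simp
    · simp
  eq p a s := by
    simp only [ΦX]
    split_ifs with h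
    · obtain ⟨k, k', h1, h2, h3, h4⟩ := getD_sw' p a a s h
      exact altA_rep _ _ k k' h1 (by simp only [θ, h3, h4])
    · rfl

theorem altYl : AltF ΦY where
  sw p a b s := by
    have e1 : (p ++ b :: a :: s).length = (p ++ a :: b :: s).length := by simp
    simp only [ΦY, e1]
    split_ifs with h
    · obtain ⟨k, k', h1, h2, -⟩ := getD_sw' p a b s h
      have : yv (p ++ b :: a :: s) = fun i => yv (p ++ a :: b :: s) (swap k k' i) := by
        funext i
        simp only [yv, h2]
      rw [this, altY_perm, Perm.sign_swap h1]; simp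
    · simp
  eq p a s := by
    simp only [ΦY]
    split_ifs with h
    · obtain ⟨k, k', h1, h2, h3, h4⟩ := getD_sw' p a a s h
      exact altY_rep _ _ k k' h1 (by simp only [yv, h3, h4])
    · rfl

def nX (l : List ℕ) : List ℕ := match l with
  | [a,b,c,d,e,f] => match f with
    | 0 => l
    | _ => match Nat.ble f e && Nat.ble f d && Nat.ble f c && Nat.ble f b && Nat.ble f a with
       | true => [Nat.sub a f, Nat.sub b f, Nat.sub c f, Nat.sub d f, Nat.sub e f, 0]
       | false => l
  | _ => l

theorem θ_add (l : List ℕ) (m : ℕ) (h : l.length = 6) : θ (l.map (· + m)) = θ l := by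
  have hs : ∀ l : List ℕ, (l.map (· + m)).sum = l.sum + l.length * m := by
    intro l; induction l with
    | nil => simp
    | cons a l ih => simp only [map_cons, sum_cons, ih, length_cons]; ring
  funext i
  simp only [θ]
  rw [hs, h]
  have : (l.map (· + m)).getD i 0 = l.getD i 0 + m := by
    have hi : (i : ℕ) < l.length := by rw [h]; exact i.2
    rw [List.getD_eq_getElem _ _ (by simpa using hi), List.getD_eq_getElem _ _ hi]; simp
  rw [this]; push_cast; ring

theorem nX_ok (l : List ℕ) : ΦX (nX l) = ΦX l := by
  unfold nX
  split
  · split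
    · rfl
    · split
      · rename_i h
        simp only [and_eq_true, Nat.ble_eq] at h
        rw [ΦX, ΦX, if_pos (by simp), if_pos (by simp)]
        rename_i a b c d e f _ _ _
        rw [← θ_add _ f rfl]
        congr 2
        simp only [map_cons, List.map_nil, Nat.sub_eq]
        obtain ⟨⟨⟨⟨h1, h2⟩, h3⟩, h4⟩, h5⟩ := h
        rw [Nat.sub_add_cancel h1, Nat.sub_add_cancel h2, Nat.sub_add_cancel h3, Nat.sub_add_cancel h4, Nat.sub_add_cancel h5, Nat.zero_add]
      · rfl
  · rfl
end

def msk : ℕ → ℕ → List (List Bool)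
  | 0, 0 => [[]]
  | 0, _ + 1 => []
  | n + 1, 0 => (msk n 0).map (false :: ·)
  | n + 1, k + 1 => (msk n k).map (true :: ·) ++ (msk n (k + 1)).map (false :: ·)

def addm (m : ℕ) : List Bool → List ℕ → List ℕ
  | s :: S, x :: l => (match s with
    | true => Nat.add x m
    | false => x) :: addm m S l
  | [], l => l
  | _ :: _, [] => []

def tof (s : List Bool) (i : Fin 6) : Bool := s.getD i false
def S6 : Finset (Fin 6 → Bool) := univ.filter fun s => (univ.filter fun i => s i = true).card = 3
def gS (m : ℚ) (s : Fin 6 → Bool) (i : Fin 6) : ℚ := m * if s i then 1/2 else -1/2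

theorem S6_eq : S6 = ((msk 6 3).map tof).toFinset := by decide +kernel
theorem S6_nd : ((msk 6 3).map tof).Nodup := by decide +kernel
theorem S6_sum {R : Type} [AddCommMonoid R] (F : (Fin 6 → Bool) → R) : ∑ s : S6, F s = ((msk 6 3).map fun s => F (tof s)).sum := by
  rw [Finset.sum_coe_sort S6 F, S6_eq, List.sum_toFinset _ S6_nd, map_map]; rfl

theorem gS_inv (m : ℚ) : ∀ σ : Perm (Fin 6), ∃ π : Perm S6, ∀ s i, gS m (π s) i = gS m s (σ i) := by
  intro σ
  have h : ∀ (σ : Perm (Fin 6)) (s : Fin 6 → Bool), s ∈ S6 → s ∘ σ ∈ S6 := by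
    intro σ s hs
    simp only [S6, mem_filter, mem_univ, true_and] at hs ⊢
    rw [← hs]
    exact Finset.card_equiv σ (by simp)
  refine ⟨⟨fun s => ⟨s.1 ∘ σ, h σ _ s.2⟩, fun s => ⟨s.1 ∘ σ.symm, h σ.symm _ s.2⟩, fun s => ?_, fun s => ?_⟩, fun s i => rfl⟩
  · ext i; simp
  · ext i; simp

theorem addm_spec (m : ℕ) : ∀ (s : List Bool) (l : List ℕ), s.length = l.length → (addm m s l).length = l.length ∧
    (addm m s l).sum = l.sum + m * s.count true ∧ ∀ i, (addm m s l).getD i 0 = l.getD i 0 + if s.getD i false then m else 0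
  | [], [], _ => by simp [addm]
  | s :: S, x :: l, h => by
    obtain ⟨h1, h2, h3⟩ := addm_spec m S l (by simpa using h)
    refine ⟨by simp [addm, h1], ?_, ?_⟩
    · cases s <;> simp [addm, h2] <;> ring
    · intro i
      rcases i with _ | i
      · cases s <;> simp [addm]
      · simpa [addm] using h3 i
  | [], _ :: _, h => by simp at h
  | _ :: _, [], h => by simp at h

theorem msk_spec : ∀ s ∈ msk 6 3, s.length = 6 ∧ s.count true = 3 := by decide +kernel

theorem θ_addm (m : ℕ) (s : List Bool) (hs : s ∈ msk 6 3) (l : List ℕ) (hl : l.length = 6) :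
    θ (addm m s l) = θ l + gS m (tof s) := by
  obtain ⟨h1, h2⟩ := msk_spec s hs
  obtain ⟨h3, h4, h5⟩ := addm_spec m s l (by omega)
  funext i
  simp only [θ, h4, h5, h2, Pi.add_apply, gS, tof]
  split_ifs with hh <;> simp only [hh, if_true, if_false] <;> push_cast <;> ring

def mvX (m : ℕ) (L : LL) : LL := L.flatMap fun p => (msk 6 3).map fun s => (p.1, addm m s p.2)

def PX (m : ℚ) : CharRing 6 := ∑ s : S6, mono (gS m s)

theorem mvX1 (m : ℕ) (l : List ℕ) : PX m * ΦX l = ((msk 6 3).map fun s => ΦX (addm m s l)).sum := by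
  by_cases hl : l.length = 6
  · rw [ΦX, if_pos hl, PX, sum_mul_altA 5 (fun s : S6 => gS m s) (gS_inv m), S6_sum (fun s => altA 5 (θ l + gS m s))]
    congr 1
    refine map_congr_left fun s hs => ?_
    rw [ΦX, if_pos ((addm_spec m s l (by rw [(msk_spec s hs).1, hl])).1.trans hl), θ_addm m s hs l hl]
  · rw [ΦX, if_neg hl, mul_zero]
    symm
    refine List.sum_eq_zero fun x hx => ?_
    obtain ⟨s, hs, rfl⟩ := mem_map.1 hx
    rw [ΦX, if_neg]
    have : ∀ (s : List Bool) (l : List ℕ), (addm m s l).length = l.length := by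
      intro s l
      induction s generalizing l with
      | nil => simp [addm]
      | cons a s ih => cases l <;> simp [addm, ih]
    rwa [this]

theorem mvX_ok (m : ℕ) (L : LL) : ev ΦX (mvX m L) = PX m * ev ΦX L := by
  induction L with
  | nil => simp [mvX, ev_nil]
  | cons p L ih =>
    have h : mvX m (p :: L) = ((msk 6 3).map fun s => (p.1, addm m s p.2)) ++ mvX m L := by simp [mvX]
    rw [h, ev_app, ih, ev_cons, mul_add, mul_smul_comm, mvX1]
    congr 1
    rw [ev, map_map, List.smul_sum, map_map]; rfl

theorem θ_rho : θ [5,4,3,2,1,0] = rhoA 5 := by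
  funext i; simp only [θ, rhoA]; revert i; decide +kernel
theorem ΦX_rho : ΦX [5,4,3,2,1,0] = altA 5 (rhoA 5) := by rw [← θ_rho]; exact if_pos rfl

theorem sl3 : θ [6,5,4,2,1,0] = slWt 5 (MFPaper.e 5 3) + rhoA 5 := by
  funext i; simp only [θ, rhoA, slWt, partLift, MFPaper.e, Pi.add_apply]; revert i; decide +kernel

theorem PX1 : PX 1 * altA 5 (rhoA 5) = altA 5 (slWt 5 (MFPaper.e 5 3) + rhoA 5) := by
  have h := mvX_ok 1 [(1,[5,4,3,2,1,0])]
  rw [← nrm_ok altX nX nX_ok, show nrm nX (mvX 1 [(1,[5,4,3,2,1,0])]) = [(1,[6,5,4,2,1,0])] by decide +kernel] at h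
  simp only [ev_cons, ev_nil, one_smul, add_zero, ΦX_rho, Nat.cast_one] at h
  rw [← h, ← sl3]; exact if_pos rfl

theorem denX_ne : altA 5 (rhoA 5) ≠ 0 := by
  intro h
  have := altA_coeff 5 _ _ (rhoA_anti 5) (rhoA_anti 5)
  rw [h] at this; simp at this

abbrev WS (w) := WtSys .C 10 5 (MFPaper.e 5 3) w

theorem ws_iff (w) : WS w ↔ ∑ i : Fin 10, (mono (w i) + mono (-(w i))) = PX 1 := by
  unfold WS WtSys
  rw [← PX1]
  simp only [reduceCtorEq, if_false, add_zero]
  exact ⟨fun h => mul_right_cancel₀ denX_ne h, fun h => by rw [h]⟩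

theorem ws0 : WS w0 := by
  rw [ws_iff, PX, S6_sum (fun s => mono (gS 1 s))]
  have h1 : (univ : Finset (Fin 10)).val.map w0 + (univ : Finset (Fin 10)).val.map (fun i => - w0 i) =
      ((msk 6 3).map fun s => gS 1 (tof s) : Multiset (Fin 6 → ℚ)) := by
    unfold w0
    decide +kernel
  have h2 := congrArg (fun M => (M.map (mono (k := 6))).sum) h1
  simp only [Multiset.map_add, Multiset.sum_add, Multiset.map_map, Multiset.map_coe, Multiset.sum_coe, map_map] at h2
  rw [sum_add_distrib]
  exact h2

theorem pw_mono (m : ℕ) (v : Fin 6 → ℚ) : pw m (mono v) = mono ((m : ℚ) • v) := by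
  simp [pw, mono, mapDomain_single]

theorem pw_sum {ι : Type} (m : ℕ) (s : Finset ι) (F : ι → CharRing 6) : pw m (∑ i ∈ s, F i) = ∑ i ∈ s, pw m (F i) := by
  classical
  have ha : ∀ a b : CharRing 6, pw m (a + b) = pw m a + pw m b := fun a b => AddMonoidAlgebra.mapDomain_add ..
  have h0 : pw m (0 : CharRing 6) = 0 := AddMonoidAlgebra.mapDomain_zero ..
  induction s using induction_on with
  | empty => simpa using h0
  | insert a s h ih => rw [sum_insert h, sum_insert h, ha, ih]

theorem res_ps (w) (hw : WS w) (m : ℕ) : resH w (psY 10 m) = PX m := by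
  have h1 := congrArg (pw m) ((ws_iff w).1 hw)
  rw [PX, pw_sum, pw_sum] at h1
  have h2 : ∀ i : Fin 10, resH w (xp i m + xp i (-m)) = pw m (mono (w i) + mono (-(w i))) := by
    intro i
    have ha : ∀ a b : CharRing 6, pw m (a + b) = pw m a + pw m b := fun a b => AddMonoidAlgebra.mapDomain_add ..
    rw [ha, pw_mono, pw_mono, map_add, xp, xp, ← resH_eq, ← resH_eq, res_mono, res_mono]
    congr 2
    · rw [sum_eq_single i] <;> simp +contextual [Pi.single_apply]
    · rw [sum_eq_single i] <;> simp +contextual [Pi.single_apply]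
  rw [psY, map_sum, sum_congr rfl fun i _ => h2 i, h1, PX]
  refine sum_congr rfl fun s _ => ?_
  rw [pw_mono]; congr 1; funext i; simp [gS]

def mvY1 (m : ℕ) (l : List ℕ) (j : ℕ) : LL :=
  match l.getD j 0 with
  | x => (1, l.set j (Nat.add x m)) :: match Nat.blt m x with
    | true => [(1, l.set j (Nat.sub x m))]
    | false => match Nat.blt x m with
      | true => [(-1, l.set j (Nat.sub m x))]
      | false => []
def mvY (m : ℕ) (L : LL) : LL := L.flatMap fun p => sc p.1 ((range 10).flatMap (mvY1 m p.2))

theorem yv_set (l : List ℕ) (hl : l.length = 10) (j : Fin 10) (x : ℕ) : yv (l.set j x) = update (yv l) j (x : ℚ) := by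
  funext i
  have hi : (i : ℕ) < l.length := by rw [hl]; exact i.2
  simp only [yv, Function.update_apply]
  rw [List.getD_eq_getElem _ _ (by simpa using hi), List.getD_eq_getElem _ _ hi, List.getElem_set]
  simp only [ext_iff, eq_comm]
  split_ifs <;> rfl

theorem mvY1_ok (m : ℕ) (l : List ℕ) (hl : l.length = 10) (j : Fin 10) :
    ev ΦY (mvY1 m l j) = altY .C 10 (update (yv l) j (yv l j + m)) + altY .C 10 (update (yv l) j (yv l j - m)) := by
  have hΦ : ∀ x, ΦY (l.set j x) = altY .C 10 (update (yv l) j (x : ℚ)) := by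
    intro x; rw [ΦY, if_pos (by simpa using hl), yv_set l hl]
  have hx : yv l j = (l.getD j 0 : ℕ) := rfl
  simp only [mvY1, Nat.add_eq, Nat.sub_eq]
  rw [hx]
  generalize l.getD j 0 = x
  rw [ev_cons, hΦ, one_smul]
  push_cast
  congr 1
  split
  · rename_i h
    have h : m < x := by simpa [blt_eq] using h
    rw [ev_cons, ev_nil, hΦ, one_smul, add_zero, cast_sub h.le]
  · rename_i h0
    have h0 : ¬ m < x := by simpa [blt_eq] using (eq_false_iff.1 h0)
    split
    · rename_i h
      have h : x < m := by simpa [blt_eq] using h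
      rw [ev_cons, ev_nil, hΦ, add_zero, cast_sub h.le]
      have := altY_neg 10 (update (yv l) j ((m : ℚ) - x)) j
      simp only [Function.update_self, Function.update_idem, neg_sub] at this
      rw [this]; simp
    · rename_i h1
      have h1 : ¬ x < m := by simpa [blt_eq] using (eq_false_iff.1 h1)
      have : x = m := by omega
      subst this
      rw [ev_nil, altY_zero _ _ j (by simp)]

theorem mvY_ok (m : ℕ) (L : LL) : ev ΦY (mvY m L) = psY 10 m * ev ΦY L := by
  induction L with
  | nil => simp [mvY, ev_nil]
  | cons p L ih =>
    have h : mvY m (p :: L) = sc p.1 ((range 10).flatMap (mvY1 m p.2)) ++ mvY m L := by simp [mvY]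
    rw [h, ev_app, ih, ev_cons, mul_add, mul_smul_comm, sc_ok, ev_flat]
    congr 2
    by_cases hl : p.2.length = 10
    · rw [ΦY, if_pos hl, psY_mul, sum_congr rfl fun j _ => (mvY1_ok m p.2 hl j).symm, Fin.sum_univ_def,
        ← List.map_coe_finRange_eq_range, map_map]; rfl
    · rw [ΦY, if_neg hl, mul_zero]
      refine List.sum_eq_zero fun x hx => ?_
      obtain ⟨j, -, rfl⟩ := mem_map.1 hx
      have hΦ : ∀ x, ΦY (p.2.set j x) = 0 := by intro x; rw [ΦY, if_neg (by simpa using hl)]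
      simp only [mvY1]
      split
      · simp [ev_cons, ev_nil, hΦ]
      · split <;> simp [ev_cons, ev_nil, hΦ]

def fN {α : Type} (n : ℕ) (k : ℕ → α) : α := Nat.rec (k 0) (fun m _ => k (Nat.succ m)) n
theorem fN_eq {α : Type} (n : ℕ) (k : ℕ → α) : fN n k = k n := by cases n <;> rfl
def fI {α : Type} (n : ℤ) (k : ℤ → α) : α := match n with
  | .ofNat n => fN n fun n => k (.ofNat n)
  | .negSucc n => fN n fun n => k (.negSucc n)
theorem fI_eq {α : Type} (n : ℤ) (k : ℤ → α) : fI n k = k n := by cases n <;> simp [fI, fN_eq]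
def fW {α : Type} (l : List ℕ) (k : List ℕ → α) : α := match l with
  | [] => k []
  | x :: l => fN x fun x => fW l fun l => k (x :: l)
theorem fW_eq {α : Type} (l : List ℕ) (k : List ℕ → α) : fW l k = k l := by
  induction l generalizing k with
  | nil => rfl
  | cons x l ih => simp [fW, fN_eq, ih]
def fL {α : Type} (l : LL) (k : LL → α) : α := match l with
  | [] => k []
  | (c, l) :: L => fI c fun c => fW l fun l => fL L fun L => k ((c, l) :: L)
theorem fL_eq {α : Type} (l : LL) (k : LL → α) : fL l k = k l := by
  induction l generalizing k with
  | nil => rfl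
  | cons x l ih => rcases x with ⟨c, l⟩; simp [fL, fI_eq, fW_eq, ih]

def wdX : List ℕ → LL → LL
  | [], L => L
  | m :: s, L => fL (nrm nX (mvX m (wdX s L))) fun L => L
def wdY : List ℕ → LL → LL
  | [], L => L
  | m :: s, L => nrm (fun l => l) (mvY m (wdY s L))
def pwY (s : List ℕ) : CharRing 10 := (s.map fun m : ℕ => psY 10 m).prod
def pwX (s : List ℕ) : CharRing 6 := (s.map fun m : ℕ => PX m).prod
theorem wdX_ok (s L) : ev ΦX (wdX s L) = pwX s * ev ΦX L := by
  induction s with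
  | nil => simp [wdX, pwX]
  | cons m s ih => rw [wdX, fL_eq, nrm_ok altX nX nX_ok, mvX_ok, ih]; simp [pwX, mul_assoc]
theorem wdY_ok (s L) : ev ΦY (wdY s L) = pwY s * ev ΦY L := by
  induction s with
  | nil => simp [wdY, pwY]
  | cons m s ih => rw [wdY, nrm_ok altYl _ (fun _ => rfl), mvY_ok, ih]; simp [pwY, mul_assoc]
theorem res_pw (w) (hw : WS w) (s) : resH w (pwY s) = pwX s := by
  simp only [pwY, pwX, map_list_prod, map_map]
  congr 1
  exact map_congr_left fun m _ => res_ps w hw m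

def lf (l : List ℕ) (i : Fin 10) : ℕ := l.getD i 0
def yl : List ℕ → List ℕ
  | [] => []
  | c :: l => (c + 1 + (yl l).headD 0) :: yl l

theorem yl_spec (l : List ℕ) (hl : l.length = 10) : ΦY (yl l) = altY .C 10 (epsWt .C 10 (lf l) + rhoY .C 10) := by
  match l, hl with
  | [a,b,c,d,e,f,g,h,i,j], _ =>
    rw [ΦY, if_pos (by simp [yl])]
    congr 1
    funext x
    simp only [yv, yl, epsWt, rhoY, lf, Pi.add_apply, sum_filter, Fin.sum_univ_succ, Fin.sum_univ_zero]
    fin_cases x <;> simp <;> ring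

theorem denY_ne : altY .C 10 (rhoY .C 10) ≠ 0 := by
  intro h
  have := altY_coeff 10 _ _ (rhoY_anti 10).1 (rhoY_anti 10).1 (rhoY_anti 10).2 (rhoY_anti 10).2
  rw [h] at this; simp at this

def Rep (lam : List ℕ) (L : LL) : Prop := lam.length = 10 ∧
  ∀ w, WS w → resH w (chY (lf lam)) * altA 5 (rhoA 5) = ev ΦX L

abbrev Env := List (List ℕ × LL)
def EOK (E : Env) : Prop := ∀ x ∈ E, Rep x.1 x.2

def lk : Env → List ℕ → LL
  | [], _ => []
  | (a, L) :: E, l => match Nat.beq (lc a l) 1 with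
    | true => L
    | false => lk E l
def has : Env → List ℕ → Bool
  | [], _ => false
  | (a, L) :: E, l => match Nat.beq (lc a l) 1 with
    | true => true
    | false => has E l

theorem lk_ok (E : Env) (hE : EOK E) (l) (h : has E l = true) : Rep l (lk E l) := by
  induction E with
  | nil => simp [has] at h
  | cons x E ih =>
    rcases x with ⟨a, L⟩
    rw [has] at h; rw [lk]
    split
    · rename_i h1
      rw [← lc_eq _ _ (eq_of_beq_eq_true h1)]
      exact hE (a, L) (by simp)
    · rename_i h1
      rw [h1] at h
      exact ih (fun x hx => hE x (by simp [hx])) h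

abbrev Tm := List (ℤ × List ℕ × List ℕ)
def smX (E : Env) : Tm → LL
  | [] => []
  | (c, s, mu) :: T => sc c (wdX s (lk E mu)) ++ smX E T
def smY : Tm → LL
  | [] => []
  | (c, s, mu) :: T => sc c (wdY s [(1, yl mu)]) ++ smY T
def dv (k : ℤ) (L : LL) : LL := L.map fun p => (p.1 / k, p.2)

theorem chY_yl (mu : List ℕ) (h : mu.length = 10) : chY (lf mu) * altY .C 10 (rhoY .C 10) = ΦY (yl mu) := by
  rw [yl_spec mu h, mul_comm]; exact chY_isChar _

theorem smul_canc {n : ℕ} (k : ℤ) (hk : k ≠ 0) (a b : CharRing n) (h : k • a = k • b) : a = b := by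
  rw [zsmul_eq_mul, zsmul_eq_mul] at h
  refine mul_left_cancel₀ ?_ h
  intro h0
  have := congrArg (fun F : CharRing n => F.coeff 0) h0
  rw [show ((k : ℤ) : CharRing n) = k • 1 by simp] at this
  simp only [coeff_smul, Finsupp.smul_apply, smul_eq_mul] at this
  rw [show (1 : CharRing n) = mono 0 from rfl, coeff_mono] at this
  simp at this; exact hk this

def tmH (T : Tm) : CharRing 10 := (T.map fun t => t.1 • (pwY t.2.1 * chY (lf t.2.2))).sum

theorem smY_ok (T : Tm) (h : ∀ t ∈ T, t.2.2.length = 10) : ev ΦY (smY T) = tmH T * altY .C 10 (rhoY .C 10) := by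
  induction T with
  | nil => simp [smY, tmH, ev_nil]
  | cons t T ih =>
    rcases t with ⟨c, s, mu⟩
    rw [smY, ev_app, sc_ok, wdY_ok, ih fun t ht => h t (by simp [ht])]
    have := chY_yl mu (h (c, s, mu) (by simp))
    simp only [tmH, map_cons, sum_cons, add_mul, ev_cons, ev_nil, one_smul, add_zero, smul_mul_assoc, mul_assoc, this]

theorem smX_ok (E : Env) (T : Tm) (h : ∀ t ∈ T, Rep t.2.2 (lk E t.2.2)) (w) (hw : WS w) :
    ev ΦX (smX E T) = resH w (tmH T) * altA 5 (rhoA 5) := by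
  induction T with
  | nil => simp [smX, tmH, ev_nil]
  | cons t T ih =>
    rcases t with ⟨c, s, mu⟩
    rw [smX, ev_app, sc_ok, wdX_ok, ih fun t ht => h t (by simp [ht]), ← (h (c, s, mu) (by simp)).2 w hw, ← res_pw w hw]
    simp only [tmH, map_cons, sum_cons, add_mul, map_add, map_zsmul, map_mul, smul_mul_assoc, mul_assoc]

def beqL : LL → LL → Bool
  | [], [] => true
  | (c, l) :: L, (d, m) :: M => match decide (c = d) with
    | true => match Nat.beq (lc l m) 1 with
      | true => beqL L M
      | false => false
    | false => false
  | _, _ => false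
theorem beqL_eq (L M) (h : beqL L M = true) : L = M := by
  fun_induction beqL L M with
  | case1 => rfl
  | case2 c l L d m M h1 h2 ih =>
    rw [ih h, lc_eq _ _ (eq_of_beq_eq_true h2), of_decide_eq_true h1]
  | case3 => simp at h
  | case4 => simp at h
  | case5 => simp at h

def stp (E : Env) (lam : List ℕ) (k : ℤ) (T : Tm) : Option Env :=
  match Nat.beq lam.length 10 && decide (k ≠ 0) && T.all (fun t => has E t.2.2) && beqL (nrm (fun l => l) (smY T)) [(k, yl lam)] with
  | false => none
  | true => fL (nrm nX (smX E T)) fun L => fL (dv k L) fun M => match beqL (sc k M) L with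
    | true => some ((lam, M) :: E)
    | false => none

theorem stp_ok (E E') (lam) (k) (T) (hE : EOK E) (h : stp E lam k T = some E') : EOK E' := by
  unfold stp at h
  split at h
  · simp at h
  · rename_i h0
    simp only [fL_eq] at h
    split at h
    · rename_i h1
      simp only [Option.some.injEq] at h
      subst h
      simp only [and_eq_true] at h0
      obtain ⟨⟨⟨h2, h3⟩, h4⟩, h5⟩ := h0
      have h2 := eq_of_beq_eq_true h2
      have hk : k ≠ 0 := of_decide_eq_true h3
      have hR : ∀ t ∈ T, Rep t.2.2 (lk E t.2.2) := fun t ht => lk_ok E hE _ (all_eq_true.1 h4 t ht)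
      have h5 := congrArg (ev ΦY) (beqL_eq _ _ h5)
      rw [nrm_ok altYl _ (fun _ => rfl), smY_ok T fun t ht => (hR t ht).1, ev_cons, ev_nil, add_zero, ← chY_yl lam h2,
        ← smul_mul_assoc] at h5
      have h5 := mul_right_cancel₀ denY_ne h5
      have h1 := congrArg (ev ΦX) (beqL_eq _ _ h1)
      intro x hx
      rcases mem_cons.1 hx with rfl | hx
      · refine ⟨h2, fun w hw => smul_canc k hk _ _ ?_⟩
        rw [← sc_ok, h1, nrm_ok altX nX nX_ok, smX_ok E T hR w hw, h5, map_zsmul, smul_mul_assoc]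
      · exact hE x hx
    · simp at h

abbrev Cert := List ℕ × ℤ × Tm
def run {α : Type} (d : α) : List Cert → Env → (Env → α) → α
  | [], E, k => k E
  | c :: C, E, k => match stp E c.1 c.2.1 c.2.2 with
    | none => d
    | some E' => run d C E' k

theorem run_ok (C : List Cert) (E : Env) (hE : EOK E) (k : Env → Bool) (h : run false C E k = true) : ∃ E', EOK E' ∧ k E' = true := by
  induction C generalizing E with
  | nil => exact ⟨E, hE, h⟩
  | cons c C ih =>
    rw [run] at h
    rcases h1 : stp E c.1 c.2.1 c.2.2 with _ | E'
    · simp [h1] at h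
    · simp only [h1] at h
      exact ih E' (stp_ok _ _ _ _ _ hE h1) h

def E0 : Env := [([0,0,0,0,0,0,0,0,0,0], [(1,[5,4,3,2,1,0])])]
theorem E0_ok : EOK E0 := by
  intro x hx
  simp only [E0, List.mem_singleton] at hx
  subst hx
  refine ⟨rfl, fun w hw => ?_⟩
  have h : chY (lf [0,0,0,0,0,0,0,0,0,0]) = 1 := by
    refine (chY_uniq _ 1 ?_).symm
    rw [IsCharY, mul_one]
    congr 1
    funext i
    have : ∀ k : Fin 10, lf [0,0,0,0,0,0,0,0,0,0] k = 0 := by decide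
    simp [epsWt, this]
  rw [h, map_one, one_mul, ev_cons, ev_nil, ΦX_rho]; simp

def gd (l : List ℕ) : Bool := match l with
  | [a,b,c,d,e,f] => Nat.blt b a && Nat.blt c b && Nat.blt d c && Nat.blt e d && Nat.blt f e && Nat.beq f 0
  | _ => false
def dyn (l : List ℕ) (i : Fin 5) : ℕ := l.getD i 0 - l.getD (i+1) 0 - 1

theorem gd_cases (l : List ℕ) (h : gd l = true) : ∃ a b c d e : ℕ, l = [a+b+c+d+e+5, b+c+d+e+4, c+d+e+3, d+e+2, e+1, 0] := by
  unfold gd at h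
  split at h
  · rename_i a b c d e f
    simp only [and_eq_true, blt_eq, beq_eq] at h
    refine ⟨a-b-1, b-c-1, c-d-1, d-e-1, e-1, ?_⟩
    simp only [List.cons.injEq, and_true]
    omega
  · simp at h

theorem gd_dyn (l : List ℕ) (h : gd l = true) : θ l = slWt 5 (dyn l) + rhoA 5 ∧ l.length = 6 := by
  obtain ⟨a, b, c, d, e, rfl⟩ := gd_cases l h
  have hd : dyn [a+b+c+d+e+5, b+c+d+e+4, c+d+e+3, d+e+2, e+1, 0] = ![a,b,c,d,e] := by
    funext i; fin_cases i <;> simp [dyn] <;> omega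
  refine ⟨?_, rfl⟩
  rw [hd]
  funext i
  simp only [θ, slWt, partLift, rhoA, Pi.add_apply, sum_filter, Fin.sum_univ_five]
  fin_cases i <;> simp <;> ring

theorem gd_inj (l m : List ℕ) (hl : gd l = true) (hm : gd m = true) (h : dyn l = dyn m) : l = m := by
  obtain ⟨a, b, c, d, e, rfl⟩ := gd_cases l hl
  obtain ⟨a', b', c', d', e', rfl⟩ := gd_cases m hm
  have h0 := congrFun h 0
  have h1 := congrFun h 1
  have h2 := congrFun h 2
  have h3 := congrFun h 3
  have h4 := congrFun h 4
  simp [dyn] at h0 h1 h2 h3 h4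
  have : e = e' := by omega
  have : d = d' := by omega
  have : c = c' := by omega
  have : b = b' := by omega
  have : a = a' := by omega
  subst_vars; rfl

theorem gd_anti (l : List ℕ) (h : gd l = true) : StrictAnti (θ l) := by
  rw [(gd_dyn l h).1]; exact sl_anti _
theorem gd_θ (l m : List ℕ) (hl : gd l = true) (hm : gd m = true) : θ l = θ m ↔ l = m :=
  ⟨fun h => gd_inj l m hl hm (sl_inj (by rw [← (gd_dyn l hl).1, h, (gd_dyn m hm).1])), fun h => by rw [h]⟩
theorem gd_Φ (l : List ℕ) (h : gd l = true) : ΦX l = altA 5 (θ l) := if_pos (gd_dyn l h).2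

def agd (L : LL) : Bool := L.all fun p => gd p.2
def cf (L : LL) (m : List ℕ) : ℤ := (L.map fun p => if p.2 = m then p.1 else 0).sum

theorem cf_ok (L : LL) (hL : agd L = true) (m) (hm : gd m = true) : (ev ΦX L).coeff (θ m) = cf L m := by
  induction L with
  | nil => simp [ev_nil, cf]
  | cons p L ih =>
    simp only [agd, all_cons, and_eq_true] at hL
    have h1 := altA_coeff 5 _ _ (gd_anti _ hL.1) (gd_anti m hm)
    rw [← gd_Φ _ hL.1] at h1
    rw [ev_cons]
    generalize ΦX p.2 = Z at *
    rw [AddMonoidAlgebra.coeff_add, coeff_smul, Finsupp.add_apply, Finsupp.smul_apply, h1, ih hL.2]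
    simp only [gd_θ _ _ hL.1 hm, cf, map_cons, sum_cons, smul_eq_mul, mul_ite, mul_one, mul_zero]

def tbad (L : LL) : Bool := agd L && L.any fun p => decide (2 ≤ p.1) && decide (2 ≤ cf L p.2)
theorem tbad_ok (lam L) (hR : Rep lam L) (h : tbad L = true) : Bad (lf lam) := by
  simp only [tbad, and_eq_true, List.any_eq_true, decide_eq_true_eq] at h
  obtain ⟨h1, p, hp, -, h2⟩ := h
  have hg : gd p.2 = true := all_eq_true.1 h1 p hp
  refine bad_of _ (θ p.2) (gd_anti _ hg) ?_
  rw [hR.2 w0 ws0, cf_ok L h1 _ hg]; exact h2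

def tmf (L : LL) : Bool := agd L && L.all (fun p => decide (p.1 = 1)) && decide (L.map Prod.snd).Nodup
theorem tmf_ok (lam L) (hR : Rep lam L) (h : tmf L = true) : IsMFRes .C 10 5 (MFPaper.e 5 3) (lf lam) := by
  simp only [tmf, and_eq_true, decide_eq_true_eq] at h
  obtain ⟨⟨h1, h2⟩, h3⟩ := h
  intro w hw f hf
  rw [chY_uniq _ f hf]
  have hnd : ((L.map Prod.snd).map dyn).Nodup := by
    refine List.Nodup.map_on ?_ h3
    intro x hx y hy hxy
    obtain ⟨p, hp, rfl⟩ := mem_map.1 hx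
    obtain ⟨q, hq, rfl⟩ := mem_map.1 hy
    exact gd_inj _ _ (all_eq_true.1 h1 p hp) (all_eq_true.1 h1 q hq) hxy
  refine ⟨Multiset.toFinsupp (((L.map Prod.snd).map dyn : List _) : Multiset (Fin 5 → ℕ)), ?_, fun μ => ?_⟩
  · rw [Decomp, resH_eq, hR.2 w hw]
    clear h3 hnd hR
    induction L with
    | nil => simp [ev_nil]
    | cons p L ih =>
      simp only [agd, all_cons, and_eq_true, decide_eq_true_eq] at h1 h2
      rw [ev_cons, ih h1.2 h2.2, h2.1, one_smul, gd_Φ _ h1.1, (gd_dyn _ h1.1).1]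
      rw [map_cons, map_cons, ← Multiset.cons_coe, ← Multiset.singleton_add, map_add, Multiset.toFinsupp_singleton]
      generalize altA 5 = A
      rw [Finsupp.sum_add_index' (by simp) (by intros; push_cast; rw [add_smul]), Finsupp.sum_single_index (by simp)]
      simp
  · rw [Multiset.toFinsupp_apply, Multiset.coe_count]
    exact List.nodup_iff_count_le_one.1 hnd μ

def W (s : List ℕ) : List ℕ := (range 10).map fun i => (s.filter fun x => Nat.beq x (i+1)).length
theorem W_len (s) : (W s).length = 10 := by simp [W]
def ff (p : ℕ) : CharRing 10 := if p ≤ 10 then chY (lf (W [p])) else 0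

def cl (m : ℕ) : Fin 10 → CharRing 10 := fun i => br i m
theorem cl_zero : cl 0 = 0 := by funext i; simp [cl, br]
theorem cl_rec (m : ℕ) (i) : (xp i 1 + xp i (-1)) * cl (m+1) i = cl (m+2) i + cl m i := by
  simp only [cl, br]
  push_cast
  simp only [neg_add, show ((m:ℚ)+2) = m + 1 + 1 by ring, neg_add, xp_add]
  have : xp i 1 * xp i (-1) = 1 := by rw [← xp_add]; simp [xp_zero]
  linear_combination (xp i (m:ℚ) - xp i (-(m:ℚ))) * this

def rl : List ℕ := [10,9,8,7,6,5,4,3,2,1]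
def M0 : Matrix (Fin 10) (Fin 10) (CharRing 10) := fun i j => cl (rl.getD j 0) i
def aR : CharRing 10 := altY .C 10 (rhoY .C 10)
theorem set1 : ∀ j m : Fin 10, ∀ c, ((rl.set j c).getD m 0) = if m = j then c else rl.getD m 0 := by
  intro j m c
  simp only [List.getD_eq_getElem?_getD, List.getElem?_set]
  by_cases h : m = j
  · subst h; simp [rl]
  · rw [if_neg (by omega), if_neg h]
theorem ΦY_det (l : List ℕ) (h : l.length = 10) : ΦY l = (Matrix.of fun i j : Fin 10 => cl (l.getD j 0) i).det := by
  rw [ΦY, if_pos h, altY_det]; rfl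
theorem col1 (j : Fin 10) (c : ℕ) : (M0.updateCol j (cl c)).det = ΦY (rl.set j c) := by
  rw [ΦY_det _ (by simp [rl])]
  congr 1
  ext i m : 2
  simp only [updateCol_apply, of_apply, set1]
  split <;> rfl
theorem col2 (j k : Fin 10) (c d : ℕ) : ((M0.updateCol j (cl c)).updateCol k (cl d)).det = ΦY ((rl.set j c).set k d) := by
  rw [ΦY_det _ (by simp [rl])]
  congr 1
  ext i m : 2
  have : (((rl.set j c).set k d).getD m 0) = if m = k then d else (rl.set j c).getD m 0 := by
    simp only [List.getD_eq_getElem?_getD, List.getElem?_set]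
    by_cases h : m = k
    · subst h; simp [rl]
    · rw [if_neg (by omega), if_neg h]
  simp only [updateCol_apply, of_apply, this, set1]
  split
  · rfl
  split <;> rfl
theorem chY_zero : chY (lf (W [])) = 1 := by
  refine (chY_uniq _ 1 ?_).symm
  rw [IsCharY, mul_one]
  congr 1
  funext i
  have : ∀ k : Fin 10, lf (W []) k = 0 := by decide
  simp [epsWt, this]
theorem det_M0 : M0.det = aR := by
  have h1 : M0.det = ΦY rl := by rw [ΦY_det _ rfl]; rfl
  have h2 := chY_yl (W []) (W_len _)
  rw [chY_zero, one_mul] at h2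
  rw [h1, aR, h2]
  rfl
theorem ff_mul (p : ℕ) (hp : p ≤ 10) : ff p * aR = ΦY (yl (W [p])) := by
  rw [ff, if_pos hp, aR, chY_yl _ (W_len _)]
theorem nrmY1 (l m : List ℕ) (c : ℤ) (h : beqL (nrm (fun l => l) [(1, l)]) [(c, m)] = true) : ΦY l = c • ΦY m := by
  have := congrArg (ev ΦY) (beqL_eq _ _ h)
  rw [nrm_ok altYl _ (fun _ => rfl)] at this
  simpa [ev_cons, ev_nil] using this
def aa (j : ℕ) : CharRing 10 := (-1) ^ j * ff (j + 1)
theorem chk1 : ∀ j : Fin 10, beqL (nrm (fun l => l) [(1, rl.set j 11)]) [((-1) ^ (j:ℕ), yl (W [j+1]))] = true := by decide +kernel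
theorem chk2 : ∀ j k : Fin 10, k < j → beqL (nrm (fun l => l) [(1, (rl.set j 11).set k 12)]) [((-1) ^ (j+k+1:ℕ), yl (W [j+1,k+2]))] = true := by decide +kernel
theorem cram1 (j : Fin 10) : (M0.updateCol j (cl 11)).det = aa j * aR := by
  rw [col1, nrmY1 _ _ _ (chk1 j), aa, mul_assoc, ff_mul _ (by omega), zsmul_eq_mul]; push_cast; rfl
theorem aR_ne : aR ≠ 0 := denY_ne
theorem c11 (i : Fin 10) : cl 11 i = ∑ j : Fin 10, aa j * M0 i j := by
  have h := congrFun (Matrix.mulVec_cramer M0 (cl 11)) i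
  rw [det_M0] at h
  apply mul_left_cancel₀ aR_ne
  simp only [Pi.smul_apply, smul_eq_mul] at h
  rw [← h, mulVec, dotProduct, mul_sum]
  refine sum_congr rfl fun j _ => ?_
  rw [Matrix.cramer_apply, cram1]; ring
def bq (j : ℕ) : CharRing 10 := (-1) ^ (j+1) * (ff (j + 2) + ff j)
theorem ff_zero : ff 0 = 1 := by rw [ff, if_pos (by simp), ← chY_zero]; rfl
theorem ff_11 : ff 11 = 0 := by rw [ff, if_neg (by simp)]
theorem c12 (i : Fin 10) : cl 12 i = ∑ j : Fin 10, (aa 0 * aa j + bq j) * M0 i j := by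
  have h := congrArg (fun x => (xp i 1 + xp i (-1)) * x) (c11 i)
  simp only [add_mul, sum_add_distrib, mul_assoc] at h ⊢
  rw [← mul_sum, ← c11]
  simp only [← add_mul] at h
  rw [cl_rec 10 i, mul_sum] at h
  have e : ∀ j : Fin 10, (xp i 1 + xp i (-1)) * (aa j * M0 i j) = aa j * (cl (11 - j) i + cl (9 - j) i) := by
    intro j
    have := cl_rec (9 - j) i
    have e1 : M0 i j = cl (9 - j + 1) i := by
      simp only [M0]; congr 1; clear this; revert j; decide
    rw [e1, mul_left_comm, this]
    congr 3; omega
  simp only [e] at h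
  simp only [Fin.sum_univ_succ, Fin.sum_univ_zero, aa, bq, M0] at h ⊢
  simp [rl, cl_zero, ff_zero, ff_11] at h ⊢
  linear_combination h

theorem updC (A : Matrix (Fin 10) (Fin 10) (CharRing 10)) (k : Fin 10) (c : Fin 10 → CharRing 10) (v) (hv : ∀ i, v i = ∑ j, c j * A i j) :
    (A.updateCol k v).det = c k * A.det := by
  rw [← smul_eq_mul, ← Matrix.det_updateCol_sum A k c]
  congr 2
  funext i; simp [hv]

theorem chYne (lam) : chY lam ≠ 0 := by
  intro h
  have := chY_isChar lam
  rw [IsCharY, h, mul_zero] at this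
  obtain ⟨h2, h3⟩ := eps_dom lam
  have h4 := altY_coeff 10 _ _ h2 h2 h3 h3
  rw [← this] at h4
  simp at h4

theorem aa_ne (j : Fin 10) : aa j ≠ 0 := by
  rw [aa, ff, if_pos (by omega)]
  exact mul_ne_zero (pow_ne_zero _ (by simp)) (chYne _)

theorem two_det (j k : Fin 10) (h : k ≠ j) : ((M0.updateCol j (cl 11)).updateCol k (cl 12)).det = (aa j * bq k - aa k * bq j) * aR := by
  apply mul_left_cancel₀ (aa_ne j)
  rw [mul_left_comm (aa j), ← cram1, ← Matrix.det_updateCol_smul (M0.updateCol j (cl 11)) k (aa j) (cl 12)]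
  set b : Fin 10 → CharRing 10 := fun j => aa 0 * aa j + bq j with hb
  rw [updC _ k (fun i => if i = j then b j else aa j * b i - b j * aa i)]
  · simp only [h, if_false, hb]; ring
  · intro i
    rw [Pi.smul_apply, c12, smul_eq_mul, mul_sum]
    simp only [updateCol_apply]
    rw [← add_sum_erase _ _ (mem_univ j), ← add_sum_erase _ _ (mem_univ j)]
    rw [if_pos rfl, if_pos rfl]
    have : ∑ x ∈ univ.erase j, ((if x = j then b j else aa j * b x - b j * aa x) * if x = j then cl 11 i else M0 i x)
      = ∑ x ∈ univ.erase j, aa j * (b x * M0 i x) - b j * ∑ x ∈ univ.erase j, aa x * M0 i x := by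
      rw [mul_sum, ← sum_sub_distrib]
      refine sum_congr rfl fun x hx => ?_
      rw [if_neg (ne_of_mem_erase hx), if_neg (ne_of_mem_erase hx)]; ring
    rw [this, c11, ← add_sum_erase _ _ (mem_univ j)]; simp only [hb]; ring

theorem two_col (j k : Fin 10) (h : k < j) : chY (lf (W [j+1,k+2])) = ff (j+1) * (ff (k+2) + ff k) - ff (k+1) * (ff (j+2) + ff j) := by
  have h1 := two_det j k h.ne
  rw [col2, nrmY1 _ _ _ (chk2 j k h), ← chY_yl _ (W_len _), ← aR, ← smul_mul_assoc] at h1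
  have h1 := mul_right_cancel₀ aR_ne h1
  simp only [aa, bq, zsmul_eq_mul] at h1
  push_cast at h1
  have h3 : ((-1 : CharRing 10) ^ ((j:ℕ)+k+1)) ≠ 0 := pow_ne_zero _ (by simp)
  apply mul_left_cancel₀ h3
  rw [h1, pow_succ, pow_succ, pow_succ, pow_add]; ring

def cjH (n : ℕ) : CharRing n →+* CharRing n := mapDomainRingHom ℤ (-AddMonoidHom.id (Fin n → ℚ))
theorem cj_mono (n) (v : Fin n → ℚ) : cjH n (mono v) = mono (-v) := by
  simp [cjH, mono, mapDomain_single]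
def sgH (σ : Perm (Fin 6)) : CharRing 6 →+* CharRing 6 := mapDomainRingHom ℤ
  ({ toFun := fun v : Fin 6 → ℚ => fun i => v (σ i), map_zero' := rfl, map_add' := fun _ _ => rfl } : (Fin 6 → ℚ) →+ (Fin 6 → ℚ))
theorem sg_mono (σ) (v : Fin 6 → ℚ) : sgH σ (mono v) = mono fun i => v (σ i) := by
  simp [sgH, mono, mapDomain_single]
theorem sg_coeff (σ F) (v : Fin 6 → ℚ) : (sgH σ F).coeff (fun i => v (σ i)) = F.coeff v := by
  simp only [sgH, mapDomainRingHom_apply, coeff_mapDomain]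
  refine mapDomain_apply (f := fun v : Fin 6 → ℚ => fun i => v (σ i)) ?_ F.coeff v
  intro u v h; funext i
  simpa using congrFun h (σ.symm i)
abbrev sgn (σ : Perm (Fin 6)) : ℤ := ((Perm.sign σ : ℤˣ) : ℤ)
theorem sgn_sq (σ) : sgn σ * sgn σ = 1 := by
  simp only [sgn]; rw [← Units.val_mul, Int.units_mul_self]; rfl
theorem sg_altA (σ v) : sgH σ (altA 5 v) = sgn σ • altA 5 v := by
  rw [altA, map_sum, smul_sum]
  refine Fintype.sum_equiv (Equiv.mulRight σ) _ _ fun τ => ?_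
  rw [map_zsmul, sg_mono, smul_smul]
  simp only [Equiv.coe_mulRight, Perm.sign_mul, Units.val_mul]
  rw [mul_left_comm, sgn_sq, mul_one]; rfl
def PA (F : CharRing 6) : Prop := ∀ σ, sgH σ F = sgn σ • F
theorem PA.coeff {F} (h : PA F) (σ v) : F.coeff (fun i => v (σ i)) = sgn σ * F.coeff v := by
  rw [← sg_coeff σ F v, h σ, coeff_smul, Finsupp.smul_apply, smul_eq_mul, ← mul_assoc, sgn_sq, one_mul]
theorem PA_ev (L : LL) : PA (ev ΦX L) := by
  intro σ
  induction L with
  | nil => simp [ev_nil]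
  | cons p L ih =>
    rw [ev_cons, map_add, ih, map_zsmul, smul_add]
    have : sgH σ (ΦX p.2) = sgn σ • ΦX p.2 := by
      rw [ΦX]; split
      · exact sg_altA σ _
      · simp
    rw [this, smul_comm]
def Sy (H : CharRing 6) : Prop := ∀ σ, sgH σ H = H
theorem Sy_of (H : CharRing 6) (h : PA (H * altA 5 (rhoA 5))) : Sy H := by
  intro σ
  have h1 := h σ
  rw [map_mul, sg_altA, mul_smul_comm] at h1
  have h2 := congrArg (fun x => sgn σ • x) h1
  simp only [smul_smul, sgn_sq, one_smul] at h2
  exact mul_right_cancel₀ denX_ne h2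
theorem PA_mul {H F} (h : Sy H) (hF : PA F) : PA (H * F) := by
  intro σ; rw [map_mul, h, hF, mul_smul_comm]

def Bf (F G : CharRing 6) : ℤ := (F * cjH 6 G).coeff 0
theorem Bf_add_r (F G G') : Bf F (G + G') = Bf F G + Bf F G' := by simp [Bf, mul_add]
theorem Bf_add_l (F F' G) : Bf (F + F') G = Bf F G + Bf F' G := by simp [Bf, add_mul]
theorem Bf_sub_l (F F' G) : Bf (F - F') G = Bf F G - Bf F' G := by simp [Bf, sub_mul]
theorem Bf_smul_r (c : ℤ) (F G) : Bf F (c • G) = c * Bf F G := by simp only [Bf, map_zsmul, mul_smul_comm, coeff_smul, Finsupp.smul_apply, smul_eq_mul]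
theorem Bf_sum_r {ι} (s : Finset ι) (F) (G : ι → CharRing 6) : Bf F (∑ i ∈ s, G i) = ∑ i ∈ s, Bf F (G i) := by
  classical
  induction s using induction_on with
  | empty => simp [Bf]
  | insert a s h ih => rw [sum_insert h, sum_insert h, Bf_add_r, ih]
theorem Bf_mul (F G u) (hu : cjH 6 u = u) : Bf (u * F) G = Bf F (u * G) := by
  rw [Bf, Bf, map_mul, hu]; congr 2; ring
theorem Bf_mono (F v) : Bf F (mono v) = F.coeff v := by
  rw [Bf, cj_mono, mono, AddMonoidAlgebra.coeff_mul_single_apply]; simp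
theorem Bf_altA (F) (h : PA F) (v) : Bf F (altA 5 v) = 720 * F.coeff v := by
  rw [altA, Bf_sum_r]
  rw [sum_congr rfl (g := fun _ => F.coeff v) fun σ _ => by rw [Bf_smul_r, Bf_mono, h.coeff, ← mul_assoc, sgn_sq, one_mul]]
  rw [Finset.sum_const, Finset.card_univ, Fintype.card_perm]; simp [Nat.factorial]

theorem cj_br (i : Fin 10) (m) : cjH 10 (br i m) = - br i m := by
  simp only [br, map_sub, xp, cj_mono]
  rw [← single_neg, ← single_neg, neg_neg]; ring
theorem cj_altY (v) : cjH 10 (altY .C 10 v) = altY .C 10 v := by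
  rw [altY_det, map_det]
  have : (cjH 10).mapMatrix (MY v) = - MY v := by
    refine Matrix.ext fun i j => ?_
    exact cj_br _ _
  rw [this, Matrix.det_neg]; norm_num
theorem cj_chY (lam) : cjH 10 (chY lam) = chY lam := by
  refine chY_uniq lam _ ?_
  have h := congrArg (cjH 10) (chY_isChar lam)
  rwa [map_mul, cj_altY, cj_altY] at h
theorem cj_ff (p) : cjH 10 (ff p) = ff p := by
  rw [ff]; split
  · exact cj_chY _
  · simp
theorem cj_ps (m) : cjH 10 (psY 10 m) = psY 10 m := by
  rw [psY, map_sum]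
  refine sum_congr rfl fun i _ => ?_
  simp only [map_add, xp, cj_mono]
  rw [← single_neg, ← single_neg, neg_neg, add_comm]
theorem cj_res (w F) : cjH 6 (resH w F) = resH w (cjH 10 F) := by
  have : (cjH 6).comp (resH w) = (resH w).comp (cjH 10) := by
    refine AddMonoidAlgebra.ringHom_ext (fun r => ?_) fun v => ?_
    · simp [cjH, resH, mapDomain_single]
    · show cjH 6 (resH w (mono v)) = resH w (cjH 10 (mono v))
      rw [← resH_eq, res_mono, cj_mono, cj_mono, ← resH_eq, res_mono]; simp
  exact congrArg (fun f => f F) this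
theorem cj_pwX (s) : cjH 6 (pwX s) = pwX s := by
  rw [← res_pw w0 ws0, cj_res, pwY, map_list_prod, map_map]
  congr 2
  exact map_congr_left fun m _ => cj_ps m
abbrev rf (p : ℕ) : CharRing 6 := resH w0 (ff p)
abbrev AX : CharRing 6 := altA 5 (rhoA 5)
theorem cj_rf (p) : cjH 6 (rf p) = rf p := by rw [cj_res, cj_ff]
theorem Bf_split (p q : ℕ) (s t : List ℕ) : Bf (rf p * rf q * AX) (pwX (s ++ t) * AX) = Bf (pwX s * (rf p * AX)) (pwX t * (rf q * AX)) := by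
  rw [show pwX (s ++ t) = pwX s * pwX t by simp [pwX], show rf p * rf q * AX = rf q * (rf p * AX) by ring, Bf_mul _ _ _ (cj_rf q),
    Bf_mul _ _ _ (cj_pwX s)]
  congr 1; ring

def dotL (L M : LL) : ℤ := (L.map fun p => p.1 * cf M p.2).sum
theorem Bf_ev1 (F) (hF : PA F) (L : LL) (hL : agd L = true) : Bf F (ev ΦX L) = 720 * (L.map fun p => p.1 * F.coeff (θ p.2)).sum := by
  induction L with
  | nil => simp [ev_nil, Bf]
  | cons p L ih =>
    simp only [agd, all_cons, and_eq_true] at hL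
    rw [ev_cons, Bf_add_r, ih hL.2, Bf_smul_r, gd_Φ _ hL.1, Bf_altA _ hF, map_cons, sum_cons]; ring
theorem Bf_ev (L M) (hL : agd L = true) (hM : agd M = true) : Bf (ev ΦX M) (ev ΦX L) = 720 * dotL L M := by
  rw [Bf_ev1 _ (PA_ev M) L hL, dotL]
  congr 2
  exact map_congr_left fun p hp => by rw [cf_ok M hM _ (all_eq_true.1 hL p hp)]

theorem lc_self (l) : lc l l = 1 := by
  rcases lcK_spec 0 0 0 l l with h1 | h1 | h1
  all_goals induction l <;> simp_all [lc, lcK_cons]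
  all_goals first | rfl | simp [lcK] at *
theorem lc_tr : ∀ a b c, lc a b = 0 → lc b c = 0 → lc a c = 0
  | [], _, [] , h, h' => by rename_i b; cases b <;> simp [lc, lcK] at *
  | [], _, _ :: _, _, _ => rfl
  | _ :: _, [], _, h, _ => by simp [lc, lcK] at h
  | _ :: _, _ :: _, [], _, h => by simp [lc, lcK] at h
  | a :: l, b :: m, c :: n, h, h' => by
    have := lc_tr l m n
    simp only [lc, lcK_cons] at *
    split_ifs at * <;> first | omega | simp_all
theorem lc_sw : ∀ a b, lc a b = 2 → lc b a = 0
  | [], [], h => by simp [lc, lcK] at h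
  | [], _ :: _, h => by simp [lc, lcK] at h
  | _ :: _, [], _ => rfl
  | a :: l, b :: m, h => by
    have := lc_sw l m
    simp only [lc, lcK_cons] at *
    split_ifs at * <;> first | omega | simp_all

def srd : LL → Bool
  | [] => true
  | p :: L => match L with
    | [] => true
    | q :: _ => match Nat.beq (lc p.2 q.2) 0 with
      | true => srd L
      | false => false
theorem srd_ok (L : LL) (h : srd L = true) : L.Pairwise fun p q => lc p.2 q.2 = 0 := by
  induction L with
  | nil => simp
  | cons p L ih =>
    rcases L with _ | ⟨q, L⟩
    · simp
    · rw [srd] at h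
      split at h
      · rename_i h1
        have h1 := eq_of_beq_eq_true h1
        have := ih h
        refine pairwise_cons.2 ⟨fun x hx => ?_, this⟩
        rcases mem_cons.1 hx with rfl | hx
        · exact h1
        · exact lc_tr _ _ _ h1 ((pairwise_cons.1 this).1 x hx)
      · simp at h
def md (L : LL) : LL → ℤ := @List.rec (ℤ × List ℕ) (fun _ => LL → ℤ) (fun _ => 0)
  (fun p _ ihL => @List.rec (ℤ × List ℕ) (fun _ => ℤ) 0 fun q M ih => lcK (ihL (q :: M)) (Int.add (Int.mul p.1 q.1) (ihL M)) ih p.2 q.2) L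
theorem lc_ne (l m) (h : lc l m = 0) : l ≠ m := by rintro rfl; rw [lc_self] at h; omega
theorem cf_z (M : LL) (m) (h : ∀ x ∈ M, m ≠ x.2) : cf M m = 0 := by
  rw [cf, List.sum_eq_zero]
  intro x hx
  obtain ⟨y, hy, rfl⟩ := mem_map.1 hx
  exact if_neg (h y hy).symm
theorem cf_cons (q) (M : LL) (m) : cf (q :: M) m = (if q.2 = m then q.1 else 0) + cf M m := by simp [cf]
theorem dotL_cons (p L M) : dotL (p :: L) M = p.1 * cf M p.2 + dotL L M := by simp [dotL]
theorem dotL_skip (L q M) (h : ∀ x ∈ L, q.2 ≠ x.2) : dotL L (q :: M) = dotL L M := by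
  rw [dotL, dotL]; congr 1
  exact map_congr_left fun x hx => by rw [cf_cons, if_neg (h x hx), zero_add]
theorem md_ok (L M : LL) (hL : L.Pairwise fun p q => lc p.2 q.2 = 0) (hM : M.Pairwise fun p q => lc p.2 q.2 = 0) : md L M = dotL L M := by
  induction L generalizing M with
  | nil => rfl
  | cons p L ihL =>
    obtain ⟨hp, hL'⟩ := pairwise_cons.1 hL
    induction M with
    | nil => rw [dotL, List.sum_eq_zero]; · rfl
             · intro x hx; obtain ⟨y, hy, rfl⟩ := mem_map.1 hx; simp [cf]
    | cons q M ihM =>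
      obtain ⟨hq, hM'⟩ := pairwise_cons.1 hM
      show lcK (md L (q :: M)) (Int.add (Int.mul p.1 q.1) (md L M)) (md (p :: L) M) p.2 q.2 = _
      rcases lcK_spec (md L (q :: M)) (Int.add (Int.mul p.1 q.1) (md L M)) (md (p :: L) M) p.2 q.2 with h | h | h
      · rw [h.2, ihL _ hL' hM, dotL_cons, cf_z, mul_zero, zero_add]
        intro x hx
        rcases mem_cons.1 hx with rfl | hx
        · exact lc_ne _ _ h.1
        · exact lc_ne _ _ (lc_tr _ _ _ h.1 (hq x hx))
      · rw [h.2, ihM hM', dotL_skip]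
        have := lc_sw _ _ h.1
        intro x hx
        rcases mem_cons.1 hx with rfl | hx
        · exact lc_ne _ _ this
        · exact lc_ne _ _ (lc_tr _ _ _ this (hp x hx))
      · rw [h.2.2, ihL _ hL' hM', dotL_cons, cf_cons, if_pos h.1.symm, cf_z, dotL_skip, add_zero]; · rfl
        · intro x hx; rw [← h.1]; exact lc_ne _ _ (hp x hx)
        · intro x hx; rw [h.1]; exact lc_ne _ _ (hq x hx)

def pz1 (L : LL) : ℤ := (L.map fun p => max p.1 0).sum
theorem coeff_01 (lam) (hb : ¬ Bad lam) (v : Fin 6 → ℚ) (hv : StrictAnti v) :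
    0 ≤ (resH w0 (chY lam) * AX).coeff v ∧ (resH w0 (chY lam) * AX).coeff v ≤ 1 := by
  constructor
  · have := multX lam (v - rhoA 5) (by rwa [sub_add_cancel])
    rw [sub_add_cancel] at this; rw [this]; positivity
  · by_contra h
    exact hb (bad_of lam v hv (by show 2 ≤ (resH w0 (chY lam) * AX).coeff v; omega))
theorem pair_le (lam) (hb : ¬ Bad lam) (hF : PA (resH w0 (chY lam) * AX)) (L : LL) (hL : agd L = true) :
    Bf (resH w0 (chY lam) * AX) (ev ΦX L) ≤ 720 * pz1 L := by
  rw [Bf_ev1 _ hF L hL]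
  refine mul_le_mul_of_nonneg_left ?_ (by norm_num)
  refine List.sum_le_sum fun p hp => ?_
  obtain ⟨h0, h1⟩ := coeff_01 lam hb (θ p.2) (gd_anti _ (all_eq_true.1 hL p hp))
  rcases le_total p.1 0 with h | h
  · rw [max_eq_right h]; exact mul_nonpos_of_nonpos_of_nonneg h h0
  · rw [max_eq_left h]; exact mul_le_of_le_one_right h h1

def okL (L : LL) : Prop := agd L = true ∧ srd L = true
def TOK (s : List ℕ) (T : List LL) : Prop := ∀ p ≤ 11, okL (T.getD p []) ∧ ev ΦX (T.getD p []) = pwX s * (rf p * AX)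
def nn (T1 T2 : List LL) (p q : ℕ) : ℤ := md (T2.getD q []) (T1.getD p [])
def Cn (T1 T2 : List LL) (j k : ℕ) : ℤ := Int.sub (Int.add (nn T1 T2 (j+1) (k+2)) (nn T1 T2 (j+1) k)) (Int.add (nn T1 T2 (k+1) (j+2)) (nn T1 T2 (k+1) j))
theorem nn_ok (s t T1 T2) (h1 : TOK s T1) (h2 : TOK t T2) (p q) (hp : p ≤ 11) (hq : q ≤ 11) :
    Bf (rf p * rf q * AX) (pwX (s ++ t) * AX) = 720 * nn T1 T2 p q := by
  obtain ⟨⟨a1, b1⟩, c1⟩ := h1 p hp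
  obtain ⟨⟨a2, b2⟩, c2⟩ := h2 q hq
  rw [Bf_split, ← c1, ← c2, Bf_ev _ _ a2 a1, nn, md_ok _ _ (srd_ok _ b2) (srd_ok _ b1)]
theorem crit (s t T1 T2 LT) (h1 : TOK s T1) (h2 : TOK t T2) (hS : ∀ p ≤ 11, Sy (rf p)) (hLT : agd LT = true)
    (hE : ev ΦX LT = pwX (s ++ t) * AX) (j k : Fin 10) (hjk : k < j) (h : pz1 LT < Cn T1 T2 j k) : Bad (lf (W [j+1,k+2])) := by
  by_contra hb
  have e1 : resH w0 (chY (lf (W [j+1,k+2]))) = rf (j+1) * (rf (k+2) + rf k) - rf (k+1) * (rf (j+2) + rf j) := by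
    rw [two_col j k hjk]; simp only [map_sub, map_mul, map_add]
  have hk : (k:ℕ) < j := hjk
  have hF : PA (resH w0 (chY (lf (W [j+1,k+2]))) * AX) := by
    refine PA_mul ?_ (sg_altA · _)
    intro σ
    rw [e1]
    simp only [map_sub, map_mul, map_add]
    rw [hS _ (by omega) σ, hS _ (by omega) σ, hS _ (by omega) σ, hS _ (by omega) σ, hS _ (by omega) σ, hS _ (by omega) σ]
  have h3 := pair_le _ hb hF LT hLT
  rw [hE, e1] at h3
  have e2 : (rf (j+1) * (rf (k+2) + rf k) - rf (k+1) * (rf (j+2) + rf j)) * AX =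
    (rf (j+1) * rf (k+2) * AX + rf (j+1) * rf k * AX) - (rf (k+1) * rf (j+2) * AX + rf (k+1) * rf j * AX) := by ring
  rw [e2, Bf_sub_l, Bf_add_l, Bf_add_l, nn_ok s t T1 T2 h1 h2 _ _ (by omega) (by omega), nn_ok s t T1 T2 h1 h2 _ _ (by omega) (by omega),
    nn_ok s t T1 T2 h1 h2 _ _ (by omega) (by omega), nn_ok s t T1 T2 h1 h2 _ _ (by omega) (by omega)] at h3
  have h4 : Cn T1 T2 j k = nn T1 T2 (j+1) (k+2) + nn T1 T2 (j+1) k - (nn T1 T2 (k+1) (j+2) + nn T1 T2 (k+1) j) := rfl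
  omega

def tab (s : List ℕ) (f : ℕ → LL) (k : List LL → Bool) : List ℕ → Bool
  | [] => k [[]]
  | p :: ps => fL (wdX s (f p)) fun L => (agd L && srd L) && tab s f (fun T => k (L :: T)) ps
theorem tab_ok (s f k) (ps : List ℕ) (h : tab s f k ps = true) : k (ps.map (fun p => wdX s (f p)) ++ [[]]) = true ∧ ∀ p ∈ ps, okL (wdX s (f p)) := by
  induction ps generalizing k with
  | nil => exact ⟨h, by simp⟩
  | cons p ps ih =>
    rw [tab, fL_eq] at h
    simp only [and_eq_true] at h
    obtain ⟨h1, h2⟩ := ih _ h.2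
    refine ⟨h1, fun q hq => ?_⟩
    rcases mem_cons.1 hq with rfl | hq
    · exact h.1
    · exact h2 q hq
theorem rf_11 : rf 11 = 0 := by rw [rf, ff_11, map_zero]
theorem okL_nil : okL [] := ⟨rfl, rfl⟩
theorem tab_TOK (s s0 f k) (h : tab s f k (range 11) = true) (hf : ∀ p ≤ 10, ev ΦX (f p) = pwX s0 * (rf p * AX)) :
    ∃ T, TOK (s ++ s0) T ∧ k T = true := by
  obtain ⟨h1, h2⟩ := tab_ok _ _ _ _ h
  refine ⟨_, ?_, h1⟩
  intro p hp
  rcases Nat.lt_or_ge p 11 with h | h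
  · have : (((range 11).map (fun p => wdX s (f p))) ++ [[]]).getD p [] = wdX s (f p) := by
      rw [List.getD_append _ _ _ _ (by simpa using h), List.getD_eq_getElem _ _ (by simpa using h)]; simp
    rw [this]
    refine ⟨h2 p (by simpa using h), ?_⟩
    rw [wdX_ok, hf p (by omega)]; simp [pwX, mul_assoc]
  · have hp : p = 11 := by omega
    subst hp
    have : (((range 11).map (fun p => wdX s (f p))) ++ [[]]).getD 11 [] = [] := by
      rw [List.getD_append_right _ _ _ _ (by simp)]; simp
    rw [this, rf_11]
    exact ⟨okL_nil, by simp [ev_nil]⟩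

def rp (c : ℕ) : List ℕ := List.replicate c 1
def cE (k : ℕ) : Cert := (W [k], k, ((range k).flatMap fun i => (range ((k-i-1)/2+1)).map fun j =>
    ((match i % 2 with | 0 => 1 | _ => -1 : ℤ), [i+1], W [k-1-i-2*j])) ++ (range (k/2)).map fun j => (-(k:ℤ), [], W [k-2-2*j]))
def cH (c : ℕ) : Cert := (W (rp c), c, (range c).map fun i => (1, [i+1], W (rp (c-1-i))))
def c1 (l : List ℕ) (M : List (List ℕ)) (k : List ℕ) : Cert := (W l, 1, (1, [1], W k) :: M.map fun m => (-1, [], W m))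
def c2 (p : ℕ) (M : List (List ℕ)) : Cert := (W [p, 2], 2, (1, [1,1], W [p]) :: (-1, [2], W [p]) :: (-2, [], W [p]) :: M.map fun m => (-2, [], W m))
def crt : List Cert :=
  (range 10).map (fun i => cE (i+1)) ++ (range 5).map (fun i => cH (i+2)) ++
  (range 8).map (fun i => c1 [1, i+2] [[i+1], [i+3]] [i+2]) ++
  [c1 [1,10] [[9]] [10],
   c2 2 [[1,3],[4],[1,1],[2],[]], c2 3 [[1,4],[5],[1,2],[3],[1]], c2 4 [[1,5],[6],[1,3],[4],[2]],
   c2 8 [[1,9],[10],[1,7],[8],[6]], c2 9 [[1,10],[1,8],[9],[7]], c2 10 [[1,9],[8]],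
   c1 [1,1,2] [rp 4, rp 2] (rp 3), c1 [1,1,1,2] [rp 5, rp 3] (rp 4), c1 [1,2,2] [[2,3],[1,2]] [2,2],
   c1 [1,1,3] [[2,3],[1,4],[3],[1,2]] [1,3], c1 [1,1,4] [[2,4],[1,5],[4],[1,3]] [1,4], c1 [1,1,10] [[10,2],[10],[1,9]] [1,10],
   (W [2,2,2], 6, [(1,[1,1,1],W (rp 3)), (3,[1,2],W (rp 3)), (2,[3],W (rp 3)), (6,[1],W (rp 3)), (-3,[1,1],W (rp 4)),
     (-3,[2],W (rp 4)), (-3,[1,1],W (rp 2)), (-3,[2],W (rp 2))])]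

def pos : List (List ℕ) := (range 9).map (fun i => [i+2]) ++ (range 5).map (fun i => rp (i+1)) ++ [[1,2],[1,3],[1,4],[1,10],[2,2],[1,1,2]]
def neg : List (List ℕ) := [rp 6, [1,1,1,2], [1,2,2], [2,2,2], [1,1,3], [1,1,4], [1,1,10], [8,2],[9,2],[10,2]] ++ (range 5).map (fun i => [1,i+5])
def ts (T1 T2 : List LL) (b : ℤ) (j k : ℕ) : Bool := fI (Cn T1 T2 j k) fun c => decide (b < c)
def pt (T2 T3 T12 : List LL) (b4 b5 b6 b22 : ℤ) (j k : ℕ) : Bool :=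
  bif Nat.beq k 0 && (Nat.beq j 1 || Nat.ble 7 j) then true
  else bif Nat.beq k 7 && Nat.beq j 8 then ts T3 T3 b6 j k
  else bif Nat.beq k 8 && Nat.beq j 9 then ts T12 T12 b22 j k
  else bif Nat.beq ((j+k)%2) 1 then ts T2 T2 b4 j k
  else ts T2 T3 b5 j k
def fc (E : Env) (p : ℕ) : LL := lk E (W [p])
def pB (s : List ℕ) (L : LL) (k : ℤ → Bool) : Bool := fL (wdX s L) fun L => agd L && fI (pz1 L) k
def tst (E : Env) : Bool :=
  (range 11).all (fun p => has E (W [p])) && pos.all (fun s => has E (W s) && tmf (lk E (W s))) &&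
  neg.all (fun s => has E (W s) && tbad (lk E (W s))) &&
  tab [1,1] (fc E) (fun T2 => tab [1] (fun p => T2.getD p []) (fun T3 => tab [1,2] (fc E) (fun T12 =>
    pB [1,1,1,1] (fc E 0) fun b4 => pB [1,1,1,1,1] (fc E 0) fun b5 => pB [1,1,1,1,1,1] (fc E 0) fun b6 => pB [1,2,1,2] (fc E 0) fun b22 =>
    (range 10).all fun j => (range j).all fun k => pt T2 T3 T12 b4 b5 b6 b22 j k)
    (range 11)) (range 11)) (range 11)
set_option maxRecDepth 100000 in
theorem big : run false crt E0 tst = true := by decide +kernel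

theorem ts_ok {T1 T2 b j k} (h : ts T1 T2 b j k = true) : b < Cn T1 T2 j k := by
  rw [ts, fI_eq] at h; exact of_decide_eq_true h
theorem pB_ok {s L k} (h : pB s L k = true) : agd (wdX s L) = true ∧ k (pz1 (wdX s L)) = true := by
  rw [pB, fL_eq, fI_eq] at h; simpa using h

theorem main : (∀ s ∈ pos, IsMFRes .C 10 5 (MFPaper.e 5 3) (lf (W s))) ∧ (∀ s ∈ neg, Bad (lf (W s))) ∧
    ∀ j k : Fin 10, k < j → ¬ ((k:ℕ) = 0 ∧ ((j:ℕ) = 1 ∨ 7 ≤ (j:ℕ))) → Bad (lf (W [j+1,k+2])) := by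
  obtain ⟨E, hE, h⟩ := run_ok crt E0 E0_ok tst big
  simp only [tst, and_eq_true, all_eq_true] at h
  obtain ⟨⟨⟨h0, hp⟩, hn⟩, ht⟩ := h
  refine ⟨fun s hs => tmf_ok _ _ (lk_ok E hE _ (hp s hs).1) (hp s hs).2,
    fun s hs => tbad_ok _ _ (lk_ok E hE _ (hn s hs).1) (hn s hs).2, ?_⟩
  have hf : ∀ p ≤ 10, ev ΦX (fc E p) = pwX [] * (rf p * AX) := by
    intro p hp
    rw [fc, ← (lk_ok E hE _ (h0 p (by simp; omega))).2 w0 ws0, rf, ff, if_pos hp]; simp [pwX]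
  have hS : ∀ p ≤ 11, Sy (rf p) := by
    intro p hp
    refine Sy_of _ ?_
    rcases Nat.lt_or_ge p 11 with h | h
    · have := hf p (by omega)
      rw [show pwX [] = 1 from rfl, one_mul] at this
      rw [← this]; exact PA_ev _
    · rw [show p = 11 by omega, rf_11, zero_mul]; exact PA_ev []
  obtain ⟨T2, h2, ht⟩ := tab_TOK _ _ _ _ ht hf
  obtain ⟨T3, h3, ht⟩ := tab_TOK _ _ _ _ ht fun p hp => (h2 p (by omega)).2
  obtain ⟨T12, h12, ht⟩ := tab_TOK _ _ _ _ ht hf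
  obtain ⟨g4, ht⟩ := pB_ok ht
  obtain ⟨g5, ht⟩ := pB_ok ht
  obtain ⟨g6, ht⟩ := pB_ok ht
  obtain ⟨g22, ht⟩ := pB_ok ht
  have hw : ∀ s, ev ΦX (wdX s (fc E 0)) = pwX s * AX := by
    intro s; rw [wdX_ok, hf 0 (by omega)]; simp [pwX, rf, ff_zero]
  intro j k hjk hne
  have h := all_eq_true.1 (all_eq_true.1 ht j (by simp)) k (by simpa using hjk)
  simp only [pt, Bool.cond_eq_ite, and_eq_true, Bool.or_eq_true, beq_eq, Nat.ble_eq] at h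
  rw [if_neg hne] at h
  split_ifs at h
  · exact crit [1,1,1] [1,1,1] T3 T3 _ h3 h3 hS g6 (hw _) j k hjk (ts_ok h)
  · exact crit [1,2] [1,2] T12 T12 _ h12 h12 hS g22 (hw _) j k hjk (ts_ok h)
  · exact crit [1,1] [1,1] T2 T2 _ h2 h2 hS g4 (hw _) j k hjk (ts_ok h)
  · exact crit [1,1] [1,1,1] T2 T3 _ h2 h3 hS g5 (hw _) j k hjk (ts_ok h)

theorem lfW (s : List ℕ) (m : Fin 10) : lf (W s) m = (s.filter fun x => Nat.beq x (m+1)).length := by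
  simp [lf, W]

theorem bad2 (j k : Fin 10) (h : k < j) (hne : ¬ ((k:ℕ) = 0 ∧ (j:ℕ) = 1)) : Bad (lf (W [j+1,k+2])) := by
  by_cases h0 : (k:ℕ) = 0 ∧ ((j:ℕ) = 1 ∨ 7 ≤ (j:ℕ))
  · have : [(j:ℕ)+1,k+2] ∈ neg := by
      have : (j:ℕ) = 7 ∨ (j:ℕ) = 8 ∨ (j:ℕ) = 9 := by omega
      rw [h0.1]
      rcases this with h | h | h <;> rw [h] <;> decide
    exact main.2.1 _ this
  · exact main.2.2 j k h h0

theorem bad_le {lam : Fin 10 → ℕ} (s) (hs : Bad (lf (W s))) (h : ∀ m : Fin 10, (s.filter fun x => Nat.beq x (m+1)).length ≤ lam m) : Bad lam :=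
  Bad_mono (fun m => by rw [lfW]; exact h m) hs

theorem cover (lam : Fin 10 → ℕ) (hlam0 : lam ≠ 0) (hb : ¬ Bad lam) :
      ((∃ i : ℕ, 2 ≤ i ∧ i ≤ 10 ∧ lam = MFPaper.e 10 i)
        ∨ (∃ c : ℕ, 1 ≤ c ∧ c ≤ 5 ∧ lam = c • MFPaper.e 10 1)
        ∨ lam = MFPaper.e 10 1 + MFPaper.e 10 2 ∨ lam = MFPaper.e 10 1 + MFPaper.e 10 3 ∨ lam = MFPaper.e 10 1 + MFPaper.e 10 4
        ∨ lam = MFPaper.e 10 1 + MFPaper.e 10 10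
        ∨ lam = 2 • MFPaper.e 10 2
        ∨ lam = 2 • MFPaper.e 10 1 + MFPaper.e 10 2) := by
  have nn1 : ∀ s ∈ neg, ¬ ∀ m : Fin 10, (s.filter fun x => Nat.beq x (m+1)).length ≤ lam m :=
    fun s hs h => hb (bad_le s (main.2.1 s hs) h)
  have flt : ∀ (a m : ℕ) (l : List ℕ), ((a :: l).filter fun x => Nat.beq x m).length = (if a = m then 1 else 0) + (l.filter fun x => Nat.beq x m).length := by
    intro a m l
    by_cases h : a = m
    · subst h; simp; omega
    · have : Nat.beq a m = false := by rw [eq_false_iff]; simpa using h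
      simp [h, this]
  have nn2 : ∀ i j : Fin 10, 0 < (i:ℕ) → i ≤ j → 1 ≤ lam i → 1 ≤ lam j → (i = j → 2 ≤ lam i ∧ 2 ≤ (i:ℕ)) → False := by
    intro i j hi hij h1 h2 h3
    have hij' : (i:ℕ) ≤ j := hij
    refine hb (bad_le _ (bad2 j ⟨i-1, by omega⟩ (by show (i:ℕ)-1 < j; omega) ?_) fun m => ?_)
    · rintro ⟨h4, h5⟩
      have : i = j := Fin.ext (by simp at h4; omega)
      have := (h3 this).2
      simp at h4; omega
    · rw [flt, flt]
      simp only [List.filter_nil, List.length_nil]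
      by_cases hm1 : m = i
      · subst hm1
        by_cases hm2 : m = j
        · have := (h3 hm2).1; split_ifs <;> omega
        · have : (m:ℕ) ≠ j := fun h => hm2 (Fin.ext h)
          split_ifs <;> omega
      · have h5 : (m:ℕ) ≠ i := fun h => hm1 (Fin.ext h)
        by_cases hm2 : m = j
        · subst hm2; split_ifs <;> omega
        · have : (m:ℕ) ≠ j := fun h => hm2 (Fin.ext h)
          split_ifs <;> omega
  by_cases hA : ∃ i : Fin 10, 0 < (i:ℕ) ∧ 1 ≤ lam i
  · obtain ⟨i, hi, h1⟩ := hA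
    have hz : ∀ m : Fin 10, 0 < (m:ℕ) → (m:ℕ) ≠ i → lam m = 0 := by
      intro m hm hmi
      by_contra h
      rcases lt_or_gt_of_ne hmi with h2 | h2
      · exact nn2 m i hm (le_of_lt h2) (by omega) h1 fun h => absurd (congrArg Fin.val h) hmi
      · exact nn2 i m hi (le_of_lt h2) h1 (by omega) fun h => absurd (congrArg Fin.val h).symm hmi
    have hle : 2 ≤ (i:ℕ) → lam i = 1 := by
      intro h; by_contra h2
      exact nn2 i i hi le_rfl h1 h1 fun _ => ⟨by omega, h⟩
    have nz : ∀ s ∈ neg, ((s.filter fun x => Nat.beq x 1).length ≤ lam 0) → ((s.filter fun x => Nat.beq x (i+1)).length ≤ lam i) →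
        ¬ ∀ m : Fin 10, 0 < (m:ℕ) → (m:ℕ) ≠ i → (s.filter fun x => Nat.beq x (m+1)).length = 0 := by
      intro s hs h2 h3 h4
      refine nn1 s hs fun m => ?_
      by_cases hm : m = 0
      · subst hm; exact h2
      by_cases hm2 : m = i
      · subst hm2; exact h3
      · rw [h4 m (Nat.pos_of_ne_zero fun h => hm (Fin.ext h)) fun h => hm2 (Fin.ext h)]; omega
    have eqn : ∀ mu : Fin 10 → ℕ, lam 0 = mu 0 → lam i = mu i → (∀ m : Fin 10, 0 < (m:ℕ) → (m:ℕ) ≠ i → mu m = 0) → lam = mu := by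
      intro mu h2 h3 h4
      funext m
      by_cases hm : m = 0
      · subst hm; exact h2
      by_cases hm2 : m = i
      · subst hm2; exact h3
      · have e1 := Nat.pos_of_ne_zero fun h => hm (Fin.ext h)
        have e2 : (m:ℕ) ≠ i := fun h => hm2 (Fin.ext h)
        rw [h4 m e1 e2, hz m e1 e2]
    by_cases hi1 : i = 1
    · subst hi1
      have b1 : lam 1 ≤ 2 := by
        by_contra h
        exact nz [2,2,2] (by decide) (by simp) (by simp; omega) (by decide)
      by_cases h2 : lam 1 = 2
      · have : lam 0 = 0 := by
          by_contra h
          exact nz [1,2,2] (by decide) (by simp; omega) (by simp; omega) (by decide)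
        right; right; right; right; right; right; left
        exact eqn _ (by rw [this]; decide) (by rw [h2]; decide) (by decide)
      · have h2 : lam 1 = 1 := by omega
        have b0 : lam 0 ≤ 2 := by
          by_contra h
          exact nz [1,1,1,2] (by decide) (by simp; omega) (by simp; omega) (by decide)
        have : lam 0 = 0 ∨ lam 0 = 1 ∨ lam 0 = 2 := by omega
        rcases this with h | h | h
        · left; exact ⟨2, by omega, by omega, eqn _ (by rw [h]; decide) (by rw [h2]; decide) (by decide)⟩
        · right; right; left; exact eqn _ (by rw [h]; decide) (by rw [h2]; decide) (by decide)
        · right; right; right; right; right; right; right; exact eqn _ (by rw [h]; decide) (by rw [h2]; decide) (by decide)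
    have h2 : lam i = 1 := hle (by have : (i:ℕ) ≠ 1 := fun h => hi1 (Fin.ext h); omega)
    by_cases h : lam 0 = 0
    · left
      refine ⟨i+1, by omega, by omega, eqn _ ?_ ?_ ?_⟩
      · rw [h]; simp [MFPaper.e]; omega
      · rw [h2]; simp [MFPaper.e]
      · intro m _ hm; simp [MFPaper.e, hm]
    have b0 : i = 2 ∨ i = 3 ∨ i = 9 → lam 0 = 1 := by
      intro hh
      by_contra h3
      refine nz [1,1,i+1] (by rcases hh with rfl | rfl | rfl <;> decide) ?_ ?_ ?_
      · rcases hh with rfl | rfl | rfl <;> simp <;> omega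
      · rcases hh with rfl | rfl | rfl <;> simp <;> omega
      · rcases hh with rfl | rfl | rfl <;> decide
    have b1 : i = 2 ∨ i = 3 ∨ i = 9 := by
      by_contra h3
      have : i = 4 ∨ i = 5 ∨ i = 6 ∨ i = 7 ∨ i = 8 := by
        clear * - hi hi1 h3; revert i; decide
      refine nz [1,i+1] (by rcases this with rfl | rfl | rfl | rfl | rfl <;> decide) ?_ ?_ ?_
      · rcases this with rfl | rfl | rfl | rfl | rfl <;> simp <;> omega
      · rcases this with rfl | rfl | rfl | rfl | rfl <;> simp <;> omega
      · rcases this with rfl | rfl | rfl | rfl | rfl <;> decide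
    have h3 := b0 b1
    rcases b1 with rfl | rfl | rfl
    · right; right; right; left; exact eqn _ (by rw [h3]; decide) (by rw [h2]; decide) (by decide)
    · right; right; right; right; left; exact eqn _ (by rw [h3]; decide) (by rw [h2]; decide) (by decide)
    · right; right; right; right; right; left; exact eqn _ (by rw [h3]; decide) (by rw [h2]; decide) (by decide)
  · push Not at hA
    have hz : ∀ m : Fin 10, m ≠ 0 → lam m = 0 := fun m hm => by
      have := hA m (Nat.pos_of_ne_zero fun h => hm (Fin.ext h)); omega
    right; left
    refine ⟨lam 0, ?_, ?_, ?_⟩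
    · by_contra h
      refine hlam0 (funext fun m => ?_)
      by_cases hm : m = 0
      · subst hm; simp; omega
      · exact hz m hm
    · by_contra h
      refine nn1 (rp 6) (by decide) fun m => ?_
      by_cases hm : m = 0
      · subst hm; simp [rp]; omega
      · have : ((rp 6).filter fun x => Nat.beq x (m+1)).length = 0 := by clear hz nn1 nn2; revert m; decide
        omega
    · funext m
      by_cases hm : m = 0
      · subst hm; simp [MFPaper.e]
      · rw [hz m hm]; simp [MFPaper.e]; exact fun h => absurd h hm

theorem final (lam : Fin 10 → ℕ) (hlam0 : lam ≠ 0) :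
    IsMFRes CType.C 10 5 (MFPaper.e 5 3) lam ↔
      ((∃ i : ℕ, 2 ≤ i ∧ i ≤ 10 ∧ lam = MFPaper.e 10 i)
        ∨ (∃ c : ℕ, 1 ≤ c ∧ c ≤ 5 ∧ lam = c • MFPaper.e 10 1)
        ∨ lam = MFPaper.e 10 1 + MFPaper.e 10 2 ∨ lam = MFPaper.e 10 1 + MFPaper.e 10 3 ∨ lam = MFPaper.e 10 1 + MFPaper.e 10 4
        ∨ lam = MFPaper.e 10 1 + MFPaper.e 10 10
        ∨ lam = 2 • MFPaper.e 10 2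
        ∨ lam = 2 • MFPaper.e 10 1 + MFPaper.e 10 2) := by
  constructor
  · intro h
    exact cover lam hlam0 fun hb => Bad_not ws0 lam hb h
  · have key : ∀ s ∈ pos, (lam = lf (W s)) → IsMFRes CType.C 10 5 (MFPaper.e 5 3) lam := fun s hs h => h ▸ main.1 s hs
    rintro (⟨i, h1, h2, rfl⟩ | ⟨i, h1, h2, rfl⟩ | rfl | rfl | rfl | rfl | rfl | rfl)
    · refine key [i] ?_ ?_
      · interval_cases i <;> decide
      · interval_cases i <;> decide
    · refine key (rp i) ?_ ?_
      · interval_cases i <;> decide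
      · interval_cases i <;> decide
    · exact key [1,2] (by decide) (by decide)
    · exact key [1,3] (by decide) (by decide)
    · exact key [1,4] (by decide) (by decide)
    · exact key [1,10] (by decide) (by decide)
    · exact key [2,2] (by decide) (by decide)
    · exact key [1,1,2] (by decide) (by decide)

end Cas

/-- **Theorem 8.1.**  Let `X = A₅ < Y = C₁₀ = Sp₂₀` via the 20-dimensional irreducible
representation `δ = ω₃`, and let `V = V_Y(lam)` with `lam ≠ 0, λ₁` a dominant weight
for `Y`.  Then `V↓X` is multiplicity-free if and only if `lam` is one of:
`λ_i (2 ≤ i ≤ 10)`, `cλ₁ (1 ≤ c ≤ 5)`, `λ₁+λ₂`, `λ₁+λ₃`, `λ₁+λ₄`, `λ₁+λ₁₀`,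
`2λ₂`, or `2λ₁+λ₂`. -/
theorem thm_A5_in_C10 (lam : Fin 10 → ℕ)
    (hlam0 : lam ≠ 0) (hlam1 : lam ≠ e 10 1) :
    IsMFRes CType.C 10 5 (e 5 3) lam ↔
      ((∃ i : ℕ, 2 ≤ i ∧ i ≤ 10 ∧ lam = e 10 i)
        ∨ (∃ c : ℕ, 1 ≤ c ∧ c ≤ 5 ∧ lam = c • e 10 1)
        ∨ lam = e 10 1 + e 10 2 ∨ lam = e 10 1 + e 10 3 ∨ lam = e 10 1 + e 10 4
        ∨ lam = e 10 1 + e 10 10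
        ∨ lam = 2 • e 10 2
        ∨ lam = 2 • e 10 1 + e 10 2) := by
  exact Cas.final lam hlam0
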